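/- arXiv:math/0503433 — 2 statements merged into one kernel-verified Lean document; each statement's English description precedes it below -/
import Mathlib

section
/- Let f : ℝ → ℝ be a C² map sending [0,1] into itself, whose critical set C = {x ∈ [0,1] : f'(x) = 0} is a finite non-degenerate critical set for f with exponent β > 0 and constant B > 0, and assume f satisfies the slow approximation condition with respect to C and Lebesgue measure on [0,1]. If there exists λ > 0 such that for Lebesgue-almost every x ∈ [0,1], liminf_{n→∞} (1/n) ∑_{i=0}^{n−1} log(1/|f'(f^i(x))|) ≤ −λ, then for Lebesgue-almost every x ∈ [0,1] one also has limsup_{n→∞} (1/n) ∑_{i=0}^{n−1} log(1/|f'(f^i(x))|) ≤ −λ; that is, the weaker liminf expansion condition already implies the non-uniform expansion (limsup) condition. (This is the one-dimensional case of the paper's Theorem 2.) -/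
open MeasureTheory Filter Metric Set

/-- The δ-truncated distance to the set `C`. -/
noncomputable def truncDist {X : Type*} [MetricSpace X] (δ : ℝ) (C : Set X) (x : X) : ℝ :=
  if infDist x C ≤ δ then infDist x C else 1

section ErgodicTheory

open Topology ENNReal

variable {X : Type*} [MeasurableSpace X]

/-- The Cesàro averages of the push-forwards of `m` under the iterates of `F`. -/
noncomputable def cesaroMeasure (m : Measure X) (F : X → X) (n : ℕ) : Measure X :=
  ((n : ℝ≥0∞) + 1)⁻¹ • ∑ i ∈ Finset.range (n + 1), m.map F^[i]

lemma cesaroMeasure_apply (m : Measure X) {F : X → X} (hF : Measurable F) (n : ℕ) {A : Set X}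
    (hA : MeasurableSet A) :
    cesaroMeasure m F n A =
      ((n : ℝ≥0∞) + 1)⁻¹ * ∑ i ∈ Finset.range (n + 1), m (F^[i] ⁻¹' A) := by
  simp only [cesaroMeasure, Measure.smul_apply, Measure.finsetSum_apply, smul_eq_mul]
  congr 1
  exact Finset.sum_congr rfl fun i _ => Measure.map_apply (hF.iterate i) hA

lemma inv_mul_sum_le {n : ℕ} {a : ℕ → ℝ≥0∞} {c : ℝ≥0∞} (h : ∀ i, a i ≤ c) :
    ((n : ℝ≥0∞) + 1)⁻¹ * ∑ i ∈ Finset.range (n + 1), a i ≤ c := by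
  calc _ ≤ ((n : ℝ≥0∞) + 1)⁻¹ * ∑ i ∈ Finset.range (n + 1), c := by gcongr; exact h _
    _ = (((n : ℝ≥0∞) + 1)⁻¹ * ((n : ℝ≥0∞) + 1)) * c := by
        rw [Finset.sum_const, Finset.card_range, nsmul_eq_mul]; push_cast; ring
    _ = c := by
        rw [ENNReal.inv_mul_cancel (by positivity) (by finiteness), one_mul]

/-- If the push-forwards of a finite measure under all iterates of a map are uniformly dominated,
then there is a dominated invariant measure which agrees with the original one on invariant
sets. -/
theorem exists_invariant_measure (m : Measure X) [IsFiniteMeasure m] {F : X → X}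
    (hF : Measurable F) {K : ℝ≥0∞} (hK : K ≠ ∞)
    (h : ∀ k A, MeasurableSet A → m (F^[k] ⁻¹' A) ≤ K * m A) :
    ∃ ν : Measure X, IsFiniteMeasure ν ∧ MeasurePreserving F ν ν ∧ ν ≪ m ∧
      ∀ A, MeasurableSet A → F ⁻¹' A = A → ν A = m A := by
  set a := cesaroMeasure m F with ha
  let U : Ultrafilter ℕ := hyperfilter ℕ
  let L : Set X → ℝ≥0∞ := fun A => (U.map (fun n => a n A)).lim
  have hL : ∀ A, Tendsto (fun n => a n A) U (𝓝 (L A)) := fun A =>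
    (U.map (fun n => a n A)).le_nhds_lim
  have hU : (U : Filter ℕ) ≤ atTop := Nat.hyperfilter_le_atTop
  have haK : ∀ n A, MeasurableSet A → a n A ≤ K * m A := fun n A hA => by
    rw [ha, cesaroMeasure_apply m hF n hA]
    exact inv_mul_sum_le fun i => h i A hA
  have hLK : ∀ A, MeasurableSet A → L A ≤ K * m A := fun A hA =>
    le_of_tendsto' (hL A) fun n => haK n A hA
  have hunion : ∀ A B, MeasurableSet B → Disjoint A B → L (A ∪ B) = L A + L B :=
    fun A B hB hAB => by
    refine tendsto_nhds_unique (hL _) ?_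
    simp_rw [measure_union hAB hB]
    exact (hL A).add (hL B)
  have hL0 : L ∅ = 0 := by simpa using hLK ∅ MeasurableSet.empty
  have hsum : ∀ (f : ℕ → Set X), (∀ i, MeasurableSet (f i)) →
      Pairwise (Function.onFun Disjoint f) → L (⋃ i, f i) = ∑' i, L (f i) := fun f hf hd => by
    have hstep : ∀ N, L (⋃ i, f i) = ∑ i ∈ Finset.range N, L (f i) + L (⋃ i, f (i + N)) := by
      intro N
      induction N with
      | zero => simp
      | succ N ih =>
        rw [ih, Finset.sum_range_succ, add_assoc]
        congr 1
        rw [← hunion _ _ (MeasurableSet.iUnion fun i => hf _)]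
        · congr 1
          ext x
          simp only [mem_iUnion, mem_union]
          constructor
          · rintro ⟨i, hi⟩
            rcases i with _ | i
            · left; simpa using hi
            · right; exact ⟨i, by convert hi using 2; ring⟩
          · rintro (hx | ⟨i, hi⟩)
            · exact ⟨0, by simpa using hx⟩
            · exact ⟨i + 1, by convert hi using 2; ring⟩
        · rw [disjoint_iUnion_right]
          intro i
          exact hd (by omega)
    have htail : Tendsto (fun N => L (⋃ i, f (i + N))) atTop (𝓝 0) := by
      have h1 : Tendsto (fun N => ∑' i, m (f (i + N))) atTop (𝓝 0) :=
        ENNReal.tendsto_sum_nat_add _ (by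
          rw [← measure_iUnion (μ := m) hd hf]; exact measure_ne_top m _)
      have h2 : Tendsto (fun N => K * ∑' i, m (f (i + N))) atTop (𝓝 (K * 0)) :=
        ENNReal.Tendsto.const_mul h1 (Or.inr hK)
      rw [mul_zero] at h2
      refine tendsto_of_tendsto_of_tendsto_of_le_of_le tendsto_const_nhds h2
        (fun _ => zero_le) fun N => ?_
      refine (hLK _ (MeasurableSet.iUnion fun i => hf _)).trans ?_
      gcongr
      exact measure_iUnion_le _
    have h3 := (ENNReal.tendsto_nat_tsum fun i => L (f i)).add htail
    rw [add_zero] at h3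
    refine tendsto_nhds_unique ?_ h3
    exact tendsto_const_nhds.congr fun N => hstep N
  let ν : Measure X := Measure.ofMeasurable (fun A _ => L A) hL0 fun f hf hd => hsum f hf hd
  have hν : ∀ A, MeasurableSet A → ν A = L A := fun A hA => Measure.ofMeasurable_apply A hA
  have hinv : ∀ A, MeasurableSet A → L (F ⁻¹' A) = L A := fun A hA => by
    have hc : Tendsto (fun n : ℕ => ((n : ℝ≥0∞) + 1)⁻¹ * m univ) U (𝓝 0) := by
      have : Tendsto (fun n : ℕ => ((n + 1 : ℕ) : ℝ≥0∞)⁻¹) atTop (𝓝 0) :=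
        (tendsto_add_atTop_iff_nat (f := fun n : ℕ => (n : ℝ≥0∞)⁻¹) 1).2
          ENNReal.tendsto_inv_nat_nhds_zero
      have h2 := ENNReal.Tendsto.mul_const this (Or.inr (measure_ne_top m univ))
      rw [zero_mul] at h2
      refine (h2.mono_left hU).congr fun n => ?_
      push_cast; rfl
    have key : ∀ n, a n (F ⁻¹' A) + ((n : ℝ≥0∞) + 1)⁻¹ * m A =
        a n A + ((n : ℝ≥0∞) + 1)⁻¹ * m (F^[n + 1] ⁻¹' A) := fun n => by
      rw [ha, cesaroMeasure_apply m hF n hA, cesaroMeasure_apply m hF n (hF hA), ← mul_add,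
        ← mul_add]
      congr 1
      rw [← Finset.sum_range_succ (fun i => m (F^[i] ⁻¹' A)) (n + 1), Finset.sum_range_succ' _ (n + 1)]
      congr 1
      refine Finset.sum_congr rfl fun i _ => ?_
      rw [Function.iterate_succ', preimage_comp]
    have hz : ∀ B : ℕ → Set X, Tendsto (fun n : ℕ => ((n : ℝ≥0∞) + 1)⁻¹ * m (B n)) U (𝓝 0) :=
      fun B => tendsto_of_tendsto_of_tendsto_of_le_of_le tendsto_const_nhds hc
        (fun _ => zero_le) fun n => by
          show _ ≤ ((n : ℝ≥0∞) + 1)⁻¹ * m univ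
          gcongr; exact subset_univ _
    have h1 := (hL (F ⁻¹' A)).add (hz fun _ => A)
    have h2 := (hL A).add (hz fun n => F^[n + 1] ⁻¹' A)
    rw [add_zero] at h1 h2
    exact tendsto_nhds_unique (h1.congr key) h2
  refine ⟨ν, ⟨?_⟩, ⟨hF, ?_⟩, ?_, ?_⟩
  · rw [hν _ MeasurableSet.univ]
    exact (hLK _ MeasurableSet.univ).trans_lt (by finiteness)
  · ext A hA
    rw [Measure.map_apply hF hA, hν _ (hF hA), hν _ hA, hinv A hA]
  · refine Measure.AbsolutelyContinuous.mk fun A hA h0 => ?_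
    rw [hν A hA]
    simpa [h0] using hLK A hA
  · intro A hA hFA
    rw [hν A hA]
    refine tendsto_nhds_unique (hL A) (tendsto_const_nhds.congr fun n => ?_)
    have : ∀ i, F^[i] ⁻¹' A = A := fun i => by
      induction i with
      | zero => rfl
      | succ i ih => rw [Function.iterate_succ', preimage_comp, hFA, ih]
    rw [ha, cesaroMeasure_apply m hF n hA]
    simp_rw [this]
    rw [Finset.sum_const, Finset.card_range, nsmul_eq_mul, ← mul_assoc]
    push_cast
    rw [ENNReal.inv_mul_cancel (by positivity) (by finiteness), one_mul]

end ErgodicTheory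

section Birkhoff

open Topology ENNReal

variable {X : Type*} [MeasurableSpace X]

lemma integrable_birkhoffSum {ν : Measure X} {T : X → X} (hT : MeasurePreserving T ν ν)
    {φ : X → ℝ} (hφ : Integrable φ ν) (n : ℕ) : Integrable (birkhoffSum T φ n) ν := by
  have : birkhoffSum T φ n = fun x => ∑ k ∈ Finset.range n, φ (T^[k] x) := rfl
  rw [this]
  exact integrable_finsetSum _ fun k _ => (hT.iterate k).integrable_comp_of_integrable hφ

lemma measurable_birkhoffSum {T : X → X} (hT : Measurable T) {φ : X → ℝ} (hφ : Measurable φ)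
    (n : ℕ) : Measurable (birkhoffSum T φ n) := by
  have : birkhoffSum T φ n = fun x => ∑ k ∈ Finset.range n, φ (T^[k] x) := rfl
  rw [this]
  exact Finset.measurable_sum _ fun k _ => hφ.comp (hT.iterate k)

/-- The maximal ergodic theorem. -/
theorem setIntegral_nonneg_of_exists_birkhoffSum_pos {ν : Measure X} {T : X → X}
    (hT : MeasurePreserving T ν ν) {φ : X → ℝ} (hφm : Measurable φ) (hφ : Integrable φ ν) :
    0 ≤ ∫ x in {x | ∃ n, 0 < birkhoffSum T φ n x}, φ x ∂ν := by
  let M : ℕ → X → ℝ := fun n x => partialSups (fun k => birkhoffSum T φ k x) n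
  have hM_succ : ∀ n x, M (n + 1) x = M n x ⊔ birkhoffSum T φ (n + 1) x := fun n x =>
    partialSups_add_one _ _
  have hM_zero : ∀ x, M 0 x = 0 := fun x => by simp [M]
  have hM_meas : ∀ n, Measurable (M n) := fun n => by
    induction n with
    | zero => simp [funext hM_zero]
    | succ n ih =>
      rw [funext (hM_succ n)]
      exact ih.sup (measurable_birkhoffSum hT.measurable hφm _)
  have hM_int : ∀ n, Integrable (M n) ν := fun n => by
    induction n with
    | zero => simp [funext hM_zero]
    | succ n ih =>
      rw [funext (hM_succ n)]
      exact ih.sup (integrable_birkhoffSum hT hφ _)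
  have hM_nonneg : ∀ n x, 0 ≤ M n x := fun n x => by
    rw [← hM_zero x]
    exact (partialSups (fun k => birkhoffSum T φ k x)).monotone (Nat.zero_le n)
  have hM_mono : ∀ x, Monotone fun n => M n x := fun x =>
    (partialSups (fun k => birkhoffSum T φ k x)).monotone
  have hle : ∀ n x, 0 < M n x → M n x ≤ M n (T x) + φ x := by
    intro n x hx
    have h1 : ∀ k ≤ n, birkhoffSum T φ k x ≤ max 0 (M n (T x) + φ x) := by
      intro k hk
      rcases k with _ | k
      · simp
      · rw [birkhoffSum_succ']
        have : birkhoffSum T φ k (T x) ≤ M n (T x) :=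
          le_partialSups_of_le (fun k => birkhoffSum T φ k (T x)) (by omega)
        exact le_max_of_le_right (by linarith)
    have h2 : M n x ≤ max 0 (M n (T x) + φ x) := partialSups_le _ _ _ h1
    rcases le_max_iff.1 h2 with h | h
    · linarith
    · exact h
  let A : ℕ → Set X := fun n => {x | 0 < M n x}
  have hA_meas : ∀ n, MeasurableSet (A n) := fun n => measurableSet_lt measurable_const (hM_meas n)
  have hA_mono : Monotone A := fun i j hij x hx => lt_of_lt_of_le hx (hM_mono x hij)
  have hA_union : ⋃ n, A n = {x | ∃ n, 0 < birkhoffSum T φ n x} := by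
    ext x
    simp only [mem_iUnion, A, mem_ofPred_eq]
    constructor
    · rintro ⟨n, hn⟩
      by_contra! hcon
      exact absurd (partialSups_le (fun k => birkhoffSum T φ k x) n 0 fun k _ => hcon k)
        (not_le.2 hn)
    · rintro ⟨n, hn⟩
      exact ⟨n, lt_of_lt_of_le hn (le_partialSups (fun k => birkhoffSum T φ k x) n)⟩
  have hA_nonneg : ∀ n, 0 ≤ ∫ x in A n, φ x ∂ν := by
    intro n
    have hMT : Integrable (fun x => M n (T x)) ν := hT.integrable_comp_of_integrable (hM_int n)
    have h1 : ∫ x in A n, (M n x - M n (T x)) ∂ν ≤ ∫ x in A n, φ x ∂ν := by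
      refine setIntegral_mono_on ((hM_int n).sub hMT).integrableOn hφ.integrableOn (hA_meas n)
        fun x hx => ?_
      have := hle n x hx
      linarith
    rw [integral_sub (hM_int n).integrableOn hMT.integrableOn] at h1
    have h2 : ∫ x in A n, M n x ∂ν = ∫ x, M n x ∂ν := by
      refine setIntegral_eq_integral_of_forall_compl_eq_zero fun x hx => ?_
      exact le_antisymm (not_lt.1 hx) (hM_nonneg n x)
    have h3 : ∫ x in A n, M n (T x) ∂ν ≤ ∫ x, M n (T x) ∂ν :=
      setIntegral_le_integral hMT (Eventually.of_forall fun x => hM_nonneg n _)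
    have h4 : ∫ x, M n (T x) ∂ν = ∫ x, M n x ∂ν := by
      have := integral_map (μ := ν) hT.measurable.aemeasurable
        (f := M n) (hM_meas n).aestronglyMeasurable
      rw [hT.map_eq] at this
      exact this.symm
    linarith
  rw [← hA_union]
  exact ge_of_tendsto' (tendsto_setIntegral_of_monotone hA_meas hA_mono hφ.integrableOn) hA_nonneg

/-- Points whose ergodic sums drop infinitely often below a line of slope less than `α`. -/
def lowSet (T : X → X) (φ : X → ℝ) (α : ℝ) : Set X :=
  {x | ∃ a : ℚ, (a : ℝ) < α ∧ ∃ᶠ n : ℕ in atTop, birkhoffSum T φ n x < a * n}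

lemma frequently_linear_lt {u v : ℕ → ℝ} {a a' c : ℝ} (haa : a < a')
    (h : ∃ᶠ n : ℕ in atTop, u n < a * n) (huv : ∀ n, v n ≤ u n + c) :
    ∃ᶠ n : ℕ in atTop, v n < a' * n := by
  have : ∀ᶠ n : ℕ in atTop, c < (a' - a) * n := by
    have := (tendsto_natCast_atTop_atTop (R := ℝ)).const_mul_atTop (sub_pos.2 haa)
    exact this.eventually_gt_atTop c
  refine (h.and_eventually this).mono fun n hn => ?_
  have := huv n
  nlinarith [hn.1, hn.2]

lemma mem_lowSet_iff {T : X → X} {φ : X → ℝ} {α : ℝ} {x : X} :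
    x ∈ lowSet T φ α ↔ ∃ a : ℝ, a < α ∧ ∃ᶠ n : ℕ in atTop, birkhoffSum T φ n x < a * n := by
  constructor
  · rintro ⟨a, ha, h⟩
    exact ⟨a, ha, h⟩
  · rintro ⟨a, ha, h⟩
    obtain ⟨q, hq, hq'⟩ := exists_rat_btwn ha
    exact ⟨q, hq', frequently_linear_lt hq h (c := 0) fun n => by simp⟩

lemma preimage_lowSet (T : X → X) (φ : X → ℝ) (α : ℝ) :
    T ⁻¹' lowSet T φ α = lowSet T φ α := by
  ext x
  simp only [mem_preimage, mem_lowSet_iff]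
  constructor
  · rintro ⟨a, ha, h⟩
    obtain ⟨b, hab, hb⟩ := exists_between ha
    refine ⟨b, hb, ?_⟩
    have h1 : ∃ᶠ n : ℕ in atTop, birkhoffSum T φ (n + 1) x - φ x + a < a * (n + 1 : ℕ) :=
      h.mono fun n hn => by
        rw [birkhoffSum_succ']; push_cast; linarith
    have h2 : ∃ᶠ n : ℕ in atTop, birkhoffSum T φ n x - φ x + a < a * n := by
      rw [frequently_atTop] at h1 ⊢
      intro N
      obtain ⟨n, hn, h⟩ := h1 N
      exact ⟨n + 1, by omega, h⟩
    exact frequently_linear_lt hab h2 (c := φ x - a) fun n => by linarith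
  · rintro ⟨a, ha, h⟩
    obtain ⟨b, hab, hb⟩ := exists_between ha
    refine ⟨b, hb, ?_⟩
    have h1 : ∃ᶠ n : ℕ in atTop, birkhoffSum T φ (n + 1) x - a < a * n := by
      rw [frequently_atTop] at h ⊢
      intro N
      obtain ⟨n, hn, h⟩ := h (N + 1)
      obtain ⟨k, rfl⟩ : ∃ k, n = k + 1 := ⟨n - 1, by omega⟩
      refine ⟨k, by omega, ?_⟩
      push_cast at h
      linarith
    exact frequently_linear_lt hab h1 (c := a - φ x) fun n => by
      rw [birkhoffSum_succ']; linarith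

lemma measurableSet_lowSet {T : X → X} (hT : Measurable T) {φ : X → ℝ} (hφ : Measurable φ)
    (α : ℝ) : MeasurableSet (lowSet T φ α) := by
  have : lowSet T φ α = ⋃ (a : ℚ) (_ : (a : ℝ) < α), ⋂ N : ℕ, ⋃ (n : ℕ) (_ : N ≤ n),
      {x | birkhoffSum T φ n x < a * n} := by
    ext x
    simp [lowSet, frequently_atTop]
  rw [this]
  refine MeasurableSet.iUnion fun a => MeasurableSet.iUnion fun _ => MeasurableSet.iInter fun N =>
    MeasurableSet.iUnion fun n => MeasurableSet.iUnion fun _ => ?_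
  exact measurableSet_lt (measurable_birkhoffSum hT hφ n) measurable_const

lemma setIntegral_le_of_subset_lowSet {ν : Measure X} [IsFiniteMeasure ν] {T : X → X}
    (hT : MeasurePreserving T ν ν) {φ : X → ℝ} (hφm : Measurable φ) (hφ : Integrable φ ν)
    {α : ℝ} {A : Set X} (hA : MeasurableSet A) (hTA : T ⁻¹' A = A) (hAs : A ⊆ lowSet T φ α) :
    ∫ x in A, φ x ∂ν ≤ α * ν.real A := by
  have hTr : MeasurePreserving T (ν.restrict A) (ν.restrict A) := by
    have := hT.restrict_preimage hA
    rwa [hTA] at this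
  have hi : Integrable (fun x => α - φ x) (ν.restrict A) :=
    (integrable_const α).sub hφ.integrableOn
  have h1 := setIntegral_nonneg_of_exists_birkhoffSum_pos hTr
    (φ := fun x => α - φ x) (measurable_const.sub hφm) hi
  have hsum : ∀ n x, birkhoffSum T (fun x => α - φ x) n x = α * n - birkhoffSum T φ n x := by
    intro n x
    simp [birkhoffSum, Finset.sum_sub_distrib, mul_comm]
  have hsub : A ⊆ {x | ∃ n, 0 < birkhoffSum T (fun x => α - φ x) n x} := by
    intro x hx
    obtain ⟨a, ha, h⟩ := mem_lowSet_iff.1 (hAs hx)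
    obtain ⟨n, hn⟩ := h.exists
    refine ⟨n, ?_⟩
    rw [hsum]
    have : a * n ≤ α * n := by gcongr
    linarith
  rw [Measure.restrict_eq_self_of_ae_mem ((ae_restrict_mem hA).mono fun x hx => hsub hx)] at h1
  rw [integral_sub (integrable_const α) hφ.integrableOn] at h1
  simp only [integral_const, smul_eq_mul, measureReal_restrict_apply_univ] at h1
  linarith

lemma birkhoffSum_neg' (T : X → X) (φ : X → ℝ) (n : ℕ) (x : X) :
    birkhoffSum T (fun x => -φ x) n x = -birkhoffSum T φ n x := by
  simp [birkhoffSum]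

lemma le_setIntegral_of_subset_lowSet_neg {ν : Measure X} [IsFiniteMeasure ν] {T : X → X}
    (hT : MeasurePreserving T ν ν) {φ : X → ℝ} (hφm : Measurable φ) (hφ : Integrable φ ν)
    {β : ℝ} {A : Set X} (hA : MeasurableSet A) (hTA : T ⁻¹' A = A)
    (hAs : A ⊆ lowSet T (fun x => -φ x) (-β)) :
    β * ν.real A ≤ ∫ x in A, φ x ∂ν := by
  have := setIntegral_le_of_subset_lowSet hT hφm.neg hφ.neg hA hTA hAs
  simp only [Pi.neg_apply] at this
  rw [integral_neg] at this
  linarith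

lemma measure_iInter_lowSet {ν : Measure X} [IsFiniteMeasure ν] {T : X → X}
    (hT : MeasurePreserving T ν ν) {φ : X → ℝ} (hφm : Measurable φ) (hφ : Integrable φ ν) :
    ν (⋂ k : ℕ, lowSet T φ (-k)) = 0 := by
  set A := ⋂ k : ℕ, lowSet T φ (-k) with hAdef
  have hA : MeasurableSet A := MeasurableSet.iInter fun k => measurableSet_lowSet hT.measurable hφm _
  have hTA : T ⁻¹' A = A := by
    rw [hAdef, preimage_iInter]
    simp_rw [preimage_lowSet]
  have hr : ν.real A = 0 := by
    by_contra hne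
    have hpos : 0 < ν.real A := lt_of_le_of_ne measureReal_nonneg (Ne.symm hne)
    obtain ⟨k, hk⟩ := exists_nat_gt (-(∫ x in A, φ x ∂ν) / ν.real A)
    have := setIntegral_le_of_subset_lowSet hT hφm hφ hA hTA (iInter_subset _ k)
    rw [div_lt_iff₀ hpos] at hk
    linarith
  rwa [measureReal_eq_zero_iff] at hr

/-- Birkhoff's pointwise ergodic theorem (existence of the limit). -/
theorem ae_exists_tendsto_birkhoffSum_div {ν : Measure X} [IsFiniteMeasure ν] {T : X → X}
    (hT : MeasurePreserving T ν ν) {φ : X → ℝ} (hφm : Measurable φ) (hφ : Integrable φ ν) :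
    ∀ᵐ x ∂ν, ∃ l : ℝ, Tendsto (fun n : ℕ => birkhoffSum T φ n x / n) atTop (𝓝 l) := by
  have h1 : ∀ᵐ x ∂ν, x ∉ ⋂ k : ℕ, lowSet T φ (-k) :=
    measure_eq_zero_iff_ae_notMem.1 (measure_iInter_lowSet hT hφm hφ)
  have h2 : ∀ᵐ x ∂ν, x ∉ ⋂ k : ℕ, lowSet T (fun x => -φ x) (-k) :=
    measure_eq_zero_iff_ae_notMem.1 (measure_iInter_lowSet hT hφm.neg hφ.neg)
  have h3 : ∀ᵐ x ∂ν, ∀ p q : ℚ, (p : ℝ) < q →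
      x ∉ lowSet T φ p ∩ lowSet T (fun x => -φ x) (-q) := by
    rw [ae_all_iff]; intro p
    rw [ae_all_iff]; intro q
    by_cases hpq : (p : ℝ) < q
    · have : ν (lowSet T φ p ∩ lowSet T (fun x => -φ x) (-q)) = 0 := by
        set A := lowSet T φ p ∩ lowSet T (fun x => -φ x) (-q) with hAdef
        have hA : MeasurableSet A := (measurableSet_lowSet hT.measurable hφm _).inter
          (measurableSet_lowSet hT.measurable hφm.neg _)
        have hTA : T ⁻¹' A = A := by
          rw [hAdef, preimage_inter, preimage_lowSet, preimage_lowSet]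
        have e1 := setIntegral_le_of_subset_lowSet hT hφm hφ hA hTA inter_subset_left
        have e2 := le_setIntegral_of_subset_lowSet_neg hT hφm hφ hA hTA inter_subset_right
        have e3 : 0 ≤ ν.real A := measureReal_nonneg
        have : ν.real A = 0 := by nlinarith
        rwa [measureReal_eq_zero_iff] at this
      filter_upwards [measure_eq_zero_iff_ae_notMem.1 this] with x hx _ using hx
    · exact Eventually.of_forall fun x h => absurd h hpq
  filter_upwards [h1, h2, h3] with x hx1 hx2 hx3
  have hlow : ∀ {ψ : X → ℝ} {a a' : ℝ}, a < a' →
      (∃ᶠ n : ℕ in atTop, birkhoffSum T ψ n x / n < a) → x ∈ lowSet T ψ a' := by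
    intro ψ a a' haa h
    refine mem_lowSet_iff.2 ⟨a, haa, ?_⟩
    refine (h.and_eventually (eventually_gt_atTop 0)).mono fun n hn => ?_
    exact (div_lt_iff₀ (by exact_mod_cast hn.2)).1 hn.1
  refine tendsto_of_no_upcrossings Rat.denseRange_cast ?_ ?_ ?_
  · rintro _ ⟨p, rfl⟩ _ ⟨q, rfl⟩ hpq ⟨ha, hb⟩
    obtain ⟨p', hp, hp'⟩ := exists_rat_btwn hpq
    obtain ⟨q', hq, hq'⟩ := exists_rat_btwn hp'
    refine hx3 p' q' hq ⟨hlow hp ha, ?_⟩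
    refine hlow (neg_lt_neg hq') (hb.mono fun n hn => ?_)
    rw [birkhoffSum_neg', neg_div]
    linarith
  · simp only [mem_iInter, not_forall] at hx2
    obtain ⟨k, hk⟩ := hx2
    refine ⟨(k : ℝ) + 1, ?_⟩
    rw [eventually_map]
    by_contra hcon
    refine hk (hlow (a := -((k : ℝ) + 1)) (by linarith) ?_)
    refine (not_eventually.1 hcon).mono fun n hn => ?_
    rw [birkhoffSum_neg', neg_div]
    linarith [not_le.1 hn]
  · simp only [mem_iInter, not_forall] at hx1
    obtain ⟨k, hk⟩ := hx1
    refine ⟨-((k : ℝ) + 1), ?_⟩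
    rw [eventually_map]
    by_contra hcon
    refine hk (hlow (a := -((k : ℝ) + 1)) (by linarith) ?_)
    exact (not_eventually.1 hcon).mono fun n hn => not_le.1 hn

lemma exists_tendsto_birkhoffSum_div_comp_iff (T : X → X) (φ : X → ℝ) (x : X) :
    (∃ l : ℝ, Tendsto (fun n : ℕ => birkhoffSum T φ n (T x) / n) atTop (𝓝 l)) ↔
      ∃ l : ℝ, Tendsto (fun n : ℕ => birkhoffSum T φ n x / n) atTop (𝓝 l) := by
  have hz : Tendsto (fun n : ℕ => φ x / n) atTop (𝓝 0) := tendsto_const_div_atTop_nhds_zero_nat _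
  have h1 : Tendsto (fun n : ℕ => ((n : ℝ) + 1) / n) atTop (𝓝 1) := by
    have : Tendsto (fun n : ℕ => 1 + 1 / (n : ℝ)) atTop (𝓝 (1 + 0)) :=
      tendsto_const_nhds.add (tendsto_const_div_atTop_nhds_zero_nat 1)
    rw [add_zero] at this
    refine this.congr' ?_
    filter_upwards [eventually_gt_atTop 0] with n hn
    have : (n : ℝ) ≠ 0 := by positivity
    field_simp
  constructor
  · rintro ⟨l, hl⟩
    refine ⟨l, ?_⟩
    rw [← tendsto_add_atTop_iff_nat 1]
    have h2 := (hl.add hz).div h1 one_ne_zero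
    rw [add_zero, div_one] at h2
    refine h2.congr' ?_
    filter_upwards [eventually_gt_atTop 0] with n hn
    have : (n : ℝ) ≠ 0 := by positivity
    have : (n : ℝ) + 1 ≠ 0 := by positivity
    simp only [Pi.div_apply]
    rw [birkhoffSum_succ']
    push_cast
    field_simp
    ring
  · rintro ⟨l, hl⟩
    refine ⟨l, ?_⟩
    rw [← tendsto_add_atTop_iff_nat 1] at hl
    have h2 := (hl.mul h1).sub hz
    rw [sub_zero, mul_one] at h2
    refine h2.congr' ?_
    filter_upwards [eventually_gt_atTop 0] with n hn
    have : (n : ℝ) ≠ 0 := by positivity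
    have : (n : ℝ) + 1 ≠ 0 := by positivity
    rw [birkhoffSum_succ']
    push_cast
    field_simp
    ring

/-- Convergence of the ergodic averages of a nonnegative `R` with frequently bounded averages, and
of any observable `Φ` controlled by `R`, with respect to a measure whose push-forwards are uniformly
dominated. -/
theorem ae_exists_tendsto_of_dominated_pushforward (m : Measure X) [IsFiniteMeasure m] {F : X → X}
    (hF : Measurable F) {K : ℝ≥0∞} (hK : K ≠ ∞)
    (h : ∀ k A, MeasurableSet A → m (F^[k] ⁻¹' A) ≤ K * m A)
    {R Φ : X → ℝ} (hRm : Measurable R) (hΦm : Measurable Φ) (hR0 : ∀ x, 0 ≤ R x) {a b c : ℝ}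
    (hΦ : ∀ᵐ x ∂m, |Φ x| ≤ a * R x + b)
    (hRc : ∀ᵐ x ∂m, ∃ k, birkhoffSum F R k x < c * k) :
    ∀ᵐ x ∂m, (∃ l : ℝ, Tendsto (fun n : ℕ => birkhoffSum F R n x / n) atTop (𝓝 l)) ∧
      ∃ l : ℝ, Tendsto (fun n : ℕ => birkhoffSum F Φ n x / n) atTop (𝓝 l) := by
  obtain ⟨ν, hνfin, hν, hνm, hνinv⟩ := exists_invariant_measure m hF hK h
  have htrans : ∀ φ : X → ℝ, Measurable φ → Integrable φ ν →
      ∀ᵐ x ∂m, ∃ l : ℝ, Tendsto (fun n : ℕ => birkhoffSum F φ n x / n) atTop (𝓝 l) := by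
    intro φ hφm hφ
    have hB := ae_exists_tendsto_birkhoffSum_div hν hφm hφ
    rw [ae_iff] at hB ⊢
    rw [← hνinv _ _ _]
    · exact hB
    · refine (measurableSet_exists_tendsto fun n => ?_).compl
      exact (measurable_birkhoffSum hF hφm n).div_const _
    · ext x
      simp only [mem_preimage, mem_ofPred_eq]
      rw [exists_tendsto_birkhoffSum_div_comp_iff]
  have hRi : Integrable R ν := by
    have hbd : ∀ N : ℕ, ∫ x, min (R x) N ∂ν ≤ c * ν.real univ := by
      intro N
      have hi : Integrable (fun x => min (R x) N) ν := by
        refine Integrable.mono' (integrable_const (N : ℝ))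
          (hRm.min measurable_const).aestronglyMeasurable (Eventually.of_forall fun x => ?_)
        rw [Real.norm_eq_abs, abs_of_nonneg (le_min (hR0 x) (by positivity))]
        exact min_le_right _ _
      have hi' : Integrable (fun x => c - min (R x) N) ν := (integrable_const c).sub hi
      have h1 := setIntegral_nonneg_of_exists_birkhoffSum_pos hν
        (φ := fun x => c - min (R x) N) (measurable_const.sub (hRm.min measurable_const)) hi'
      have h2 : ∀ᵐ x ∂ν, x ∈ {x | ∃ n, 0 < birkhoffSum F (fun x => c - min (R x) N) n x} := by
        filter_upwards [hνm.ae_le hRc] with x hx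
        obtain ⟨k, hk⟩ := hx
        refine ⟨k, ?_⟩
        have : birkhoffSum F (fun x => min (R x) N) k x ≤ birkhoffSum F R k x :=
          Finset.sum_le_sum fun i _ => min_le_left _ _
        have e : birkhoffSum F (fun x => c - min (R x) N) k x =
            c * k - birkhoffSum F (fun x => min (R x) N) k x := by
          simp [birkhoffSum, Finset.sum_sub_distrib, mul_comm]
        rw [e]
        linarith
      rw [setIntegral_congr_set (t := univ) (by
        filter_upwards [h2] with x hx
        exact propext ⟨fun _ => trivial, fun _ => hx⟩)] at h1
      rw [Measure.restrict_univ, integral_sub (integrable_const c) hi] at h1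
      simp only [integral_const, smul_eq_mul] at h1
      linarith
    refine ⟨hRm.aestronglyMeasurable, ?_⟩
    rw [hasFiniteIntegral_iff_ofReal (Eventually.of_forall hR0)]
    have hmon : ∫⁻ x, ENNReal.ofReal (R x) ∂ν =
        ⨆ N : ℕ, ∫⁻ x, ENNReal.ofReal (min (R x) N) ∂ν := by
      rw [← lintegral_iSup (fun N => (hRm.min measurable_const).ennreal_ofReal)
        (fun i j hij x => ENNReal.ofReal_le_ofReal (min_le_min_left _ (by exact_mod_cast hij)))]
      congr 1
      ext x
      apply le_antisymm
      · obtain ⟨N, hN⟩ := exists_nat_ge (R x)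
        refine le_iSup_of_le N ?_
        rw [min_eq_left hN]
      · exact iSup_le fun N => ENNReal.ofReal_le_ofReal (min_le_left _ _)
    rw [hmon]
    refine lt_of_le_of_lt (iSup_le fun N => ?_) (ENNReal.ofReal_lt_top (r := c * ν.real univ))
    rw [← ofReal_integral_eq_lintegral_ofReal]
    · exact ENNReal.ofReal_le_ofReal (hbd N)
    · refine Integrable.mono' (integrable_const (N : ℝ))
          (hRm.min measurable_const).aestronglyMeasurable (Eventually.of_forall fun x => ?_)
      rw [Real.norm_eq_abs, abs_of_nonneg (le_min (hR0 x) (by positivity))]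
      exact min_le_right _ _
    · exact Eventually.of_forall fun x => le_min (hR0 x) (by positivity)
  have hΦi : Integrable Φ ν := by
    refine Integrable.mono' ((hRi.const_mul a).add (integrable_const b)) hΦm.aestronglyMeasurable ?_
    filter_upwards [hνm.ae_le hΦ] with x hx using hx
  filter_upwards [htrans R hRm hRi, htrans Φ hΦm hΦi] with x h1 h2 using ⟨h1, h2⟩

end Birkhoff

section CountBelow

/-- The number of points of `S` lying strictly below `x`. -/
noncomputable def countBelow (S : Finset ℝ) (x : ℝ) : ℕ := (S.filter (· < x)).card

lemma countBelow_mono (S : Finset ℝ) : Monotone (countBelow S) := fun x y hxy =>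
  Finset.card_le_card fun c hc => by
    simp only [Finset.mem_filter] at hc ⊢
    exact ⟨hc.1, hc.2.trans_le hxy⟩

lemma countBelow_le (S : Finset ℝ) (x : ℝ) : countBelow S x ≤ S.card :=
  Finset.card_filter_le _ _

lemma countBelow_lt_of_mem {S : Finset ℝ} {x y c : ℝ} (hc : c ∈ S) (h1 : x ≤ c) (h2 : c < y) :
    countBelow S x < countBelow S y := by
  refine Finset.card_lt_card (Finset.ssubset_iff_of_subset ?_ |>.2 ⟨c, ?_, ?_⟩)
  · intro d hd
    simp only [Finset.mem_filter] at hd ⊢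
    exact ⟨hd.1, hd.2.trans_le (h1.trans h2.le)⟩
  · simp [hc, h2]
  · simp [h1]

lemma countBelow_eq_of_disjoint {S : Finset ℝ} {x y : ℝ} (h : ∀ z ∈ uIcc x y, z ∉ S) :
    countBelow S x = countBelow S y := by
  unfold countBelow
  congr 1
  ext c
  simp only [Finset.mem_filter, and_congr_right_iff]
  intro hc
  constructor
  · intro hx
    by_contra! hy
    exact h c (mem_uIcc.2 (Or.inr ⟨hy, hx.le⟩)) hc
  · intro hx
    by_contra! hy
    exact h c (mem_uIcc.2 (Or.inl ⟨hy, hx.le⟩)) hc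

lemma notMem_of_countBelow_eq {S : Finset ℝ} {x y z : ℝ} (hx : x ∉ S) (hy : y ∉ S)
    (h : countBelow S x = countBelow S y) (hz : z ∈ uIcc x y) : z ∉ S := by
  intro hzS
  rcases mem_uIcc.1 hz with ⟨h1, h2⟩ | ⟨h1, h2⟩
  · exact (countBelow_lt_of_mem hzS h1 (h2.lt_of_ne (by rintro rfl; exact hy hzS))).ne h
  · exact (countBelow_lt_of_mem hzS h1 (h2.lt_of_ne (by rintro rfl; exact hx hzS))).ne h.symm

end CountBelow

/-- The product of the derivatives of `f` along the first `n` points of the orbit of `x`. -/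
noncomputable def derivProd (f : ℝ → ℝ) (n : ℕ) (x : ℝ) : ℝ :=
  ∏ i ∈ Finset.range n, deriv f (f^[i] x)

lemma derivProd_zero (f : ℝ → ℝ) (x : ℝ) : derivProd f 0 x = 1 := by simp [derivProd]

lemma derivProd_succ (f : ℝ → ℝ) (n : ℕ) (x : ℝ) :
    derivProd f (n + 1) x = derivProd f n x * deriv f (f^[n] x) :=
  Finset.prod_range_succ _ _

lemma derivProd_succ' (f : ℝ → ℝ) (n : ℕ) (x : ℝ) :
    derivProd f (n + 1) x = deriv f x * derivProd f n (f x) := by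
  unfold derivProd
  rw [Finset.prod_range_succ']
  simp [mul_comm, Function.iterate_succ_apply]

lemma hasDerivAt_iterate_derivProd {f : ℝ → ℝ} (hf : Differentiable ℝ f) (n : ℕ) (x : ℝ) :
    HasDerivAt f^[n] (derivProd f n x) x := by
  induction n generalizing x with
  | zero => simpa [derivProd] using hasDerivAt_id x
  | succ n ih =>
    rw [derivProd_succ, mul_comm, Function.iterate_succ']
    exact (hf _).hasDerivAt.comp x (ih x)

/-- A `C²` interval map with a finite non-degenerate critical set `C`; the constant `M` bounds
the derivative and its Lipschitz constant at critical points. -/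
structure NondegenerateMap (f : ℝ → ℝ) (C : Set ℝ) (β B M : ℝ) : Prop where
  β_pos : 0 < β
  B_pos : 0 < B
  one_lt : 1 < M
  contDiff : ContDiff ℝ 2 f
  mapsTo : MapsTo f (Icc (0:ℝ) 1) (Icc (0:ℝ) 1)
  crit : C = {x ∈ Icc (0:ℝ) 1 | deriv f x = 0}
  finite : C.Finite
  nonempty : C.Nonempty
  lower : ∀ x ∈ Icc (0:ℝ) 1 \ C, B⁻¹ * infDist x C ^ β ≤ |deriv f x|
  distortion : ∀ x ∈ Icc (0:ℝ) 1 \ C, ∀ y ∈ Icc (0:ℝ) 1 \ C, |x - y| < infDist x C / 2 →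
    abs (Real.log |deriv f x| - Real.log |deriv f y|) ≤ B * |x - y| / infDist x C ^ β
  abs_deriv_le : ∀ x ∈ Icc (0:ℝ) 1, |deriv f x| ≤ M
  abs_deriv_le_mul : ∀ c ∈ C, ∀ x ∈ Icc (0:ℝ) 1, |deriv f x| ≤ M * |x - c|

lemma exists_nondegenerateMap {f : ℝ → ℝ} {C : Set ℝ} {β B : ℝ} (hβ : 0 < β) (hB : 0 < B)
    (hC2 : ContDiff ℝ 2 f) (hmaps : MapsTo f (Icc (0:ℝ) 1) (Icc (0:ℝ) 1))
    (hC : C = {x ∈ Icc (0:ℝ) 1 | deriv f x = 0}) (hCfin : C.Finite)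
    (hnd1 : ∀ x ∈ Icc (0:ℝ) 1 \ C,
      B⁻¹ * infDist x C ^ β ≤ |deriv f x| ∧ |deriv f x| ≤ B * infDist x C ^ (-β))
    (hnd2 : ∀ x ∈ Icc (0:ℝ) 1 \ C, ∀ y ∈ Icc (0:ℝ) 1 \ C,
      |x - y| < infDist x C / 2 →
      abs (Real.log |deriv f x| - Real.log |deriv f y|) ≤ B * |x - y| / infDist x C ^ β) :
    ∃ M, NondegenerateMap f C β B M := by
  have hd1 : ContDiff ℝ 1 (deriv f) := by
    have : ContDiff ℝ (1 + 1) f := by simpa [one_add_one_eq_two] using hC2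
    exact (contDiff_succ_iff_deriv.1 this).2.2
  have hne : C.Nonempty := by
    by_contra hempty
    rw [not_nonempty_iff_eq_empty] at hempty
    have h0 : (0:ℝ) ∈ Icc (0:ℝ) 1 := by simp
    have h := (hnd1 0 ⟨h0, by simp [hempty]⟩).2
    rw [hempty, infDist_empty, Real.zero_rpow (by linarith), mul_zero] at h
    have : (0:ℝ) ∈ C := by
      rw [hC]; exact ⟨h0, by simpa using h⟩
    simp [hempty] at this
  have hdd : Continuous (deriv (deriv f)) := (hd1.continuous_deriv le_rfl)
  obtain ⟨M1, hM1⟩ := isCompact_Icc.exists_bound_of_continuousOn (s := Icc (0:ℝ) 1)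
    hd1.continuous.continuousOn
  obtain ⟨M2, hM2⟩ := isCompact_Icc.exists_bound_of_continuousOn (s := Icc (0:ℝ) 1)
    hdd.continuousOn
  refine ⟨max 2 (max M1 M2), hβ, hB, by simp, hC2, hmaps, hC, hCfin, hne, fun x hx => (hnd1 x hx).1,
    hnd2, fun x hx => (hM1 x hx).trans (by simp), fun c hc x hx => ?_⟩
  rw [hC] at hc
  have := (convex_Icc (0:ℝ) 1).norm_image_sub_le_of_norm_deriv_le (f := deriv f)
    (fun x _ => (hd1.differentiable one_ne_zero) x) hM2 hc.1 hx
  rw [hc.2, sub_zero] at this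
  refine this.trans ?_
  rw [Real.norm_eq_abs]
  gcongr
  simp

namespace NondegenerateMap

variable {f : ℝ → ℝ} {C : Set ℝ} {β B M : ℝ}

lemma differentiable (H : NondegenerateMap f C β B M) : Differentiable ℝ f :=
  H.contDiff.differentiable two_ne_zero

lemma continuous_deriv (H : NondegenerateMap f C β B M) : Continuous (deriv f) :=
  H.contDiff.continuous_deriv (by norm_num)

lemma continuous_iterate (H : NondegenerateMap f C β B M) (n : ℕ) : Continuous f^[n] :=
  H.differentiable.continuous.iterate n

lemma iterate_mem (H : NondegenerateMap f C β B M) (n : ℕ) {x : ℝ} (hx : x ∈ Icc (0:ℝ) 1) :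
    f^[n] x ∈ Icc (0:ℝ) 1 := H.mapsTo.iterate n hx

lemma continuous_derivProd (H : NondegenerateMap f C β B M) (n : ℕ) :
    Continuous (derivProd f n) :=
  continuous_finsetProd _ fun i _ => H.continuous_deriv.comp (H.continuous_iterate i)

lemma deriv_ne_zero (H : NondegenerateMap f C β B M) {x : ℝ} (hx : x ∈ Icc (0:ℝ) 1)
    (hxC : x ∉ C) : deriv f x ≠ 0 := fun h => hxC (by rw [H.crit]; exact ⟨hx, h⟩)

lemma subset_Icc (H : NondegenerateMap f C β B M) : C ⊆ Icc 0 1 := by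
  rw [H.crit]; exact fun x hx => hx.1

lemma infDist_pos (H : NondegenerateMap f C β B M) {x : ℝ} (hx : x ∉ C) : 0 < infDist x C :=
  (H.finite.isClosed.notMem_iff_infDist_pos H.nonempty).1 hx

lemma infDist_le_one (H : NondegenerateMap f C β B M) {x : ℝ} (hx : x ∈ Icc (0:ℝ) 1) :
    infDist x C ≤ 1 := by
  obtain ⟨c, hc⟩ := H.nonempty
  refine (infDist_le_dist_of_mem hc).trans ?_
  have := H.subset_Icc hc
  rw [Real.dist_eq, abs_le]
  constructor <;> linarith [hx.1, hx.2, this.1, this.2]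

/-- The level sets in `[0,1] \ C` of the number of critical points below a given point. -/
noncomputable def piece (H : NondegenerateMap f C β B M) (i : ℕ) : Set ℝ :=
  {x ∈ Icc (0:ℝ) 1 \ C | countBelow H.finite.toFinset x = i}

lemma measurableSet_piece (H : NondegenerateMap f C β B M) (i : ℕ) :
    MeasurableSet (H.piece i) :=
  (measurableSet_Icc.diff H.finite.measurableSet).inter
    ((countBelow_mono _).measurable (measurableSet_singleton i))

lemma injOn_of_uIcc (H : NondegenerateMap f C β B M) {s : Set ℝ} (hs : s ⊆ Icc 0 1)
    (h : ∀ x ∈ s, ∀ y ∈ s, ∀ z ∈ uIcc x y, z ∉ C) : InjOn f s := by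
  have key : ∀ x ∈ s, ∀ y ∈ s, x < y → f x ≠ f y := by
    intro x hx y hy hxy hf
    obtain ⟨c, hc, hc0⟩ := exists_deriv_eq_zero hxy H.differentiable.continuous.continuousOn hf
    refine h x hx y hy c (Icc_subset_uIcc (Ioo_subset_Icc_self hc)) ?_
    rw [H.crit]
    exact ⟨⟨(hs hx).1.trans hc.1.le, hc.2.le.trans (hs hy).2⟩, hc0⟩
  intro x hx y hy hf
  rcases lt_trichotomy x y with hlt | heq | hlt
  · exact absurd hf (key x hx y hy hlt)
  · exact heq
  · exact absurd hf.symm (key y hy x hx hlt)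

lemma injOn_piece (H : NondegenerateMap f C β B M) (i : ℕ) : InjOn f (H.piece i) := by
  refine H.injOn_of_uIcc (fun x hx => hx.1.1) fun x hx y hy z hz => ?_
  have := notMem_of_countBelow_eq (S := H.finite.toFinset) (by simpa using hx.1.2)
    (by simpa using hy.1.2) (hx.2.trans hy.2.symm) hz
  simpa using this

lemma Icc_subset_pieces (H : NondegenerateMap f C β B M) :
    Icc (0:ℝ) 1 ⊆ C ∪ ⋃ i ∈ Finset.range (H.finite.toFinset.card + 1), H.piece i := by
  intro x hx
  by_cases hxC : x ∈ C
  · exact Or.inl hxC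
  · refine Or.inr (mem_iUnion₂.2 ⟨countBelow H.finite.toFinset x, ?_, ⟨hx, hxC⟩, rfl⟩)
    simpa [Nat.lt_succ_iff] using countBelow_le H.finite.toFinset x

lemma lintegral_abs_deriv_mul_le (H : NondegenerateMap f C β B M) (g : ℝ → ENNReal) :
    ∫⁻ x in Icc (0:ℝ) 1, ENNReal.ofReal |deriv f x| * g (f x) ≤
      (H.finite.toFinset.card + 1 : ℕ) * ∫⁻ x in Icc (0:ℝ) 1, g x := by
  set p := H.finite.toFinset.card + 1
  set G := fun x => ENNReal.ofReal |deriv f x| * g (f x)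
  calc ∫⁻ x in Icc (0:ℝ) 1, G x
      ≤ ∫⁻ x in C ∪ ⋃ i ∈ Finset.range p, H.piece i, G x :=
        lintegral_mono_set H.Icc_subset_pieces
    _ ≤ (∫⁻ x in C, G x) + ∫⁻ x in ⋃ i ∈ Finset.range p, H.piece i, G x :=
        lintegral_union_le _ _ _
    _ = ∫⁻ x in ⋃ i ∈ Finset.range p, H.piece i, G x := by
        rw [Measure.restrict_eq_zero.2 (H.finite.measure_zero volume), lintegral_zero_measure, zero_add]
    _ ≤ ∑ i ∈ Finset.range p, ∫⁻ x in H.piece i, G x := by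
        induction Finset.range p using Finset.induction_on with
        | empty => simp
        | insert i s hi ih =>
          rw [Finset.set_biUnion_insert, Finset.sum_insert hi]
          exact (lintegral_union_le _ _ _).trans (by gcongr)
    _ ≤ ∑ i ∈ Finset.range p, ∫⁻ x in Icc (0:ℝ) 1, g x := by
        refine Finset.sum_le_sum fun i _ => ?_
        rw [← lintegral_image_eq_lintegral_abs_deriv_mul (H.measurableSet_piece i)
          (fun x _ => (H.differentiable x).hasDerivAt.hasDerivWithinAt) (H.injOn_piece i)]
        exact lintegral_mono_set (image_subset_iff.2 fun x hx => H.mapsTo hx.1.1)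
    _ = p * ∫⁻ x in Icc (0:ℝ) 1, g x := by simp

lemma lintegral_abs_derivProd_mul_le (H : NondegenerateMap f C β B M) (n : ℕ)
    (g : ℝ → ENNReal) :
    ∫⁻ x in Icc (0:ℝ) 1, ENNReal.ofReal |derivProd f n x| * g (f^[n] x) ≤
      ((H.finite.toFinset.card + 1 : ℕ) : ENNReal) ^ n * ∫⁻ x in Icc (0:ℝ) 1, g x := by
  induction n with
  | zero => simp [derivProd_zero]
  | succ n ih =>
    have := H.lintegral_abs_deriv_mul_le
      (fun x => ENNReal.ofReal |derivProd f n x| * g (f^[n] x))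
    calc _ = ∫⁻ x in Icc (0:ℝ) 1, ENNReal.ofReal |deriv f x| *
          (ENNReal.ofReal |derivProd f n (f x)| * g (f^[n] (f x))) := by
          simp only [derivProd_succ', abs_mul, ENNReal.ofReal_mul (abs_nonneg _),
            Function.iterate_succ_apply, mul_assoc]
      _ ≤ _ := this
      _ ≤ _ := by
          rw [pow_succ', mul_assoc]
          gcongr

lemma quasiMeasurePreserving (H : NondegenerateMap f C β B M) :
    Measure.QuasiMeasurePreserving f (volume.restrict (Icc (0:ℝ) 1))
      (volume.restrict (Icc (0:ℝ) 1)) := by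
  refine ⟨H.differentiable.continuous.measurable, Measure.AbsolutelyContinuous.mk fun A hA h0 => ?_⟩
  rw [Measure.map_apply H.differentiable.continuous.measurable hA]
  have h := H.lintegral_abs_deriv_mul_le (A.indicator 1)
  rw [lintegral_indicator_one hA, h0, mul_zero, nonpos_iff_eq_zero, lintegral_eq_zero_iff] at h
  · have hC : ∀ᵐ x ∂(volume.restrict (Icc (0:ℝ) 1)), x ∉ C :=
      measure_eq_zero_iff_ae_notMem.1 (Measure.restrict_apply_eq_zero' measurableSet_Icc |>.2
        (measure_mono_null inter_subset_left (H.finite.measure_zero volume)))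
    rw [measure_eq_zero_iff_ae_notMem]
    filter_upwards [h, hC, ae_restrict_mem measurableSet_Icc] with x h1 h2 h3 h4
    have h5 : A.indicator (1 : ℝ → ENNReal) (f x) = 1 := indicator_of_mem (mem_preimage.1 h4) _
    simp only [Pi.zero_apply, h5, mul_one, ENNReal.ofReal_eq_zero] at h1
    exact H.deriv_ne_zero h3 h2 (abs_nonpos_iff.1 h1)
  · exact (H.continuous_deriv.abs.measurable.ennreal_ofReal).mul
      ((measurable_one.indicator hA).comp H.differentiable.continuous.measurable)

lemma ae_orbit (H : NondegenerateMap f C β B M) {P : ℝ → Prop}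
    (h : ∀ᵐ x ∂(volume.restrict (Icc (0:ℝ) 1)), P x) :
    ∀ᵐ x ∂(volume.restrict (Icc (0:ℝ) 1)), ∀ n, P (f^[n] x) :=
  ae_all_iff.2 fun n => (H.quasiMeasurePreserving.iterate n).ae h

lemma ae_orbit_notMem (H : NondegenerateMap f C β B M) {S : Set ℝ} (hS : S.Countable) :
    ∀ᵐ x ∂(volume.restrict (Icc (0:ℝ) 1)), ∀ n, f^[n] x ∉ S :=
  H.ae_orbit (ae_restrict_of_ae (hS.ae_notMem _))

lemma finite_preimage (H : NondegenerateMap f C β B M) {S : Set ℝ} (hS : S.Finite) :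
    (Icc (0:ℝ) 1 ∩ f ⁻¹' S).Finite := by
  refine Set.Finite.subset (H.finite.union ((Finset.range
    (H.finite.toFinset.card + 1)).finite_toSet.biUnion
    (t := fun i => H.piece i ∩ f ⁻¹' S) fun i _ => ?_)) ?_
  · exact Set.Finite.of_finite_image (hS.subset (by rintro _ ⟨x, hx, rfl⟩; exact hx.2))
      ((H.injOn_piece i).mono inter_subset_left)
  · rintro x ⟨hx, hxS⟩
    rcases H.Icc_subset_pieces hx with h | h
    · exact Or.inl h
    · obtain ⟨i, hi, hxi⟩ := mem_iUnion₂.1 h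
      exact Or.inr (mem_iUnion₂.2 ⟨i, hi, hxi, hxS⟩)

lemma finite_iterate_preimage (H : NondegenerateMap f C β B M) {S : Set ℝ} (hS : S.Finite)
    (n : ℕ) : {x ∈ Icc (0:ℝ) 1 | f^[n] x ∈ S}.Finite := by
  induction n with
  | zero => exact hS.subset fun x hx => hx.2
  | succ n ih =>
    refine (H.finite_preimage ih).subset ?_
    rintro x ⟨hx, hxS⟩
    exact ⟨hx, H.mapsTo hx, by simpa [Function.iterate_succ_apply] using hxS⟩

end NondegenerateMap

/-- The logarithm of the absolute derivative of `f^[n]` at `x`, as a Birkhoff sum. -/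
noncomputable def logExp (f : ℝ → ℝ) (n : ℕ) (x : ℝ) : ℝ :=
  birkhoffSum f (fun y => Real.log |deriv f y|) n x

lemma logExp_eq_sum (f : ℝ → ℝ) (n : ℕ) (x : ℝ) :
    logExp f n x = ∑ i ∈ Finset.range n, Real.log |deriv f (f^[i] x)| := rfl

lemma logExp_add (f : ℝ → ℝ) (m n : ℕ) (x : ℝ) :
    logExp f (m + n) x = logExp f m x + logExp f n (f^[m] x) := birkhoffSum_add ..

namespace NondegenerateMap

variable {f : ℝ → ℝ} {C : Set ℝ} {β B M : ℝ}

lemma log_abs_derivProd (H : NondegenerateMap f C β B M) {x : ℝ} (hx : x ∈ Icc (0:ℝ) 1) {n : ℕ}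
    (hxC : ∀ i < n, f^[i] x ∉ C) : Real.log |derivProd f n x| = logExp f n x := by
  rw [derivProd, Finset.abs_prod, Real.log_prod]
  · rfl
  · intro i hi
    exact abs_ne_zero.2 (H.deriv_ne_zero (H.iterate_mem i hx) (hxC i (Finset.mem_range.1 hi)))

lemma derivProd_ne_zero (H : NondegenerateMap f C β B M) {x : ℝ} (hx : x ∈ Icc (0:ℝ) 1) {n : ℕ}
    (hxC : ∀ i < n, f^[i] x ∉ C) : derivProd f n x ≠ 0 :=
  Finset.prod_ne_zero_iff.2 fun i hi =>
    H.deriv_ne_zero (H.iterate_mem i hx) (hxC i (Finset.mem_range.1 hi))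

lemma log_pos (H : NondegenerateMap f C β B M) : 0 < Real.log M := Real.log_pos H.one_lt

lemma log_abs_deriv_le (H : NondegenerateMap f C β B M) {x : ℝ} (hx : x ∈ Icc (0:ℝ) 1) :
    Real.log |deriv f x| ≤ Real.log M := by
  rcases eq_or_ne (deriv f x) 0 with h | h
  · simpa [h] using H.log_pos.le
  · exact Real.log_le_log (abs_pos.2 h) (H.abs_deriv_le x hx)

lemma logExp_le (H : NondegenerateMap f C β B M) {x : ℝ} (hx : x ∈ Icc (0:ℝ) 1) (n : ℕ) :
    logExp f n x ≤ n * Real.log M := by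
  rw [logExp_eq_sum]
  exact (Finset.sum_le_sum fun i _ => H.log_abs_deriv_le (H.iterate_mem i hx)).trans_eq (by simp)

lemma exists_mem_Icc_of_ae {P : ℝ → Prop} (h : ∀ᵐ x ∂(volume.restrict (Icc (0:ℝ) 1)), P x)
    {a b : ℝ} (hab : a < b) (hs : Icc a b ⊆ Icc 0 1) : ∃ x ∈ Icc a b, P x := by
  have h' : ∀ᵐ x ∂(volume.restrict (Icc a b)), P x :=
    ae_mono (Measure.restrict_mono hs le_rfl) h
  have hne : (volume.restrict (Icc a b)) ≠ 0 := by
    rw [Ne, Measure.restrict_eq_zero, Real.volume_Icc]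
    simpa using hab
  have : NeZero (volume.restrict (Icc a b)) := ⟨hne⟩
  obtain ⟨x, h1, h2⟩ := (h'.and (ae_restrict_mem measurableSet_Icc)).exists
  exact ⟨x, h2, h1⟩

lemma not_attracting (H : NondegenerateMap f C β B M) {η : ℝ} (hη : 0 < η)
    (hexp : ∀ᵐ x ∂(volume.restrict (Icc (0:ℝ) 1)), ∃ᶠ n : ℕ in atTop, η * n ≤ logExp f n x)
    {a b : ℝ} (hab : a < b) (hs : Icc a b ⊆ Icc 0 1) {m : ℕ} (hm : 1 ≤ m)
    (hmaps : MapsTo f^[m] (Icc a b) (Icc a b)) :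
    ¬ ∀ x ∈ Icc a b, |derivProd f m x| ≤ 1 := by
  intro hD
  obtain ⟨x, hx, hC, hfr⟩ := exists_mem_Icc_of_ae
    ((H.ae_orbit_notMem H.finite.countable).and hexp) hab hs
  have hq : ∀ q : ℕ, logExp f (m * q) x ≤ 0 ∧ f^[m * q] x ∈ Icc a b := by
    intro q
    induction q with
    | zero => simpa [logExp] using hx
    | succ q ih =>
      rw [Nat.mul_succ]
      constructor
      · rw [logExp_add, ← H.log_abs_derivProd (n := m) (hs ih.2)]
        · have := Real.log_nonpos (abs_nonneg _) (hD _ ih.2)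
          linarith [ih.1]
        · intro i _
          rw [← Function.iterate_add_apply]
          exact hC _
      · rw [add_comm, Function.iterate_add_apply]
        exact hmaps ih.2
  have hb : ∀ n : ℕ, logExp f n x ≤ m * Real.log M := by
    intro n
    rw [← Nat.div_add_mod n m, logExp_add]
    have h1 := hq (n / m)
    have h2 := H.logExp_le (hs h1.2) (n % m)
    have h3 : ((n % m : ℕ) : ℝ) * Real.log M ≤ m * Real.log M := by
      have := H.log_pos
      gcongr
      exact (Nat.mod_lt _ hm).le
    linarith [h1.1]
  have hev : ∀ᶠ n : ℕ in atTop, m * Real.log M < η * n :=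
    (tendsto_natCast_atTop_atTop.const_mul_atTop hη).eventually_gt_atTop _
  obtain ⟨n, h1, h2⟩ := (hfr.and_eventually hev).exists
  linarith [hb n]

lemma exists_sum_le_of_returns (H : NondegenerateMap f C β B M) {η : ℝ} (hη : 0 < η)
    (hexp : ∀ᵐ x ∂(volume.restrict (Icc (0:ℝ) 1)), ∃ᶠ n : ℕ in atTop, η * n ≤ logExp f n x)
    {c : ℝ} (hc : c ∈ C) {y : ℝ} (hy : y ∈ Icc (0:ℝ) 1) (hyC : ∀ i, f^[i] y ∉ C)
    {m : ℕ} (hm : 1 ≤ m) {K : ℝ} (h0 : K ≤ -Real.log |y - c|) (h1 : K ≤ -Real.log |f^[m] y - c|)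
    (hj : ∀ j, 0 < j → j < m → -Real.log |f^[j] y - c| ≤ K) :
    ∃ j, 1 ≤ j ∧ j ≤ m ∧ K + ∑ i ∈ Finset.Ico 1 j, -Real.log |f^[i] y - c| ≤
      (Real.log 16 + Real.log (2 * M)) * j := by
  have hM := H.one_lt
  have hne : ∀ i, 0 < |f^[i] y - c| := fun i =>
    abs_pos.2 (sub_ne_zero.2 fun h => hyC i (h ▸ hc))
  set r := Real.exp (-K) with hr
  have hr0 : 0 < r := Real.exp_pos _
  have hk : ∀ i, Real.exp (Real.log |f^[i] y - c|) = |f^[i] y - c| := fun i => Real.exp_log (hne i)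
  have hr1 : |y - c| ≤ r := by
    rw [show |y - c| = Real.exp (Real.log |y - c|) from (hk 0).symm, hr]
    exact Real.exp_le_exp.2 (by linarith)
  have hr2 : |f^[m] y - c| ≤ r := by
    rw [← hk m, hr]; exact Real.exp_le_exp.2 (by linarith)
  have hr3 : ∀ j, 0 < j → j < m → r ≤ |f^[j] y - c| := fun j h2 h3 => by
    rw [← hk j, hr]; exact Real.exp_le_exp.2 (by linarith [hj j h2 h3])
  set w : ℕ → ℝ := fun i => if i = 0 then 4 * M * r else 2 * M * |f^[i] y - c| with hw
  have hw0 : ∀ i, 0 < w i := by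
    intro i
    simp only [hw]
    split_ifs
    · positivity
    · have := hne i; positivity
  set E : ℕ → ℝ := fun j => ∏ i ∈ Finset.range j, w i with hE
  have hE0 : ∀ j, 0 < E j := fun j => Finset.prod_pos fun i _ => hw0 i
  by_cases hall : ∀ j, 1 ≤ j → j ≤ m → E j ≤ 1 / 4
  · exfalso
    have hc1 := H.subset_Icc hc
    have hab : max 0 (c - 2 * r) < min 1 (c + 2 * r) := by
      rw [max_lt_iff, lt_min_iff, lt_min_iff]
      refine ⟨⟨?_, ?_⟩, ?_, ?_⟩ <;> linarith [hc1.1, hc1.2]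
    have hmem : ∀ z, z ∈ Icc (max 0 (c - 2 * r)) (min 1 (c + 2 * r)) ↔
        z ∈ Icc (0:ℝ) 1 ∧ |z - c| ≤ 2 * r := by
      intro z
      simp only [mem_Icc, max_le_iff, le_min_iff, abs_le]
      constructor
      · rintro ⟨⟨a1, a2⟩, a3, a4⟩
        refine ⟨⟨a1, a3⟩, ?_, ?_⟩ <;> linarith
      · rintro ⟨⟨a1, a2⟩, a3, a4⟩
        refine ⟨⟨a1, ?_⟩, a2, ?_⟩ <;> linarith
    have hyB := (hmem y).2 ⟨hy, by linarith⟩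
    have himg : ∀ j, (∀ z ∈ Icc (max 0 (c - 2 * r)) (min 1 (c + 2 * r)),
        |derivProd f j z| ≤ E j) → ∀ z ∈ Icc (max 0 (c - 2 * r)) (min 1 (c + 2 * r)),
        |f^[j] z - f^[j] y| ≤ 4 * r * E j := by
      intro j hDj z hz
      have := (convex_Icc _ _).norm_image_sub_le_of_norm_hasDerivWithin_le
        (fun x _ => (hasDerivAt_iterate_derivProd H.differentiable j x).hasDerivWithinAt)
        hDj hyB hz
      refine this.trans ?_
      have hzy : |z - y| ≤ 4 * r := by
        have e : z - y = (z - c) - (y - c) := by ring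
        rw [e]
        have := abs_sub (z - c) (y - c)
        linarith [((hmem z).1 hz).2]
      rw [Real.norm_eq_abs, mul_comm]
      exact mul_le_mul_of_nonneg_right hzy (hE0 j).le
    have hD : ∀ j, j ≤ m → ∀ z ∈ Icc (max 0 (c - 2 * r)) (min 1 (c + 2 * r)),
        |derivProd f j z| ≤ E j := by
      intro j
      induction j with
      | zero => intro _ z _; simp [derivProd_zero, hE]
      | succ j ih =>
        intro hjm z hz
        have ih' := ih (by omega)
        rw [derivProd_succ, abs_mul]
        have : E (j + 1) = E j * w j := Finset.prod_range_succ _ _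
        rw [this]
        have hzI := ((hmem z).1 hz).1
        refine mul_le_mul (ih' z hz) ?_ (abs_nonneg _) (hE0 j).le
        refine (H.abs_deriv_le_mul c hc _ (H.iterate_mem j hzI)).trans ?_
        rcases Nat.eq_zero_or_pos j with rfl | hjpos
        · simp only [Function.iterate_zero, id, hw, if_true]
          have := ((hmem z).1 hz).2
          nlinarith
        · have h2 := himg j ih' z hz
          have h3 := hall j hjpos (by omega)
          have h4 := hr3 j hjpos (by omega)
          simp only [hw, hjpos.ne', if_false]
          have h5 : |f^[j] z - c| ≤ 2 * |f^[j] y - c| := by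
            have e : f^[j] z - c = (f^[j] z - f^[j] y) + (f^[j] y - c) := by ring
            rw [e]
            refine (abs_add_le _ _).trans ?_
            nlinarith
          nlinarith
    refine H.not_attracting hη hexp hab (fun z hz => ((hmem z).1 hz).1) hm ?_ ?_
    · intro z hz
      refine (hmem _).2 ⟨H.iterate_mem m ((hmem z).1 hz).1, ?_⟩
      have h2 := himg m (hD m le_rfl) z hz
      have h3 := hall m hm le_rfl
      have e : f^[m] z - c = (f^[m] z - f^[m] y) + (f^[m] y - c) := by ring
      rw [e]
      refine (abs_add_le _ _).trans ?_
      nlinarith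
    · intro z hz
      exact (hD m le_rfl z hz).trans ((hall m hm le_rfl).trans (by norm_num))
  · push Not at hall
    obtain ⟨j, hj1, hjm, hjE⟩ := hall
    refine ⟨j, hj1, hjm, ?_⟩
    have hlog : Real.log (1 / 4) < Real.log (E j) := Real.log_lt_log (by norm_num) hjE
    have h16 : Real.log 16 = 2 * Real.log 4 := by
      rw [show (16:ℝ) = 4 ^ 2 by norm_num, Real.log_pow]; norm_num
    have h4M : Real.log (4 * M) = Real.log 2 + Real.log (2 * M) := by
      rw [← Real.log_mul (by norm_num) (by positivity)]; congr 1; ring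
    have h24 : Real.log 2 ≤ Real.log 4 := Real.log_le_log (by norm_num) (by norm_num)
    have hl2 : 0 ≤ Real.log 2 := Real.log_nonneg (by norm_num)
    have hEj : Real.log (E j) = Real.log 2 + Real.log (2 * M) - K +
        ∑ i ∈ Finset.Ico 1 j, (Real.log (2 * M) + Real.log |f^[i] y - c|) := by
      simp only [hE]
      rw [Real.log_prod (fun i _ => (hw0 i).ne'), Finset.range_eq_Ico,
        Finset.sum_eq_sum_Ico_succ_bot hj1]
      congr 1
      · simp only [hw, if_true]
        rw [Real.log_mul (by positivity) hr0.ne', hr, Real.log_exp, h4M]; ring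
      · refine Finset.sum_congr (by simp) fun i hi => ?_
        have : i ≠ 0 := by have := (Finset.mem_Ico.1 hi).1; omega
        simp only [hw, this, if_false]
        rw [Real.log_mul (by positivity) (hne i).ne']
    rw [Finset.sum_add_distrib, Finset.sum_const, Nat.card_Ico, nsmul_eq_mul, Nat.cast_sub hj1]
      at hEj
    rw [one_div, Real.log_inv] at hlog
    rw [Finset.sum_neg_distrib]
    have hj1' : (1:ℝ) ≤ j := by exact_mod_cast hj1
    push_cast at hEj
    nlinarith
end NondegenerateMap

section MaximalDefect

variable {k : ℕ → ℝ} {A : ℝ}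

lemma sum_Ico_le_of_le_right
    (h : ∀ a b, a < b → (∀ j, a < j → j < b → k j ≤ min (k a) (k b)) →
      ∃ j, 1 ≤ j ∧ a + j ≤ b ∧ min (k a) (k b) + ∑ i ∈ Finset.Ico (a + 1) (a + j), k i ≤ A * j)
    {q : ℕ} (d : ℕ) : ∀ p, p + d = q → (∀ j, p ≤ j → j < q → k j ≤ k q) →
      ∑ i ∈ Finset.Ico p q, k i ≤ A * d := by
  induction d using Nat.strong_induction_on with
  | _ d ih =>
    intro p hpq hk
    rcases Nat.eq_zero_or_pos d with rfl | hd
    · simp [← hpq]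
    have hex : ∃ b, p < b ∧ k p ≤ k b := ⟨q, by omega, hk p le_rfl (by omega)⟩
    classical
    obtain ⟨hb1, hb2⟩ := Nat.find_spec hex
    have hbq : Nat.find hex ≤ q := Nat.find_min' hex ⟨by omega, hk p le_rfl (by omega)⟩
    obtain ⟨j, hj1, hj2, hj3⟩ := h p (Nat.find hex) hb1 (by
      intro j h1 h2
      have := Nat.find_min hex h2
      rw [min_eq_left hb2]
      push Not at this
      exact (this h1).le)
    rw [min_eq_left hb2] at hj3
    have hI := ih (d - j) (by omega) (p + j) (by omega) fun i h1 h2 => hk i (by omega) h2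
    rw [← Finset.sum_Ico_consecutive k (show p ≤ p + j by omega) (show p + j ≤ q by omega),
      Finset.sum_eq_sum_Ico_succ_bot (show p < p + j by omega)]
    rw [Nat.cast_sub (by omega)] at hI
    linarith

lemma sum_Ico_succ_le_of_le_left
    (h : ∀ a b, a < b → (∀ j, a < j → j < b → k j ≤ min (k a) (k b)) →
      ∃ j, 1 ≤ j ∧ a + j ≤ b ∧ min (k a) (k b) + ∑ i ∈ Finset.Ico (a + 1) (a + j), k i ≤ A * j)
    {p : ℕ} (d : ℕ) : (∀ j, p < j → j ≤ p + d → k j ≤ k p) →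
      ∑ i ∈ Finset.Ico (p + 1) (p + d + 1), k i ≤ A * d := by
  induction d using Nat.strong_induction_on with
  | _ d ih =>
    intro hk
    rcases Nat.eq_zero_or_pos d with rfl | hd
    · simp
    classical
    set e := Nat.findGreatest (fun e => k (p + d) ≤ k (p + e)) (d - 1) with he
    have he1 : e ≤ d - 1 := Nat.findGreatest_le _
    have he2 : k (p + d) ≤ k (p + e) :=
      Nat.findGreatest_spec (P := fun e => k (p + d) ≤ k (p + e)) (Nat.zero_le (d - 1))
        (hk (p + d) (by omega) le_rfl)
    have he3 : ∀ i, p + e < i → i < p + d → k i ≤ k (p + d) := by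
      intro i h1 h2
      have := Nat.findGreatest_is_greatest (P := fun e => k (p + d) ≤ k (p + e)) (n := d - 1)
        (k := i - p) (by omega) (by omega)
      rw [show p + (i - p) = i by omega] at this
      exact (not_le.1 this).le
    obtain ⟨j, hj1, hj2, hj3⟩ := h (p + e) (p + d) (by omega) (by
      intro i h1 h2
      rw [min_eq_right he2]
      exact he3 i h1 h2)
    rw [min_eq_right he2] at hj3
    have hI := ih e (by omega) fun i h1 h2 => hk i h1 (by omega)
    have hL := sum_Ico_le_of_le_right h (q := p + d) (d - e - j) (p + e + j) (by omega)
      fun i h1 h2 => he3 i (by omega) h2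
    rw [← Finset.sum_Ico_consecutive k (show p + 1 ≤ p + e + 1 by omega)
      (show p + e + 1 ≤ p + d + 1 by omega),
      Finset.sum_Ico_succ_top (show p + e + 1 ≤ p + d by omega),
      ← Finset.sum_Ico_consecutive k (show p + e + 1 ≤ p + e + j by omega)
      (show p + e + j ≤ p + d by omega)]
    rw [Nat.cast_sub (by omega), Nat.cast_sub (by omega)] at hL
    linarith

lemma exists_sum_erase_le (hA : 0 ≤ A)
    (h : ∀ a b, a < b → (∀ j, a < j → j < b → k j ≤ min (k a) (k b)) →
      ∃ j, 1 ≤ j ∧ a + j ≤ b ∧ min (k a) (k b) + ∑ i ∈ Finset.Ico (a + 1) (a + j), k i ≤ A * j)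
    (n : ℕ) : ∃ z, ∑ i ∈ (Finset.range n).erase z, k i ≤ A * n := by
  rcases Nat.eq_zero_or_pos n with rfl | hn
  · exact ⟨0, by simp⟩
  obtain ⟨z, hz, hmax⟩ := Finset.exists_max_image (Finset.range n) k ⟨0, by simpa using hn⟩
  refine ⟨z, ?_⟩
  rw [Finset.mem_range] at hz
  have h1 := sum_Ico_le_of_le_right h (q := z) z 0 (by omega)
    fun j _ hj => hmax j (Finset.mem_range.2 (by omega))
  have h2 := sum_Ico_succ_le_of_le_left h (p := z) (n - 1 - z)
    fun j _ hj => hmax j (Finset.mem_range.2 (by omega))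
  have h3 : (Finset.range n).erase z = Finset.Ico 0 z ∪ Finset.Ico (z + 1) (z + (n - 1 - z) + 1) := by
    ext i
    simp only [Finset.mem_erase, Finset.mem_range, Finset.mem_union, Finset.mem_Ico]
    omega
  rw [h3, Finset.sum_union]
  · have : ((n - 1 - z : ℕ) : ℝ) + z ≤ n := by
      have : n - 1 - z + z ≤ n := by omega
      exact_mod_cast this
    nlinarith
  · rw [Finset.disjoint_left]
    intro i
    simp only [Finset.mem_Ico]
    omega

end MaximalDefect

namespace NondegenerateMap

variable {f : ℝ → ℝ} {C : Set ℝ} {β B M : ℝ}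

/-- The number of critical points. -/
noncomputable def numCrit (H : NondegenerateMap f C β B M) : ℕ := H.finite.toFinset.card

lemma volume_infDist_le (H : NondegenerateMap f C β B M) (r : ℝ) :
    volume {x | infDist x C ≤ r} ≤ H.numCrit * ENNReal.ofReal (2 * r) := by
  have hsub : {x | infDist x C ≤ r} ⊆ ⋃ c ∈ H.finite.toFinset, closedBall c r := by
    intro x hx
    obtain ⟨c, hc, hcd⟩ := H.finite.isCompact.exists_infDist_eq_dist H.nonempty x
    refine mem_iUnion₂.2 ⟨c, by simpa using hc, ?_⟩
    rw [mem_closedBall, ← hcd]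
    exact hx
  refine (measure_mono hsub).trans ((measure_biUnion_finset_le _ _).trans ?_)
  simp [Real.volume_closedBall, numCrit]

lemma measure_large_derivProd_near_le (H : NondegenerateMap f C β B M) (n : ℕ) {s r : ℝ}
    (hs : 0 < s) :
    (volume.restrict (Icc (0:ℝ) 1)) {x | s ≤ |derivProd f n x| ∧ infDist (f^[n] x) C ≤ r} ≤
      ENNReal.ofReal s⁻¹ * (((H.numCrit + 1 : ℕ) : ENNReal) ^ n *
        (H.numCrit * ENNReal.ofReal (2 * r))) := by
  set U := {x | infDist x C ≤ r} with hU
  have hUm : MeasurableSet U := (continuous_infDist_pt C).measurable measurableSet_Iic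
  have h1 := H.lintegral_abs_derivProd_mul_le n (U.indicator 1)
  rw [lintegral_indicator_one hUm] at h1
  have h2 : (volume.restrict (Icc (0:ℝ) 1)) U ≤ H.numCrit * ENNReal.ofReal (2 * r) :=
    (Measure.restrict_apply_le _ _).trans (H.volume_infDist_le r)
  set S := {x | s ≤ |derivProd f n x| ∧ infDist (f^[n] x) C ≤ r} with hS
  have hSm : MeasurableSet S := by
    refine MeasurableSet.inter ?_ ?_
    · exact measurableSet_le measurable_const (H.continuous_derivProd n).abs.measurable
    · exact (H.continuous_iterate n).measurable hUm
  calc (volume.restrict (Icc (0:ℝ) 1)) S = ∫⁻ x in Icc (0:ℝ) 1, S.indicator 1 x := by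
        rw [lintegral_indicator_one hSm]
    _ ≤ ∫⁻ x in Icc (0:ℝ) 1, ENNReal.ofReal s⁻¹ *
        (ENNReal.ofReal |derivProd f n x| * U.indicator 1 (f^[n] x)) := by
        refine lintegral_mono fun x => ?_
        by_cases hx : x ∈ S
        · have hx2 : f^[n] x ∈ U := hx.2
          rw [indicator_of_mem hx, indicator_of_mem hx2, Pi.one_apply, Pi.one_apply, mul_one,
            ← ENNReal.ofReal_mul (inv_nonneg.2 hs.le), ← ENNReal.ofReal_one]
          refine ENNReal.ofReal_le_ofReal ?_
          rw [inv_mul_eq_div, le_div_iff₀ hs, one_mul]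
          exact hx.1
        · rw [indicator_of_notMem hx]
          exact zero_le
    _ = ENNReal.ofReal s⁻¹ * ∫⁻ x in Icc (0:ℝ) 1,
        (ENNReal.ofReal |derivProd f n x| * U.indicator 1 (f^[n] x)) :=
        lintegral_const_mul' _ _ ENNReal.ofReal_ne_top
    _ ≤ _ := by
        gcongr
        exact h1.trans (by unfold numCrit at *; gcongr)

lemma ae_eventually_far (H : NondegenerateMap f C β B M) (L : ℝ) :
    ∀ᵐ x ∂(volume.restrict (Icc (0:ℝ) 1)), ∀ᶠ n : ℕ in atTop, ∀ j < n,
      Real.exp (-(L * n)) ≤ |derivProd f j x| →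
        Real.exp (-((L + Real.log (H.numCrit + 1) + 1) * n)) < infDist (f^[j] x) C := by
  set p := H.numCrit with hp
  set K := L + Real.log (p + 1) + 1
  set S : ℕ → Set ℝ := fun n => ⋃ j ∈ Finset.range n, {x | Real.exp (-(L * n)) ≤ |derivProd f j x| ∧
    infDist (f^[j] x) C ≤ Real.exp (-(K * n))} with hS
  have hp1 : (0:ℝ) < (p:ℝ) + 1 := by positivity
  have hmeas : ∀ n : ℕ, (volume.restrict (Icc (0:ℝ) 1)) (S n) ≤
      ENNReal.ofReal (2 * p * (n * Real.exp (-1) ^ n)) := by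
    intro n
    refine (measure_biUnion_finset_le _ _).trans ?_
    calc _ ≤ ∑ j ∈ Finset.range n, ENNReal.ofReal (Real.exp (L * n) * ((p + 1) ^ n *
          (p * (2 * Real.exp (-(K * n)))))) := by
          refine Finset.sum_le_sum fun j hj => ?_
          refine (H.measure_large_derivProd_near_le j (Real.exp_pos _)).trans ?_
          have e0 : ENNReal.ofReal (Real.exp (L * n) * (((p:ℝ) + 1) ^ n *
              (p * (2 * Real.exp (-(K * n)))))) = ENNReal.ofReal (Real.exp (L * n)) *
              (((p + 1 : ℕ) : ENNReal) ^ n * (p * ENNReal.ofReal (2 * Real.exp (-(K * n))))) := by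
            have e4 : ((p:ℝ) + 1) = ((p + 1 : ℕ) : ℝ) := by push_cast; rfl
            rw [ENNReal.ofReal_mul (Real.exp_pos _).le, ENNReal.ofReal_mul (by positivity),
              ENNReal.ofReal_mul (Nat.cast_nonneg p), ENNReal.ofReal_natCast,
              ENNReal.ofReal_pow hp1.le, e4, ENNReal.ofReal_natCast]
          rw [e0, ← hp, ← Real.exp_neg, neg_neg]
          gcongr
          · exact_mod_cast Nat.succ_le_succ (Nat.zero_le p)
          · exact (Finset.mem_range.1 hj).le
      _ = _ := by
          rw [Finset.sum_const, Finset.card_range, nsmul_eq_mul, ← ENNReal.ofReal_natCast,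
            ← ENNReal.ofReal_mul (by positivity)]
          congr 1
          have e1 : ((p:ℝ) + 1) ^ n = Real.exp (n * Real.log (p + 1)) := by
            rw [mul_comm, Real.exp_mul, Real.exp_log hp1, Real.rpow_natCast]
          have e2 : Real.exp (-1) ^ n = Real.exp (-n) := by
            rw [← Real.exp_nat_mul]; congr 1; ring
          have e3 : Real.exp (L * n) * (Real.exp (n * Real.log (p + 1)) *
              Real.exp (-(K * n))) = Real.exp (-n) := by
            rw [← Real.exp_add, ← Real.exp_add]; congr 1; simp only [K]; ring
          rw [e1, e2, ← e3]
          ring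
  have hsum : ∑' n, (volume.restrict (Icc (0:ℝ) 1)) (S n) ≠ ⊤ := by
    have hs : Summable fun n : ℕ => 2 * (p:ℝ) * (n * Real.exp (-1) ^ n) := by
      refine Summable.mul_left _ ?_
      have := summable_pow_mul_geometric_of_norm_lt_one 1 (r := Real.exp (-1)) (by
        rw [Real.norm_eq_abs, abs_of_pos (Real.exp_pos _)]
        exact Real.exp_lt_one_iff.2 (by norm_num))
      simpa using this
    refine ne_top_of_le_ne_top ?_ (ENNReal.tsum_le_tsum hmeas)
    exact hs.tsum_ofReal_ne_top
  filter_upwards [ae_eventually_notMem hsum] with x hx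
  filter_upwards [hx] with n hn j hj hj1
  by_contra! hcon
  exact hn (mem_iUnion₂.2 ⟨j, Finset.mem_range.2 hj, hj1, hcon⟩)

lemma neg_log_infDist_nonneg (H : NondegenerateMap f C β B M) {x : ℝ} (hx : x ∈ Icc (0:ℝ) 1) :
    0 ≤ -Real.log (infDist x C) := by
  have := Real.log_nonpos infDist_nonneg (H.infDist_le_one hx)
  linarith

lemma neg_log_abs_sub_nonneg (H : NondegenerateMap f C β B M) {x c : ℝ}
    (hx : x ∈ Icc (0:ℝ) 1) (hc : c ∈ C) : 0 ≤ -Real.log |x - c| := by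
  have h := H.subset_Icc hc
  have := Real.log_nonpos (abs_nonneg (x - c)) (by
    rw [abs_le]; constructor <;> linarith [hx.1, hx.2, h.1, h.2])
  linarith

lemma neg_log_infDist_le_sum (H : NondegenerateMap f C β B M) {x : ℝ} (hx : x ∈ Icc (0:ℝ) 1) :
    -Real.log (infDist x C) ≤ ∑ c ∈ H.finite.toFinset, -Real.log |x - c| := by
  obtain ⟨c, hc, hcd⟩ := H.finite.isCompact.exists_infDist_eq_dist H.nonempty x
  rw [hcd, Real.dist_eq]
  exact Finset.single_le_sum (f := fun c => -Real.log |x - c|)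
    (fun d hd => H.neg_log_abs_sub_nonneg hx (by simpa using hd)) (by simpa using hc)

lemma exists_sum_erase_log_dist_le (H : NondegenerateMap f C β B M) {η : ℝ} (hη : 0 < η)
    (hexp : ∀ᵐ x ∂(volume.restrict (Icc (0:ℝ) 1)), ∃ᶠ n : ℕ in atTop, η * n ≤ logExp f n x)
    {c : ℝ} (hc : c ∈ C) {x : ℝ} (hx : x ∈ Icc (0:ℝ) 1) (hxC : ∀ i, f^[i] x ∉ C) (n : ℕ) :
    ∃ z, ∑ i ∈ (Finset.range n).erase z, -Real.log |f^[i] x - c| ≤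
      (Real.log 16 + Real.log (2 * M)) * n := by
  have hM := H.one_lt
  refine exists_sum_erase_le (k := fun i => -Real.log |f^[i] x - c|)
    (add_nonneg (Real.log_nonneg (by norm_num)) (Real.log_nonneg (by linarith))) ?_ n
  intro a b hab hk
  have e : ∀ i, f^[i] (f^[a] x) = f^[a + i] x := fun i => by
    rw [add_comm, Function.iterate_add_apply]
  obtain ⟨j, h1, h2, h3⟩ := H.exists_sum_le_of_returns hη hexp hc (H.iterate_mem a hx)
    (fun i => by rw [e]; exact hxC _) (m := b - a) (by omega)
    (K := min (-Real.log |f^[a] x - c|) (-Real.log |f^[b] x - c|)) (min_le_left _ _)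
    (by rw [e, show a + (b - a) = b by omega]; exact min_le_right _ _)
    (fun j h1 h2 => by rw [e]; exact hk _ (by omega) (by omega))
  refine ⟨j, h1, by omega, ?_⟩
  simp only [e] at h3
  rw [Finset.sum_Ico_add (fun i => -Real.log |f^[i] x - c|) 1 j a, add_comm 1, add_comm j] at h3
  exact h3

lemma le_logExp (H : NondegenerateMap f C β B M) {x : ℝ} (hx : x ∈ Icc (0:ℝ) 1)
    (hxC : ∀ i, f^[i] x ∉ C) (n : ℕ) :
    -(n * Real.log B) - β * ∑ i ∈ Finset.range n, -Real.log (infDist (f^[i] x) C) ≤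
      logExp f n x := by
  rw [logExp_eq_sum]
  have : ∀ i ∈ Finset.range n, -Real.log B - β * -Real.log (infDist (f^[i] x) C) ≤
      Real.log |deriv f (f^[i] x)| := by
    intro i _
    have h1 := H.lower _ ⟨H.iterate_mem i hx, hxC i⟩
    have h2 := H.infDist_pos (hxC i)
    have h3 := H.B_pos
    have := Real.log_le_log (by positivity) h1
    rw [Real.log_mul (by positivity) (by positivity), Real.log_inv, Real.log_rpow h2] at this
    linarith
  refine le_trans (le_of_eq ?_) (Finset.sum_le_sum this)
  rw [Finset.sum_sub_distrib, Finset.mul_sum]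
  simp

lemma ae_eventually_sum_neg_log_infDist_le (H : NondegenerateMap f C β B M) {η : ℝ} (hη : 0 < η)
    (hexp : ∀ᵐ x ∂(volume.restrict (Icc (0:ℝ) 1)), ∃ᶠ n : ℕ in atTop, η * n ≤ logExp f n x) :
    ∃ K : ℝ, ∀ᵐ x ∂(volume.restrict (Icc (0:ℝ) 1)), ∀ᶠ n : ℕ in atTop,
      ∑ j ∈ Finset.range n, -Real.log (infDist (f^[j] x) C) ≤ K * n := by
  set p := H.numCrit with hp
  set A := Real.log 16 + Real.log (2 * M) with hA
  have hM := H.one_lt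
  have hβ := H.β_pos
  have hA0 : 0 ≤ A := add_nonneg (Real.log_nonneg (by norm_num)) (Real.log_nonneg (by linarith))
  set lev : ℝ → ℝ := fun K => |Real.log B| + β * (p * A + K) with hlev
  set Ks : ℕ → ℝ := fun s => Nat.rec 0 (fun _ K => K + (lev K + Real.log (p + 1) + 1)) s with hKs
  have hKs1 : ∀ s, Ks (s + 1) = Ks s + (lev (Ks s) + Real.log (p + 1) + 1) := fun s => rfl
  have hlp : 0 ≤ Real.log ((p:ℝ) + 1) := Real.log_nonneg (by
    have := Nat.cast_nonneg (α := ℝ) p; linarith)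
  have hKs0 : ∀ s, 0 ≤ Ks s := by
    intro s
    induction s with
    | zero => exact le_rfl
    | succ s ih => rw [hKs1]; simp only [hlev]; positivity
  have hmono : Monotone Ks := monotone_nat_of_le_succ fun s => by
    have := hKs0 s
    rw [hKs1]; simp only [hlev]
    have : 0 ≤ |Real.log B| + β * (p * A + Ks s) + Real.log (p + 1) + 1 := by positivity
    linarith
  refine ⟨p * A + Ks p, ?_⟩
  have hBC : ∀ᵐ x ∂(volume.restrict (Icc (0:ℝ) 1)), ∀ s, _ :=
    ae_all_iff.2 fun s : ℕ => H.ae_eventually_far (lev (Ks s))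
  filter_upwards [hBC, H.ae_orbit_notMem H.finite.countable, ae_restrict_mem measurableSet_Icc]
    with x hx hxC hxI
  have hev : ∀ᶠ n : ℕ in atTop, ∀ s ∈ Finset.range (p + 1), ∀ j < n,
      Real.exp (-(lev (Ks s) * n)) ≤ |derivProd f j x| →
      Real.exp (-((lev (Ks s) + Real.log (H.numCrit + 1) + 1) * n)) < infDist (f^[j] x) C :=
    (eventually_all_finset _).2 fun s _ => hx s
  filter_upwards [hev] with n hn
  set κ : ℕ → ℝ := fun j => -Real.log (infDist (f^[j] x) C) with hκ
  have hκ0 : ∀ j, 0 ≤ κ j := fun j => H.neg_log_infDist_nonneg (H.iterate_mem j hxI)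
  have hz : ∀ c ∈ C, ∃ z, ∑ i ∈ (Finset.range n).erase z, -Real.log |f^[i] x - c| ≤ A * n :=
    fun c hc => H.exists_sum_erase_log_dist_le hη hexp hc hxI hxC n
  choose! z hz using hz
  set Z : Finset ℕ := H.finite.toFinset.image z with hZ
  have hZp : Z.card ≤ p := Finset.card_image_le
  have hout : ∀ t ≤ n, ∑ j ∈ (Finset.range t).filter (· ∉ Z), κ j ≤ p * A * n := by
    intro t ht
    calc ∑ j ∈ (Finset.range t).filter (· ∉ Z), κ j
        ≤ ∑ j ∈ (Finset.range t).filter (· ∉ Z), ∑ c ∈ H.finite.toFinset,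
          -Real.log |f^[j] x - c| := Finset.sum_le_sum fun j _ =>
            H.neg_log_infDist_le_sum (H.iterate_mem j hxI)
      _ = ∑ c ∈ H.finite.toFinset, ∑ j ∈ (Finset.range t).filter (· ∉ Z),
          -Real.log |f^[j] x - c| := Finset.sum_comm
      _ ≤ ∑ c ∈ H.finite.toFinset, A * n := by
          refine Finset.sum_le_sum fun c hc => ?_
          have hcC : c ∈ C := by simpa using hc
          refine (Finset.sum_le_sum_of_subset_of_nonneg ?_ fun j _ _ =>
            H.neg_log_abs_sub_nonneg (H.iterate_mem j hxI) hcC).trans (hz c hcC)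
          intro j hj
          rw [Finset.mem_filter, Finset.mem_range] at hj
          rw [Finset.mem_erase, Finset.mem_range]
          refine ⟨?_, by omega⟩
          rintro rfl
          exact hj.2 (Finset.mem_image_of_mem z hc)
      _ = p * A * n := by
          rw [Finset.sum_const, nsmul_eq_mul, hp, numCrit]; ring
  have hsplit : ∀ t, ∑ j ∈ Finset.range t, κ j = ∑ j ∈ (Finset.range t).filter (· ∈ Z), κ j +
      ∑ j ∈ (Finset.range t).filter (· ∉ Z), κ j := fun t =>
    (Finset.sum_filter_add_sum_filter_not _ _ _).symm
  have hcard : ∀ t, ((Finset.range t).filter (· ∈ Z)).card ≤ p := fun t =>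
    (Finset.card_le_card fun j hj => (Finset.mem_filter.1 hj).2).trans hZp
  have hD : ∀ t ≤ n, ∑ j ∈ (Finset.range t).filter (· ∈ Z), κ j ≤
      Ks ((Finset.range t).filter (· ∈ Z)).card * n := by
    intro t
    induction t with
    | zero => intro _; simp [hKs]
    | succ t ih =>
      intro ht
      have ih' := ih (by omega)
      by_cases htZ : t ∈ Z
      · rw [Finset.range_add_one, Finset.filter_insert, if_pos htZ, Finset.sum_insert (by simp),
          Finset.card_insert_of_notMem (by simp), hKs1]
        set s := ((Finset.range t).filter (· ∈ Z)).card with hs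
        have h1 := H.le_logExp hxI hxC t
        change _ - β * ∑ i ∈ Finset.range t, κ i ≤ _ at h1
        have h2 : ∑ i ∈ Finset.range t, κ i ≤ (p * A + Ks s) * n := by
          rw [hsplit]; linarith [hout t (by omega)]
        have h3 : t * Real.log B ≤ |Real.log B| * n := by
          have : (t:ℝ) ≤ n := by exact_mod_cast (by omega : t ≤ n)
          have h5 := le_abs_self (Real.log B)
          have h6 := abs_nonneg (Real.log B)
          have h7 : (0:ℝ) ≤ t := Nat.cast_nonneg t
          nlinarith
        have h4 := hn s (Finset.mem_range.2 (Nat.lt_succ_of_le (hcard t))) t (by omega) (by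
          rw [← Real.exp_log (abs_pos.2 (H.derivProd_ne_zero hxI fun i _ => hxC i)),
            H.log_abs_derivProd hxI fun i _ => hxC i]
          refine Real.exp_le_exp.2 ?_
          simp only [hlev]
          nlinarith)
        have h5 : κ t ≤ (lev (Ks s) + Real.log (p + 1) + 1) * n := by
          have := Real.log_lt_log (Real.exp_pos _) h4
          rw [Real.log_exp] at this
          simp only [hκ]
          linarith
        linarith
      · rw [Finset.range_add_one, Finset.filter_insert, if_neg htZ]
        exact ih'
  rw [show (∑ j ∈ Finset.range n, -Real.log (infDist (f^[j] x) C)) = ∑ j ∈ Finset.range n, κ j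
    from rfl, hsplit]
  have h1 := hout n le_rfl
  have h2 := hD n le_rfl
  have h3 : Ks ((Finset.range n).filter (· ∈ Z)).card * n ≤ Ks p * n := by
    gcongr
    exact hmono (hcard n)
  linarith

end NondegenerateMap

section Pliss

/-- `h` is a Pliss time for `c` at level `s` if all the averages of `c` over `[j, h)` are
at least `s`. -/
def IsPlissTime (s : ℝ) (c : ℕ → ℝ) (h : ℕ) : Prop :=
  ∀ j < h, s * (h - j) ≤ ∑ i ∈ Finset.Ico j h, c i

open Classical in
lemma le_card_isPlissTime {s s₁ A : ℝ} {c : ℕ → ℝ} (hc : ∀ i, c i ≤ A) (hs : s < A) {n : ℕ}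
    (hn : s₁ * n ≤ ∑ i ∈ Finset.range n, c i) :
    (s₁ - s) / (A - s) * n ≤ ((Finset.Icc 1 n).filter (IsPlissTime s c)).card := by
  set S : ℕ → ℝ := fun m => ∑ i ∈ Finset.range m, c i - s * m with hS
  have key : ∀ m, ∀ j ≤ m, S j ≤ (A - s) * ((Finset.Icc 1 m).filter (IsPlissTime s c)).card := by
    intro m
    induction m with
    | zero => intro j hj; obtain rfl : j = 0 := by omega
              simp [hS]
    | succ m ih =>
      have hm : (Finset.Icc 1 (m + 1)) = insert (m + 1) (Finset.Icc 1 m) := by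
        ext i; simp only [Finset.mem_Icc, Finset.mem_insert]; omega
      have hmono : ((Finset.Icc 1 m).filter (IsPlissTime s c)).card ≤
          ((Finset.Icc 1 (m + 1)).filter (IsPlissTime s c)).card :=
        Finset.card_le_card (Finset.filter_subset_filter _ (by rw [hm]; exact Finset.subset_insert _ _))
      have hmono' : (A - s) * (((Finset.Icc 1 m).filter (IsPlissTime s c)).card : ℝ) ≤
          (A - s) * ((Finset.Icc 1 (m + 1)).filter (IsPlissTime s c)).card := by
        have : 0 ≤ A - s := by linarith
        gcongr
      intro j hj
      rcases Nat.lt_or_ge j (m + 1) with hlt | hge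
      · exact (ih j (by omega)).trans hmono'
      obtain rfl : j = m + 1 := le_antisymm hj hge
      by_cases hP : IsPlissTime s c (m + 1)
      · rw [hm, Finset.filter_insert, if_pos hP, Finset.card_insert_of_notMem (by simp)]
        have h1 := ih m le_rfl
        have h2 := hc m
        simp only [hS, Finset.sum_range_succ] at h1 ⊢
        push_cast
        linarith
      · unfold IsPlissTime at hP
        push Not at hP
        obtain ⟨i, hi, hlt⟩ := hP
        have h1 := ih i (by omega)
        refine le_trans ?_ (h1.trans hmono')
        simp only [hS]
        rw [← Finset.sum_range_add_sum_Ico c hi.le]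
        push_cast at hlt ⊢
        linarith
  have h1 := key n n le_rfl
  simp only [hS] at h1
  have hA : 0 < A - s := by linarith
  rw [div_mul_eq_mul_div, div_le_iff₀ hA]
  linarith

end Pliss

lemma sum_exp_neg_le {a : ℝ} (ha : 0 < a) (m : ℕ) :
    ∑ i ∈ Finset.range m, Real.exp (-(a * ((m:ℝ) - i))) ≤ 1 / (Real.exp a - 1) := by
  have hpos : 0 < Real.exp a - 1 := by
    have := Real.add_one_le_exp a; linarith
  induction m with
  | zero => simpa using hpos.le
  | succ m ih =>
    have h1 : ∀ i ∈ Finset.range m, Real.exp (-(a * (((m + 1 : ℕ):ℝ) - i))) =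
        Real.exp (-a) * Real.exp (-(a * ((m:ℝ) - i))) := by
      intro i _
      rw [← Real.exp_add]; congr 1; push_cast; ring
    rw [Finset.sum_range_succ, Finset.sum_congr rfl h1, ← Finset.mul_sum]
    have h2 : Real.exp (-(a * (((m + 1 : ℕ):ℝ) - m))) = Real.exp (-a) := by
      congr 1; push_cast; ring
    rw [h2]
    have h3 : Real.exp (-a) * Real.exp a = 1 := by rw [← Real.exp_add]; simp
    rw [le_div_iff₀ hpos] at ih ⊢
    have h4 := Real.exp_pos (-a)
    nlinarith

/-- `h` is a hyperbolic time for `x`: the derivative along the orbit segments ending at time `h`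
is exponentially large and the orbit approaches `C` only exponentially slowly seen from `h`. -/
def HypTime (f : ℝ → ℝ) (C : Set ℝ) (a b δ : ℝ) (h : ℕ) (x : ℝ) : Prop :=
  ∀ j < h, 2 * a * ((h:ℝ) - j) ≤ logExp f h x - logExp f j x ∧
    δ * Real.exp (-(b * ((h:ℝ) - j))) ≤ infDist (f^[j] x) C

/-- Constants for which hyperbolic times give bounded distortion. -/
structure HypConst (β B a b δ r κ : ℝ) : Prop where
  a_pos : 0 < a
  b_pos : 0 < b
  b_le : b ≤ a
  b_mul_le : b * β ≤ a
  δ_pos : 0 < δ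
  r_pos : 0 < r
  r_lt : 64 * r < δ
  κ_eq : κ = 4 * B * r / δ ^ β
  κ_le : κ * (1 / (Real.exp a - 1)) ≤ Real.log 2
  κ_le_a : κ ≤ a

namespace NondegenerateMap

variable {f : ℝ → ℝ} {C : Set ℝ} {β B M : ℝ}

lemma truncDist_bounds (H : NondegenerateMap f C β B M) (δ : ℝ) {x : ℝ}
    (hx : x ∈ Icc (0:ℝ) 1) : 0 ≤ -Real.log (truncDist δ C x) ∧
      -Real.log (truncDist δ C x) ≤ -Real.log (infDist x C) := by
  have := H.neg_log_infDist_nonneg hx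
  unfold truncDist
  split_ifs
  · exact ⟨this, le_rfl⟩
  · simpa using this

lemma ae_eventually_sum_truncDist_le (H : NondegenerateMap f C β B M) {η : ℝ} (hη : 0 < η)
    (hexp : ∀ᵐ x ∂(volume.restrict (Icc (0:ℝ) 1)), ∃ᶠ n : ℕ in atTop, η * n ≤ logExp f n x)
    {ε ε' δ : ℝ} (hε : ε < ε')
    (hslow : ∀ᵐ x ∂(volume.restrict (Icc (0:ℝ) 1)),
      atTop.limsup (fun n : ℕ =>
        (n : ℝ)⁻¹ * ∑ j ∈ Finset.range n, -Real.log (truncDist δ C (f^[j] x))) ≤ ε) :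
    ∀ᵐ x ∂(volume.restrict (Icc (0:ℝ) 1)), ∀ᶠ n : ℕ in atTop,
      ∑ j ∈ Finset.range n, -Real.log (truncDist δ C (f^[j] x)) ≤ ε' * n := by
  obtain ⟨K, hK⟩ := H.ae_eventually_sum_neg_log_infDist_le hη hexp
  filter_upwards [hK, hslow, ae_restrict_mem measurableSet_Icc] with x h1 h2 hx
  have hb : IsBoundedUnder (· ≤ ·) atTop (fun n : ℕ =>
        (n : ℝ)⁻¹ * ∑ j ∈ Finset.range n, -Real.log (truncDist δ C (f^[j] x))) := by
    refine ⟨K, ?_⟩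
    rw [eventually_map]
    filter_upwards [h1, eventually_gt_atTop 0] with n hn hn0
    have hn0' : (0:ℝ) < n := by exact_mod_cast hn0
    rw [inv_mul_le_iff₀ hn0', mul_comm]
    exact (Finset.sum_le_sum fun j _ => (H.truncDist_bounds δ (H.iterate_mem j hx)).2).trans hn
  filter_upwards [eventually_lt_of_limsup_lt (h2.trans_lt hε) hb, eventually_gt_atTop 0]
    with n hn hn0
  have hn0' : (0:ℝ) < n := by exact_mod_cast hn0
  rw [inv_mul_lt_iff₀ hn0'] at hn
  linarith

open Classical in
lemma exists_hypTime (H : NondegenerateMap f C β B M) {η : ℝ} (hη : 0 < η)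
    (hexp : ∀ᵐ x ∂(volume.restrict (Icc (0:ℝ) 1)), ∃ᶠ n : ℕ in atTop, η * n ≤ logExp f n x)
    (hslow : ∀ ε > (0:ℝ), ∃ δ > (0:ℝ), ∀ᵐ x ∂(volume.restrict (Icc (0:ℝ) 1)),
      atTop.limsup (fun n : ℕ =>
        (n : ℝ)⁻¹ * ∑ j ∈ Finset.range n, -Real.log (truncDist δ C (f^[j] x))) ≤ ε) :
    ∃ a b δ r κ θ : ℝ, HypConst β B a b δ r κ ∧ 0 < θ ∧
      ∀ᵐ x ∂(volume.restrict (Icc (0:ℝ) 1)), ∃ᶠ n : ℕ in atTop,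
        θ * n ≤ ((Finset.Icc 1 n).filter fun h => HypTime f C a b δ h x).card := by
  have hβ := H.β_pos
  have hB := H.B_pos
  have hlM := H.log_pos
  set a := η / 8 with ha
  have ha0 : 0 < a := by positivity
  set b := min a (a / β) with hb
  have hb0 : 0 < b := lt_min ha0 (by positivity)
  set L := Real.log M / b with hL
  have hL0 : 0 < L := by positivity
  obtain ⟨δ, hδ, hs⟩ := hslow (a / L) (by positivity)
  set δ₀ := min δ 1 with hδ₀
  have hδ₀pos : 0 < δ₀ := lt_min hδ one_pos
  have hev := H.ae_eventually_sum_truncDist_le hη hexp (ε' := 4 * a / L)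
    (div_lt_div_of_pos_right (by linarith) hL0) hs
  have hea : 0 < Real.exp a - 1 := by
    have := Real.add_one_le_exp a; linarith
  have hδβ : 0 < δ₀ ^ β := Real.rpow_pos_of_pos hδ₀pos _
  have hlog2 : 0 < Real.log 2 := Real.log_pos (by norm_num)
  set q := min (Real.log 2 * (Real.exp a - 1)) a with hq
  have hq0 : 0 < q := lt_min (by positivity) ha0
  set r := min (δ₀ / 65) (q * δ₀ ^ β / (4 * B)) with hr
  have hr0 : 0 < r := lt_min (by positivity) (by positivity)
  have hrq : 4 * B * r / δ₀ ^ β ≤ q := by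
    have h1 := min_le_right (δ₀ / 65) (q * δ₀ ^ β / (4 * B))
    rw [← hr, le_div_iff₀ (by positivity)] at h1
    rw [div_le_iff₀ hδβ]
    linarith
  refine ⟨a, b, δ₀, r, 4 * B * r / δ₀ ^ β, 2 * a / Real.log M,
    ⟨ha0, hb0, min_le_left _ _, ?_, hδ₀pos, hr0, ?_, rfl, ?_,
      hrq.trans (min_le_right _ _)⟩, by positivity, ?_⟩
  · exact (le_div_iff₀ hβ).1 (min_le_right _ _)
  · have := min_le_left (δ₀ / 65) (q * δ₀ ^ β / (4 * B))
    linarith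
  · rw [mul_one_div, div_le_iff₀ hea]
    exact hrq.trans (min_le_left _ _)
  · filter_upwards [hexp, hev, H.ae_orbit_notMem H.finite.countable,
      ae_restrict_mem measurableSet_Icc] with x h1 h2 hxC hx
    refine (h1.and_eventually h2).mono fun n ⟨h3, h4⟩ => ?_
    set τ : ℕ → ℝ := fun i => -Real.log (truncDist δ C (f^[i] x)) with hτ
    have hτ0 : ∀ i, 0 ≤ τ i := fun i => (H.truncDist_bounds δ (H.iterate_mem i hx)).1
    set c : ℕ → ℝ := fun i => Real.log |deriv f (f^[i] x)| - L * τ i with hc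
    have hcA : ∀ i, c i ≤ Real.log M + 2 * a := by
      intro i
      have := H.log_abs_deriv_le (H.iterate_mem i hx)
      have := mul_nonneg hL0.le (hτ0 i)
      simp only [hc]; linarith
    have hsum : 4 * a * n ≤ ∑ i ∈ Finset.range n, c i := by
      simp only [hc]
      rw [Finset.sum_sub_distrib, ← Finset.mul_sum]
      rw [logExp_eq_sum] at h3
      have h5 := mul_le_mul_of_nonneg_left h4 hL0.le
      rw [← mul_assoc, mul_div_cancel₀ _ hL0.ne'] at h5
      have : η * n = 8 * a * n := by rw [ha]; ring
      linarith
    have hP := le_card_isPlissTime hcA (s := 2 * a) (by linarith) hsum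
    rw [show (4 * a - 2 * a) / (Real.log M + 2 * a - 2 * a) = 2 * a / Real.log M by
      congr 1 <;> ring] at hP
    refine hP.trans ?_
    refine Nat.cast_le.2 (Finset.card_le_card fun h hh => ?_)
    rw [Finset.mem_filter] at hh ⊢
    refine ⟨hh.1, fun j hj => ?_⟩
    have hh2 := hh.2 j hj
    have hjh : (j:ℝ) < h := by exact_mod_cast hj
    simp only [hc] at hh2
    rw [Finset.sum_sub_distrib, ← Finset.mul_sum] at hh2
    have hlog : logExp f h x - logExp f j x =
        ∑ i ∈ Finset.Ico j h, Real.log |deriv f (f^[i] x)| := by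
      rw [logExp_eq_sum, logExp_eq_sum, Finset.sum_Ico_eq_sub _ hj.le]
    have hτs : 0 ≤ ∑ i ∈ Finset.Ico j h, τ i := Finset.sum_nonneg fun i _ => hτ0 i
    have hLτ := mul_nonneg hL0.le hτs
    refine ⟨by rw [hlog]; linarith, ?_⟩
    have hτj : τ j ≤ ∑ i ∈ Finset.Ico j h, τ i :=
      Finset.single_le_sum (fun i _ => hτ0 i) (by simpa using hj)
    have hle : ∑ i ∈ Finset.Ico j h, Real.log |deriv f (f^[i] x)| ≤ ((h:ℝ) - j) * Real.log M := by
      refine (Finset.sum_le_sum fun i _ => H.log_abs_deriv_le (H.iterate_mem i hx)).trans_eq ?_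
      rw [Finset.sum_const, Nat.card_Ico, nsmul_eq_mul, Nat.cast_sub hj.le]
    have hτb : τ j ≤ b * ((h:ℝ) - j) := by
      have h6 : L * τ j ≤ ((h:ℝ) - j) * Real.log M := by
        have := mul_le_mul_of_nonneg_left hτj hL0.le
        have : 0 ≤ 2 * a * ((h:ℝ) - j) := by
          have : 0 ≤ (h:ℝ) - j := by linarith
          positivity
        linarith
      rw [hL, div_mul_eq_mul_div, div_le_iff₀ hb0] at h6
      have h7 : Real.log M * τ j ≤ Real.log M * (b * ((h:ℝ) - j)) := by linarith
      exact le_of_mul_le_mul_left h7 hlM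
    have hexp1 : Real.exp (-(b * ((h:ℝ) - j))) ≤ 1 :=
      Real.exp_le_one_iff.2 (by
        have : 0 ≤ (h:ℝ) - j := by linarith
        have := mul_nonneg hb0.le this
        linarith)
    have hep := Real.exp_pos (-(b * ((h:ℝ) - j)))
    have hidn : 0 ≤ infDist (f^[j] x) C := infDist_nonneg
    simp only [hτ, truncDist] at hτb
    split_ifs at hτb with hif
    · have hpos := H.infDist_pos (hxC j)
      have : Real.exp (-(b * ((h:ℝ) - j))) ≤ infDist (f^[j] x) C := by
        rw [← Real.exp_log hpos]; exact Real.exp_le_exp.2 (by linarith)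
      have := min_le_right δ 1
      nlinarith
    · have := min_le_left δ 1
      nlinarith

end NondegenerateMap

lemma exists_deriv_eq_slope_uIcc {g g' : ℝ → ℝ} (hg : ∀ x, HasDerivAt g (g' x) x) (a b : ℝ) :
    ∃ ξ ∈ uIcc a b, g b - g a = g' ξ * (b - a) := by
  rcases lt_trichotomy a b with h | rfl | h
  · obtain ⟨ξ, hξ, he⟩ := exists_hasDerivAt_eq_slope g g' h
      (fun x _ => (hg x).continuousAt.continuousWithinAt) fun x _ => hg x
    refine ⟨ξ, Icc_subset_uIcc (Ioo_subset_Icc_self hξ), ?_⟩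
    rw [he, div_mul_cancel₀ _ (by linarith)]
  · exact ⟨a, by simp, by simp⟩
  · obtain ⟨ξ, hξ, he⟩ := exists_hasDerivAt_eq_slope g g' h
      (fun x _ => (hg x).continuousAt.continuousWithinAt) fun x _ => hg x
    refine ⟨ξ, Icc_subset_uIcc' (Ioo_subset_Icc_self hξ), ?_⟩
    have := div_mul_cancel₀ (g a - g b) (show a - b ≠ 0 by linarith)
    rw [he]; linarith

lemma exists_mem_uIcc_abs_sub_eq {x y R : ℝ} (hR : 0 ≤ R) (h : R ≤ |y - x|) :
    ∃ z ∈ uIcc x y, |z - x| = R := by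
  rcases le_total x y with hxy | hxy
  · rw [abs_of_nonneg (by linarith)] at h
    exact ⟨x + R, by rw [uIcc_of_le hxy]; constructor <;> linarith, by simp [abs_of_nonneg hR]⟩
  · rw [abs_of_nonpos (by linarith)] at h
    exact ⟨x - R, by rw [uIcc_of_ge hxy]; constructor <;> linarith, by simp [abs_of_nonneg hR]⟩

lemma mapsTo_iterate_of_chain {f : ℝ → ℝ} {J : ℕ → Set ℝ} {h : ℕ}
    (hJ : ∀ j < h, MapsTo f (J j) (J (j + 1))) (j i : ℕ) (hij : j + i ≤ h) :
    MapsTo f^[i] (J j) (J (j + i)) := by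
  induction i with
  | zero => exact fun y hy => hy
  | succ i ih =>
    rw [Function.iterate_succ']
    exact (hJ (j + i) (by omega)).comp (ih (by omega))

namespace NondegenerateMap

variable {f : ℝ → ℝ} {C : Set ℝ} {β B M a b δ r κ : ℝ}

lemma distortion_at_hypTime (H : NondegenerateMap f C β B M) (HC : HypConst β B a b δ r κ)
    {x : ℝ} (hx : x ∈ Icc (0:ℝ) 1) {h : ℕ} (hh : HypTime f C a b δ h x) {j : ℕ} (hj : j < h)
    {y : ℝ} (hy : y ∈ Icc (0:ℝ) 1)
    (hyx : |y - f^[j] x| ≤ 4 * r * Real.exp (-(2 * a * ((h:ℝ) - j)))) :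
    f^[j] x ∉ C ∧ y ∉ C ∧ |Real.log |deriv f y| - Real.log (abs (deriv f (f^[j] x)))| ≤
      κ * Real.exp (-(a * ((h:ℝ) - j))) := by
  have hβ := H.β_pos
  have hB := H.B_pos
  have ha := HC.a_pos
  have hb := HC.b_pos
  have hδ := HC.δ_pos
  have hr := HC.r_pos
  set m : ℝ := (h:ℝ) - j with hm
  have hm0 : 0 < m := by
    have : (j:ℝ) < h := by exact_mod_cast hj
    linarith
  set d := infDist (f^[j] x) C with hd
  have hd1 : δ * Real.exp (-(b * m)) ≤ d := (hh j hj).2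
  have hd0 : 0 < d := lt_of_lt_of_le (by positivity) hd1
  have hxC : f^[j] x ∉ C := fun hc => hd0.ne' (infDist_zero_of_mem hc)
  have hlt : |f^[j] x - y| < d / 2 := by
    rw [abs_sub_comm]
    refine hyx.trans_lt ?_
    have h1 : Real.exp (-(2 * a * m)) ≤ Real.exp (-(b * m)) :=
      Real.exp_le_exp.2 (by have := HC.b_le; nlinarith)
    have h2 := Real.exp_pos (-(b * m))
    have h3 := HC.r_lt
    have h4 : 4 * r * Real.exp (-(2 * a * m)) ≤ 4 * r * Real.exp (-(b * m)) := by gcongr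
    nlinarith
  have hyC : y ∉ C := fun hc => by
    have := infDist_le_dist_of_mem (x := f^[j] x) hc
    rw [Real.dist_eq] at this
    linarith
  refine ⟨hxC, hyC, ?_⟩
  rw [abs_sub_comm]
  refine (H.distortion _ ⟨H.iterate_mem j hx, hxC⟩ _ ⟨hy, hyC⟩ hlt).trans ?_
  have h5 : δ ^ β * Real.exp (-(a * m)) ≤ d ^ β := by
    refine le_trans ?_ (Real.rpow_le_rpow (by positivity) hd1 hβ.le)
    rw [Real.mul_rpow hδ.le (Real.exp_pos _).le, ← Real.exp_mul]
    have := HC.b_mul_le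
    gcongr
    nlinarith
  have hδβ : 0 < δ ^ β := Real.rpow_pos_of_pos hδ _
  rw [div_le_iff₀ (Real.rpow_pos_of_pos hd0 _), HC.κ_eq]
  rw [abs_sub_comm] at hyx
  have e1 : Real.exp (-(2 * a * m)) = Real.exp (-(a * m)) * Real.exp (-(a * m)) := by
    rw [← Real.exp_add]; congr 1; ring
  calc B * |f^[j] x - y| ≤ B * (4 * r * Real.exp (-(2 * a * m))) := by gcongr
    _ = 4 * B * r / δ ^ β * Real.exp (-(a * m)) * (δ ^ β * Real.exp (-(a * m))) := by
        rw [e1]; field_simp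
    _ ≤ _ := by gcongr

lemma κ_nonneg (H : NondegenerateMap f C β B M) (HC : HypConst β B a b δ r κ) : 0 ≤ κ := by
  have := H.B_pos
  have := HC.r_pos
  have := HC.δ_pos
  rw [HC.κ_eq]; positivity

/-- A point whose orbit stays close to that of `x` up to a hyperbolic time of `x` is expanded
almost as much. -/
lemma le_logExp_of_close (H : NondegenerateMap f C β B M) (HC : HypConst β B a b δ r κ)
    {x : ℝ} (hx : x ∈ Icc (0:ℝ) 1) {h : ℕ} (hh : HypTime f C a b δ h x) {i : ℕ} (hi : i < h)
    {ξ : ℝ} (hξ : ξ ∈ Icc (0:ℝ) 1) (hclose : ∀ t < h - i,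
      |f^[t] ξ - f^[i + t] x| ≤ 4 * r * Real.exp (-(2 * a * ((h:ℝ) - (i + t : ℕ))))) :
    (∀ t < h - i, f^[t] ξ ∉ C) ∧
      2 * a * ((h:ℝ) - i) - Real.log 2 ≤ logExp f (h - i) ξ ∧
      a * ((h:ℝ) - i) ≤ logExp f (h - i) ξ := by
  have ha := HC.a_pos
  have hit : ∀ t, f^[t] (f^[i] x) = f^[i + t] x := fun t => by
    rw [add_comm, Function.iterate_add_apply]
  have hpt : ∀ t < h - i, f^[i + t] x ∉ C ∧ f^[t] ξ ∉ C ∧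
      |Real.log |deriv f (f^[t] ξ)| - Real.log (abs (deriv f (f^[i + t] x)))| ≤
      κ * Real.exp (-(a * ((h:ℝ) - (i + t : ℕ)))) := fun t ht =>
    H.distortion_at_hypTime HC hx hh (by omega) (H.iterate_mem t hξ) (hclose t ht)
  have e1 : logExp f h x - logExp f i x =
      ∑ t ∈ Finset.range (h - i), Real.log |deriv f (f^[i + t] x)| := by
    have := logExp_add f i (h - i) x
    rw [show i + (h - i) = h by omega] at this
    rw [this, logExp_eq_sum f (h - i)]
    simp only [hit]; ring
  have e2 : ∑ t ∈ Finset.range (h - i), κ * Real.exp (-(a * ((h:ℝ) - (i + t : ℕ)))) ≤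
      Real.log 2 := by
    rw [← Finset.mul_sum]
    refine le_trans ?_ HC.κ_le
    refine mul_le_mul_of_nonneg_left ?_ (H.κ_nonneg HC)
    refine le_trans (le_of_eq ?_) (sum_exp_neg_le ha (h - i))
    refine Finset.sum_congr rfl fun t _ => ?_
    rw [Nat.cast_sub hi.le]; push_cast; congr 2; ring
  have e2' : ∑ t ∈ Finset.range (h - i), κ * Real.exp (-(a * ((h:ℝ) - (i + t : ℕ)))) ≤
      a * ((h:ℝ) - i) := by
    have : ∀ t ∈ Finset.range (h - i), κ * Real.exp (-(a * ((h:ℝ) - (i + t : ℕ)))) ≤ a := by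
      intro t ht
      have ht' : ((i + t : ℕ) : ℝ) < h := by
        have := Finset.mem_range.1 ht
        exact_mod_cast (show i + t < h by omega)
      have h1 : Real.exp (-(a * ((h:ℝ) - (i + t : ℕ)))) ≤ 1 := Real.exp_le_one_iff.2 (by
        have := mul_pos ha (sub_pos.2 ht')
        linarith)
      have := mul_le_mul_of_nonneg_left h1 (H.κ_nonneg HC)
      linarith [HC.κ_le_a]
    refine (Finset.sum_le_sum this).trans_eq ?_
    rw [Finset.sum_const, Finset.card_range, nsmul_eq_mul, Nat.cast_sub hi.le, mul_comm]
  have e3 : ∑ t ∈ Finset.range (h - i), (Real.log |deriv f (f^[i + t] x)| -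
      κ * Real.exp (-(a * ((h:ℝ) - (i + t : ℕ))))) ≤
      ∑ t ∈ Finset.range (h - i), Real.log |deriv f (f^[t] ξ)| :=
    Finset.sum_le_sum fun t ht => by
      have := neg_le_of_abs_le (hpt t (Finset.mem_range.1 ht)).2.2
      linarith
  have h1 := (hh i hi).1
  rw [Finset.sum_sub_distrib] at e3
  rw [logExp_eq_sum f (h - i) ξ]
  exact ⟨fun t ht => (hpt t ht).2.1, by linarith, by linarith⟩

lemma abs_sub_le_of_hypTime (H : NondegenerateMap f C β B M) (HC : HypConst β B a b δ r κ)
    {x : ℝ} (hx : x ∈ Icc (0:ℝ) 1) {h : ℕ} (hh : HypTime f C a b δ h x) {J : ℕ → Set ℝ}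
    (hJI : ∀ j ≤ h, J j ⊆ Icc 0 1) (hJc : ∀ j < h, (J j).OrdConnected)
    (hxJ : ∀ j ≤ h, f^[j] x ∈ J j) (hJ : ∀ j < h, MapsTo f (J j) (J (j + 1)))
    (hlast : ∀ y ∈ J h, |y - f^[h] x| ≤ r) (j : ℕ) (hj : j ≤ h) (y : ℝ) (hy : y ∈ J j) :
    |y - f^[j] x| ≤ 4 * r * Real.exp (-(2 * a * ((h:ℝ) - j))) := by
  have hr := HC.r_pos
  have ha := HC.a_pos
  suffices key : ∀ m j, j + m = h → ∀ i, j ≤ i → i ≤ h → ∀ y ∈ J i,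
      |y - f^[i] x| ≤ 4 * r * Real.exp (-(2 * a * ((h:ℝ) - i))) from
    key (h - j) j (by omega) j le_rfl hj y hy
  clear y hy hj j
  intro m
  induction m with
  | zero =>
    intro j hj i hi1 hi2 y hy
    obtain rfl : i = h := by omega
    have := hlast y hy
    simp only [sub_self, mul_zero, neg_zero, Real.exp_zero]
    linarith
  | succ m ih =>
    intro j hj i hi1 hi2 y hy
    rcases Nat.lt_or_ge j i with hlt | hge
    · exact ih (j + 1) (by omega) i hlt hi2 y hy
    obtain rfl : i = j := le_antisymm hge hi1
    by_contra! hcon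
    set R := 4 * r * Real.exp (-(2 * a * ((h:ℝ) - i))) with hR
    obtain ⟨z, hz, hzR⟩ := exists_mem_uIcc_abs_sub_eq (by positivity) hcon.le
    have hsub : uIcc (f^[i] x) y ⊆ J i := (hJc i (by omega)).uIcc_subset (hxJ i hi2) hy
    obtain ⟨ξ, hξ, hξe⟩ := exists_deriv_eq_slope_uIcc
      (hasDerivAt_iterate_derivProd H.differentiable (h - i)) (f^[i] x) z
    have hξR : |ξ - f^[i] x| ≤ R := (abs_sub_left_of_mem_uIcc hξ).trans hzR.le
    have hξJ : ξ ∈ J i := hsub (uIcc_subset_uIcc_left hz hξ)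
    have hit : f^[h - i] (f^[i] x) = f^[h] x := by
      rw [← Function.iterate_add_apply, show h - i + i = h by omega]
    obtain ⟨hne, hlog, -⟩ := H.le_logExp_of_close HC hx hh (i := i) (by omega) (hJI i hi2 hξJ)
      fun t ht => by
        rcases Nat.eq_zero_or_pos t with rfl | htpos
        · exact hξR
        · exact ih (i + 1) (by omega) (i + t) (by omega) (by omega) _
            (mapsTo_iterate_of_chain hJ i t (by omega) hξJ)
    have hD : Real.exp (2 * a * ((h:ℝ) - i)) / 2 ≤ |derivProd f (h - i) ξ| := by
      have hξI := hJI i hi2 hξJ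
      rw [← Real.exp_log (abs_pos.2 (H.derivProd_ne_zero hξI hne)), H.log_abs_derivProd hξI hne]
      calc _ = Real.exp (2 * a * ((h:ℝ) - i) - Real.log 2) := by
            rw [Real.exp_sub, Real.exp_log (by norm_num)]
        _ ≤ _ := Real.exp_le_exp.2 hlog
    have hzJ : f^[h - i] z ∈ J h := by
      have := mapsTo_iterate_of_chain hJ i (h - i) (by omega) (hsub hz)
      rwa [show i + (h - i) = h by omega] at this
    have h1 := hlast _ hzJ
    rw [hit] at hξe
    rw [hξe, abs_mul, hzR] at h1
    have h2 : Real.exp (2 * a * ((h:ℝ) - i)) / 2 * R = 2 * r := by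
      have : Real.exp (2 * a * ((h:ℝ) - i)) * Real.exp (-(2 * a * ((h:ℝ) - i))) = 1 := by
        rw [← Real.exp_add]; simp
      rw [hR]; linear_combination 2 * r * this
    have h3 : Real.exp (2 * a * ((h:ℝ) - i)) / 2 * R ≤ |derivProd f (h - i) ξ| * R := by
      gcongr
    linarith

lemma exists_large_image (H : NondegenerateMap f C β B M) (HC : HypConst β B a b δ r κ)
    (hyp : ∀ᵐ x ∂(volume.restrict (Icc (0:ℝ) 1)), ∃ᶠ h in atTop, HypTime f C a b δ h x)
    {u v : ℝ} (huv : u < v) (hs : Icc u v ⊆ Icc 0 1) :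
    ∃ n, 1 ≤ n ∧ ∃ y ∈ f^[n] '' Icc u v, ∃ z ∈ f^[n] '' Icc u v, r < z - y := by
  by_contra! hcon
  have hr := HC.r_pos
  have ha := HC.a_pos
  obtain ⟨x, hx, hfr⟩ := exists_mem_Icc_of_ae hyp huv hs
  have hev : ∀ᶠ h : ℕ in atTop, 8 * r * Real.exp (-(2 * a * (h:ℝ))) < v - u := by
    have h1 : Tendsto (fun h : ℕ => 8 * r * Real.exp (-(2 * a * (h:ℝ)))) atTop
        (nhds (8 * r * 0)) :=
      (Real.tendsto_exp_neg_atTop_nhds_zero.comp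
        (tendsto_natCast_atTop_atTop.const_mul_atTop (by positivity : 0 < 2 * a))).const_mul _
    rw [mul_zero] at h1
    exact h1.eventually_lt_const (by linarith)
  obtain ⟨h, hh, hlt, hpos⟩ := (hfr.and_eventually (hev.and (eventually_ge_atTop 1))).exists
  have key := H.abs_sub_le_of_hypTime HC (hs hx) hh (J := fun j => f^[j] '' Icc u v)
    (fun j _ => by rintro _ ⟨y, hy, rfl⟩; exact H.iterate_mem j (hs hy))
    (fun j _ => (isPreconnected_Icc.image _ (H.continuous_iterate j).continuousOn).ordConnected)
    (fun j _ => mem_image_of_mem _ hx)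
    (fun j _ => by
      rintro _ ⟨y, hy, rfl⟩
      exact ⟨y, hy, Function.iterate_succ_apply' f j y⟩)
    (fun y hy => by
      rw [abs_le]
      have h1 := hcon h hpos y hy _ (mem_image_of_mem _ hx)
      have h2 := hcon h hpos _ (mem_image_of_mem _ hx) y hy
      constructor <;> linarith) 0 (Nat.zero_le h)
  have h1 := key u ⟨u, left_mem_Icc.2 huv.le, rfl⟩
  have h2 := key v ⟨v, right_mem_Icc.2 huv.le, rfl⟩
  simp only [Function.iterate_zero, id, Nat.cast_zero, sub_zero] at h1 h2
  rw [abs_le] at h1 h2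
  linarith

lemma exists_grid_subset {N : ℕ} (hN : 0 < N) {r y z : ℝ} (hr : 2 / N ≤ r) (hy : 0 ≤ y)
    (hz : z ≤ 1) (hyz : r < z - y) : ∃ i < N, Icc ((i:ℝ) / N) ((i + 1) / N) ⊆ Icc y z := by
  have hN' : (0:ℝ) < N := by exact_mod_cast hN
  have h1 := Nat.le_ceil (y * N)
  have h2 := Nat.ceil_lt_add_one (show 0 ≤ y * N by positivity)
  rw [div_le_iff₀ hN'] at hr
  have h3 : ((⌈y * N⌉₊ : ℕ):ℝ) + 1 < z * N := by nlinarith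
  refine ⟨⌈y * N⌉₊, ?_, Icc_subset_Icc ?_ ?_⟩
  · have : ((⌈y * N⌉₊ : ℕ):ℝ) < N := by nlinarith
    exact_mod_cast this
  · rwa [le_div_iff₀ hN']
  · rw [div_le_iff₀ hN']; exact h3.le

lemma exists_grid_subset_image (H : NondegenerateMap f C β B M) (HC : HypConst β B a b δ r κ)
    (hyp : ∀ᵐ x ∂(volume.restrict (Icc (0:ℝ) 1)), ∃ᶠ h in atTop, HypTime f C a b δ h x)
    {N : ℕ} (hN : 0 < N) (hr : 2 / N ≤ r) {u v : ℝ} (huv : u < v) (hs : Icc u v ⊆ Icc 0 1) :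
    ∃ n, 1 ≤ n ∧ ∃ i : Fin N, Icc ((i:ℝ) / N) ((i + 1) / N) ⊆ f^[n] '' Icc u v := by
  obtain ⟨n, hn, y, hy, z, hz, hyz⟩ := H.exists_large_image HC hyp huv hs
  have hI : f^[n] '' Icc u v ⊆ Icc 0 1 := by
    rintro _ ⟨w, hw, rfl⟩; exact H.iterate_mem n (hs hw)
  obtain ⟨i, hi, hsub⟩ := exists_grid_subset hN hr (hI hy).1 (hI hz).2 hyz
  exact ⟨n, hn, ⟨i, hi⟩, hsub.trans
    ((isPreconnected_Icc.image _ (H.continuous_iterate n).continuousOn).ordConnected.out hy hz)⟩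

lemma grid_subset {N : ℕ} (i : Fin N) : Icc ((i:ℝ) / N) ((i + 1) / N) ⊆ Icc (0:ℝ) 1 := by
  have hN' : (0:ℝ) < N := by exact_mod_cast i.pos
  refine Icc_subset_Icc (by positivity) ?_
  rw [div_le_one hN']
  exact_mod_cast i.2

lemma exists_preperiodic (H : NondegenerateMap f C β B M) (HC : HypConst β B a b δ r κ)
    (hyp : ∀ᵐ x ∂(volume.restrict (Icc (0:ℝ) 1)), ∃ᶠ h in atTop, HypTime f C a b δ h x)
    {N : ℕ} (hN : 0 < N) (hr : 2 / N ≤ r) {u v : ℝ} (huv : u < v) (hs : Icc u v ⊆ Icc 0 1) :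
    ∃ y ∈ Icc u v, ∃ m k, 1 ≤ k ∧ f^[k] (f^[m] y) = f^[m] y := by
  have hN' : (0:ℝ) < N := by exact_mod_cast hN
  set L : Fin N → Set ℝ := fun i => Icc ((i:ℝ) / N) ((i + 1) / N) with hL
  have hstep : ∀ i : Fin N, ∃ n, 1 ≤ n ∧ ∃ i' : Fin N, L i' ⊆ f^[n] '' L i := fun i =>
    H.exists_grid_subset_image HC hyp hN hr
      (div_lt_div_of_pos_right (by linarith) hN') (grid_subset i)
  choose n hn σ hσ using hstep
  have hchain : ∀ s i, ∃ m, s ≤ m ∧ L (σ^[s] i) ⊆ f^[m] '' L i := by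
    intro s i
    induction s with
    | zero => exact ⟨0, le_rfl, by simp⟩
    | succ s ih =>
      obtain ⟨m, hm, hsub⟩ := ih
      refine ⟨n (σ^[s] i) + m, by have := hn (σ^[s] i); omega, ?_⟩
      rw [Function.iterate_succ_apply', Function.iterate_add, image_comp]
      exact (hσ _).trans (image_mono hsub)
  obtain ⟨n₀, _, i₀, h₀⟩ := H.exists_grid_subset_image HC hyp hN hr huv hs
  obtain ⟨t, t', hne, heq⟩ := Finite.exists_ne_map_eq_of_infinite fun t : ℕ => σ^[t] i₀
  wlog hlt : t < t' generalizing t t'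
  · exact this t' t hne.symm heq.symm (by omega)
  set i := σ^[t] i₀ with hi
  have heq' : σ^[t' - t] i = i := by
    rw [hi, ← Function.iterate_add_apply, show t' - t + t = t' by omega]
    exact heq.symm
  obtain ⟨k, hk, hks⟩ := hchain (t' - t) i
  rw [heq'] at hks
  obtain ⟨m, _, hms⟩ := hchain t i₀
  have hle : ((i:ℝ) / N) ≤ (i + 1) / N := div_le_div_of_nonneg_right (by linarith) hN'.le
  obtain ⟨p, hp, hpe⟩ := hks (left_mem_Icc.2 hle)
  obtain ⟨q, hq, hqe⟩ := hks (right_mem_Icc.2 hle)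
  obtain ⟨c, hc, hfix⟩ := exists_mem_uIcc_isFixedPt (a := q) (b := p) (f := f^[k])
    (H.continuous_iterate k).continuousOn (by rw [hqe]; exact hq.2) (by rw [hpe]; exact hp.1)
  have hcL : c ∈ L i := ordConnected_Icc.uIcc_subset hq hp hc
  obtain ⟨w, hw, hwc⟩ := hms hcL
  obtain ⟨y, hy, hyw⟩ := h₀ hw
  refine ⟨y, hy, m + n₀, k, by omega, ?_⟩
  rw [Function.iterate_add_apply, hyw, hwc]
  exact hfix

lemma finite_orbit_of_preperiodic {f : ℝ → ℝ} {y : ℝ} {m k : ℕ} (hk : 1 ≤ k)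
    (h : f^[k] (f^[m] y) = f^[m] y) : (range fun n => f^[n] y).Finite := by
  refine ((Finset.range (m + k)).finite_toSet.image fun n => f^[n] y).subset ?_
  rintro _ ⟨n, rfl⟩
  induction n using Nat.strong_induction_on with
  | _ n ih =>
    rcases Nat.lt_or_ge n (m + k) with hlt | hge
    · exact ⟨n, by simpa using hlt, rfl⟩
    · have : f^[n] y = f^[n - k] y := by
        conv_lhs => rw [show n = (n - m - k) + (k + m) by omega, Function.iterate_add_apply,
          Function.iterate_add_apply f k m, h, ← Function.iterate_add_apply]
        congr 1
        rw [show n - m - k + m = n - k by omega]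
      simp only [this]
      exact ih (n - k) (by omega)

/-- There is a finite forward invariant set meeting all intervals of length larger than `r`. -/
lemma exists_finite_invariant (H : NondegenerateMap f C β B M) (HC : HypConst β B a b δ r κ)
    (hyp : ∀ᵐ x ∂(volume.restrict (Icc (0:ℝ) 1)), ∃ᶠ h in atTop, HypTime f C a b δ h x) :
    ∃ E : Set ℝ, E.Finite ∧ MapsTo f E E ∧ ∀ y ∈ Icc (0:ℝ) 1, ∀ z ∈ Icc (0:ℝ) 1,
      (∀ w ∈ uIcc y z, w ∉ E) → |y - z| ≤ r := by
  have hr := HC.r_pos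
  obtain ⟨N, hN⟩ := exists_nat_gt (2 / r)
  have hN' : (0:ℝ) < N := lt_trans (by positivity) hN
  have hN0 : 0 < N := by exact_mod_cast hN'
  have hNr : 2 / N ≤ r := by
    rw [div_lt_iff₀ hr] at hN
    rw [div_le_iff₀ hN']; linarith
  have hp : ∀ i : Fin N, ∃ y ∈ Icc ((i:ℝ) / N) ((i + 1) / N), ∃ m k, 1 ≤ k ∧
      f^[k] (f^[m] y) = f^[m] y := fun i => H.exists_preperiodic HC hyp hN0 hNr
        (div_lt_div_of_pos_right (by linarith) hN') (grid_subset i)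
  choose y hy m k hk hmk using hp
  refine ⟨⋃ i, range fun n => f^[n] (y i),
    finite_iUnion fun i => finite_orbit_of_preperiodic (hk i) (hmk i), ?_, ?_⟩
  · rintro w hw
    obtain ⟨i, n, rfl⟩ := mem_iUnion.1 hw
    exact mem_iUnion.2 ⟨i, n + 1, Function.iterate_succ_apply' f n _⟩
  · have key : ∀ p ∈ Icc (0:ℝ) 1, ∀ q ∈ Icc (0:ℝ) 1,
        (∀ w ∈ uIcc p q, w ∉ ⋃ i, range fun n => f^[n] (y i)) → q - p ≤ r := by
      intro p hp q hq hw
      by_contra! hcon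
      obtain ⟨i, hi, hsub⟩ := exists_grid_subset hN0 hNr hp.1 hq.2 hcon
      exact hw (y ⟨i, hi⟩) (Icc_subset_uIcc (hsub (hy ⟨i, hi⟩)))
        (mem_iUnion.2 ⟨⟨i, hi⟩, 0, rfl⟩)
    intro p hp q hq hw
    rw [abs_le]
    have h1 := key p hp q hq hw
    have h2 := key q hq p hp (by rwa [uIcc_comm])
    constructor <;> linarith

end NondegenerateMap

/-- The points of `[0,1]` that are not separated from `x` by `f^[n] ⁻¹' E`. -/
def orbitComp (f : ℝ → ℝ) (E : Set ℝ) (n : ℕ) (x : ℝ) : Set ℝ :=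
  {y | y ∈ Icc (0:ℝ) 1 ∧ ∀ z ∈ uIcc x y, f^[n] z ∉ E}

section OrbitComp

variable {f : ℝ → ℝ} {E : Set ℝ} {n m : ℕ} {x y z : ℝ}

lemma mem_orbitComp_self (hx : x ∈ Icc (0:ℝ) 1) (h : f^[n] x ∉ E) : x ∈ orbitComp f E n x :=
  ⟨hx, by simpa using h⟩

lemma orbitComp_notMem (hy : y ∈ orbitComp f E n x) : f^[n] y ∉ E := hy.2 y right_mem_uIcc

lemma mem_orbitComp_symm (hx : x ∈ Icc (0:ℝ) 1) (hy : y ∈ orbitComp f E n x) :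
    x ∈ orbitComp f E n y := ⟨hx, by rw [uIcc_comm]; exact hy.2⟩

lemma mem_orbitComp_trans (hy : y ∈ orbitComp f E n x) (hz : z ∈ orbitComp f E n y) :
    z ∈ orbitComp f E n x :=
  ⟨hz.1, fun w hw => (uIcc_subset_uIcc_union_uIcc hw).elim (hy.2 w) (hz.2 w)⟩

lemma orbitComp_eq (hx : x ∈ Icc (0:ℝ) 1) (hy : y ∈ orbitComp f E n x) :
    orbitComp f E n y = orbitComp f E n x :=
  Subset.antisymm (fun _ hz => mem_orbitComp_trans hy hz)
    fun _ hz => mem_orbitComp_trans (mem_orbitComp_symm hx hy) hz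

lemma uIcc_subset_Icc_of_mem (hx : x ∈ Icc (0:ℝ) 1) (hy : y ∈ Icc (0:ℝ) 1) :
    uIcc x y ⊆ Icc (0:ℝ) 1 := ordConnected_Icc.uIcc_subset hx hy

lemma uIcc_subset_orbitComp (hx : x ∈ Icc (0:ℝ) 1) (hy : y ∈ orbitComp f E n x) :
    uIcc x y ⊆ orbitComp f E n x := fun _ hz =>
  ⟨uIcc_subset_Icc_of_mem hx hy.1 hz, fun w hw => hy.2 w (uIcc_subset_uIcc_left hz hw)⟩

lemma ordConnected_orbitComp (hx : x ∈ Icc (0:ℝ) 1) : (orbitComp f E n x).OrdConnected := by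
  refine ordConnected_iff_uIcc_subset.2 fun y hy z hz => ?_
  rw [← orbitComp_eq hx hy] at hz ⊢
  exact uIcc_subset_orbitComp hy.1 hz

lemma orbitComp_add_subset (hE : MapsTo f E E) :
    orbitComp f E (n + m) x ⊆ orbitComp f E n x := fun y hy => ⟨hy.1, fun z hz hzE => hy.2 z hz (by
  rw [add_comm, Function.iterate_add_apply]; exact hE.iterate m hzE)⟩

lemma mapsTo_orbitComp (hf : Continuous f) (hI : MapsTo f (Icc (0:ℝ) 1) (Icc 0 1)) :
    MapsTo f^[n] (orbitComp f E (n + m) x) (orbitComp f E m (f^[n] x)) := fun y hy =>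
  ⟨hI.iterate n hy.1, fun z hz => by
    obtain ⟨w, hw, rfl⟩ := intermediate_value_uIcc (hf.iterate n).continuousOn hz
    rw [← Function.iterate_add_apply, add_comm]
    exact hy.2 w hw⟩

end OrbitComp

/-- `n` is a Markov time for `x` if `f^[n]` maps the component of `x` of order `n` onto a
component of order `0`, with uniform expansion and bounded distortion. -/
structure MarkovTime (f : ℝ → ℝ) (C E : Set ℝ) (a K : ℝ) (n : ℕ) (x : ℝ) : Prop where
  pos : 1 ≤ n
  mem : x ∈ Icc (0:ℝ) 1
  notMem : f^[n] x ∉ E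
  surj : orbitComp f E 0 (f^[n] x) ⊆ f^[n] '' orbitComp f E n x
  crit : ∀ y ∈ orbitComp f E n x, ∀ j < n, f^[j] y ∉ C
  expand : ∀ y ∈ orbitComp f E n x, ∀ j < n, a * ((n:ℝ) - j) ≤ logExp f (n - j) (f^[j] y)
  dist : ∀ y ∈ orbitComp f E n x, ∀ z ∈ orbitComp f E n x, ∀ j < n,
    abs (Real.log (abs (deriv f (f^[j] y))) - Real.log (abs (deriv f (f^[j] z)))) ≤
      K * Real.exp (-(a * ((n:ℝ) - j))) * |f^[n] y - f^[n] z|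

/-- Between the endpoints of an interval on which `g` is injective, every value that is not
separated from `g x` by the endpoint values is attained. -/
lemma exists_preimage_Ioo {g : ℝ → ℝ} (hg : Continuous g) {α γ x p : ℝ} (hx : x ∈ Ioo α γ)
    (hinj : InjOn g (Ioo α γ)) (hα : g α ∉ uIcc (g x) p) (hγ : g γ ∉ uIcc (g x) p) :
    ∃ w ∈ Ioo α γ, g w = p := by
  wlog hp : g x ≤ p generalizing g p
  · obtain ⟨w, hw, he⟩ := this hg.neg (p := -p) (fun y hy z hz h => hinj hy hz (neg_injective h))
      (fun h => hα (by
        rw [mem_uIcc] at h ⊢; simp only [Pi.neg_apply, neg_le_neg_iff] at h; tauto))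
      (fun h => hγ (by
        rw [mem_uIcc] at h ⊢; simp only [Pi.neg_apply, neg_le_neg_iff] at h; tauto))
      (neg_le_neg (not_le.1 hp).le)
    exact ⟨w, hw, neg_injective he⟩
  rw [uIcc_of_le hp, mem_Icc, not_and_or, not_le, not_le] at hα hγ
  have left : ∀ v, v ∈ uIcc (g α) (g x) → v ≠ g α → ∃ w ∈ Ioc α x, g w = v := fun v hv hne => by
    obtain ⟨w, hw, rfl⟩ := intermediate_value_uIcc hg.continuousOn hv
    rw [uIcc_of_le hx.1.le] at hw
    exact ⟨w, ⟨hw.1.lt_of_ne (by rintro rfl; exact hne rfl), hw.2⟩, rfl⟩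
  have right : ∀ v, v ∈ uIcc (g x) (g γ) → v ≠ g γ → ∃ w ∈ Ico x γ, g w = v := fun v hv hne => by
    obtain ⟨w, hw, rfl⟩ := intermediate_value_uIcc hg.continuousOn hv
    rw [uIcc_of_le hx.2.le] at hw
    exact ⟨w, ⟨hw.1, hw.2.lt_of_ne (by rintro rfl; exact hne rfl)⟩, rfl⟩
  rcases hα with hα | hα
  · rcases hγ with hγ | hγ
    · obtain ⟨v, hv1, hv2⟩ := exists_between (max_lt hα hγ)
      rw [max_lt_iff] at hv1
      obtain ⟨w, hw, hwv⟩ := left v (mem_uIcc.2 (Or.inl ⟨hv1.1.le, hv2.le⟩)) hv1.1.ne'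
      obtain ⟨w', hw', hwv'⟩ := right v (mem_uIcc.2 (Or.inr ⟨hv1.2.le, hv2.le⟩)) hv1.2.ne'
      have := hinj ⟨hw.1, hw.2.trans_lt hx.2⟩ ⟨hx.1.trans_le hw'.1, hw'.2⟩ (hwv.trans hwv'.symm)
      have hwx : w = x := le_antisymm hw.2 (this ▸ hw'.1)
      rw [hwx] at hwv
      exact absurd hwv hv2.ne'
    · obtain ⟨w, hw, he⟩ := right p (mem_uIcc.2 (Or.inl ⟨hp, hγ.le⟩)) hγ.ne
      exact ⟨w, ⟨hx.1.trans_le hw.1, hw.2⟩, he⟩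
  · obtain ⟨w, hw, he⟩ := left p (mem_uIcc.2 (Or.inr ⟨hp, hα.le⟩)) hα.ne
    exact ⟨w, ⟨hw.1, hw.2.trans_lt hx.2⟩, he⟩

namespace MarkovTime

variable {f : ℝ → ℝ} {C E : Set ℝ} {β B M a b δ r κ K : ℝ} {n m : ℕ} {x y : ℝ}

lemma of_mem_orbitComp (H : NondegenerateMap f C β B M) (h : MarkovTime f C E a K n x)
    (hy : y ∈ orbitComp f E n x) : MarkovTime f C E a K n y := by
  have e := orbitComp_eq h.mem hy
  have e' : orbitComp f E 0 (f^[n] y) = orbitComp f E 0 (f^[n] x) :=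
    orbitComp_eq (H.iterate_mem n h.mem)
      (mapsTo_orbitComp (m := 0) H.differentiable.continuous H.mapsTo hy)
  exact ⟨h.pos, hy.1, orbitComp_notMem hy, by rw [e, e']; exact h.surj, by rw [e]; exact h.crit,
    by rw [e]; exact h.expand, by rw [e]; exact h.dist⟩

lemma derivProd_eq (H : NondegenerateMap f C β B M) (h : MarkovTime f C E a K n x)
    (hy : y ∈ orbitComp f E n x) : |derivProd f n y| = Real.exp (logExp f n y) := by
  rw [← H.log_abs_derivProd hy.1 (h.crit y hy),
    Real.exp_log (abs_pos.2 (H.derivProd_ne_zero hy.1 (h.crit y hy)))]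

lemma abs_sub_le (H : NondegenerateMap f C β B M) (h : MarkovTime f C E a K n x) {z : ℝ}
    (hy : y ∈ orbitComp f E n x) (hz : z ∈ orbitComp f E n x) :
    |y - z| ≤ Real.exp (-(a * n)) * |f^[n] y - f^[n] z| := by
  obtain ⟨ξ, hξ, he⟩ := exists_deriv_eq_slope_uIcc
    (hasDerivAt_iterate_derivProd H.differentiable n) z y
  have hξ' := (ordConnected_orbitComp h.mem).uIcc_subset hz hy hξ
  rw [he, abs_mul, h.derivProd_eq H hξ', ← mul_assoc, ← Real.exp_add]
  refine le_mul_of_one_le_left (abs_nonneg _) (Real.one_le_exp ?_)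
  have := h.expand ξ hξ' 0 h.pos
  simp only [Nat.cast_zero, sub_zero, Nat.sub_zero, Function.iterate_zero, id] at this
  linarith

lemma injOn (H : NondegenerateMap f C β B M) (h : MarkovTime f C E a K n x) :
    InjOn f^[n] (orbitComp f E n x) := fun y hy z hz he => by
  have := h.abs_sub_le H hy hz
  rw [he, sub_self, abs_zero, mul_zero] at this
  exact sub_eq_zero.1 (abs_nonpos_iff.1 this)

lemma subset_image (H : NondegenerateMap f C β B M) (hE : MapsTo f E E)
    (h : MarkovTime f C E a K n x) :
    orbitComp f E m (f^[n] x) ⊆ f^[n] '' orbitComp f E (n + m) x := by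
  intro q hq
  have hx := mem_orbitComp_self h.mem h.notMem
  have hq0 : q ∈ orbitComp f E 0 (f^[n] x) := by
    have := orbitComp_add_subset (n := 0) (m := m) hE (x := f^[n] x)
    rw [zero_add] at this
    exact this hq
  obtain ⟨w, hw, rfl⟩ := h.surj hq0
  refine ⟨w, ⟨hw.1, fun z hz => ?_⟩, rfl⟩
  rw [add_comm, Function.iterate_add_apply]
  refine hq.2 _ ?_
  have hsub : uIcc x w ⊆ orbitComp f E n x := uIcc_subset_orbitComp h.mem hw
  rcases ContinuousOn.strictMonoOn_of_injOn_Icc' (a := x ⊓ w) (b := x ⊔ w) inf_le_sup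
    (H.continuous_iterate n).continuousOn ((h.injOn H).mono hsub) with hm | hm
  · exact hm.monotoneOn.mapsTo_uIcc hz
  · exact hm.antitoneOn.mapsTo_uIcc hz

lemma add (H : NondegenerateMap f C β B M) (hE : MapsTo f E E) (hK : 0 ≤ K)
    (h : MarkovTime f C E a K n x) (h' : MarkovTime f C E a K m (f^[n] x)) :
    MarkovTime f C E a K (n + m) x := by
  have hsub := orbitComp_add_subset (n := n) (m := m) hE (x := x)
  have hmap := mapsTo_orbitComp (n := n) (m := m) (E := E) (x := x)
    H.differentiable.continuous H.mapsTo
  have hnm : ∀ y, f^[n + m] y = f^[m] (f^[n] y) := fun y => by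
    rw [add_comm, Function.iterate_add_apply]
  have hj : ∀ j, n ≤ j → ∀ y, f^[j] y = f^[j - n] (f^[n] y) := fun j hj y => by
    rw [← Function.iterate_add_apply, Nat.sub_add_cancel hj]
  refine ⟨h.pos.trans (Nat.le_add_right n m), h.mem, by rw [hnm]; exact h'.notMem, ?_, ?_, ?_, ?_⟩
  · rw [hnm]
    intro p hp
    obtain ⟨q, hq, rfl⟩ := h'.surj hp
    obtain ⟨w, hw, rfl⟩ := h.subset_image H hE hq
    exact ⟨w, hw, hnm w⟩
  · intro y hy j hjnm
    rcases lt_or_ge j n with hlt | hge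
    · exact h.crit y (hsub hy) j hlt
    · rw [hj j hge]
      exact h'.crit _ (hmap hy) _ (by omega)
  · intro y hy j hjnm
    rcases lt_or_ge j n with hlt | hge
    · have h1 := h.expand y (hsub hy) j hlt
      have h2 := h'.expand _ (hmap hy) 0 h'.pos
      rw [show n + m - j = (n - j) + m by omega, logExp_add, ← Function.iterate_add_apply,
        Nat.sub_add_cancel hlt.le]
      simp only [Nat.cast_zero, sub_zero, Nat.sub_zero, Function.iterate_zero, id] at h2
      push_cast
      linarith
    · have h2 := h'.expand _ (hmap hy) (j - n) (by omega)
      rw [← hj j hge, show m - (j - n) = n + m - j by omega, Nat.cast_sub hge] at h2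
      push_cast
      linarith
  · intro y hy z hz j hjnm
    rcases lt_or_ge j n with hlt | hge
    · have h1 := h.dist y (hsub hy) z (hsub hz) j hlt
      have h2 := h'.abs_sub_le H (hmap hy) (hmap hz)
      rw [hnm, hnm]
      calc _ ≤ _ := h1
        _ ≤ K * Real.exp (-(a * ((n:ℝ) - j))) *
            (Real.exp (-(a * m)) * |f^[m] (f^[n] y) - f^[m] (f^[n] z)|) := by gcongr
        _ = _ := by
            rw [← mul_assoc, mul_assoc K, ← Real.exp_add]
            congr 3; push_cast; ring_nf
    · have h2 := h'.dist _ (hmap hy) _ (hmap hz) (j - n) (by omega)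
      rw [← hj j hge, ← hj j hge, Nat.cast_sub hge, ← hnm, ← hnm,
        show (m:ℝ) - (j - n) = ((n + m : ℕ) : ℝ) - j by push_cast; ring] at h2
      exact h2

lemma of_add (H : NondegenerateMap f C β B M) (hE : MapsTo f E E) (hm : 1 ≤ m)
    (h : MarkovTime f C E a K n x) (h' : MarkovTime f C E a K (n + m) x) :
    MarkovTime f C E a K m (f^[n] x) := by
  have hmap := mapsTo_orbitComp (n := n) (m := m) (E := E) (x := x)
    H.differentiable.continuous H.mapsTo
  have hnm : ∀ y, f^[n + m] y = f^[m] (f^[n] y) := fun y => by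
    rw [add_comm, Function.iterate_add_apply]
  have hj : ∀ j y, f^[j] (f^[n] y) = f^[n + j] y := fun j y => by
    rw [add_comm, Function.iterate_add_apply]
  have hcast : ∀ j : ℕ, ((n + m : ℕ) : ℝ) - (n + j : ℕ) = m - j := fun j => by push_cast; ring
  refine ⟨hm, H.iterate_mem n h.mem, by rw [← hnm]; exact h'.notMem, ?_, ?_, ?_, ?_⟩
  · rw [← hnm]
    intro p hp
    obtain ⟨w, hw, rfl⟩ := h'.surj hp
    exact ⟨f^[n] w, hmap hw, (hnm w).symm⟩
  · intro y hy j hjm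
    obtain ⟨w, hw, rfl⟩ := h.subset_image H hE hy
    rw [hj]
    exact h'.crit w hw _ (by omega)
  · intro y hy j hjm
    obtain ⟨w, hw, rfl⟩ := h.subset_image H hE hy
    have := h'.expand w hw (n + j) (by omega)
    rwa [hcast, Nat.add_sub_add_left, ← hj] at this
  · intro y hy z hz j hjm
    obtain ⟨w, hw, rfl⟩ := h.subset_image H hE hy
    obtain ⟨v, hv, rfl⟩ := h.subset_image H hE hz
    have := h'.dist w hw v hv (n + j) (by omega)
    rwa [hcast, ← hj, ← hj, hnm, hnm] at this

lemma abs_logExp_sub_le (ha : 0 < a) (hK : 0 ≤ K) (H : NondegenerateMap f C β B M)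
    (h : MarkovTime f C E a K n x) {y z : ℝ} (hy : y ∈ orbitComp f E n x)
    (hz : z ∈ orbitComp f E n x) :
    |logExp f n y - logExp f n z| ≤ K * (1 / (Real.exp a - 1)) := by
  rw [logExp_eq_sum, logExp_eq_sum, ← Finset.sum_sub_distrib]
  refine (Finset.abs_sum_le_sum_abs _ _).trans ?_
  refine (Finset.sum_le_sum (g := fun j : ℕ => K * Real.exp (-(a * ((n:ℝ) - j))))
    fun j hj => ?_).trans ?_
  · refine (h.dist y hy z hz j (Finset.mem_range.1 hj)).trans (mul_le_of_le_one_right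
      (by positivity) ?_)
    have h1 := H.iterate_mem n hy.1
    have h2 := H.iterate_mem n hz.1
    rw [abs_le]
    constructor <;> linarith [h1.1, h1.2, h2.1, h2.2]
  · rw [← Finset.mul_sum]
    exact mul_le_mul_of_nonneg_left (sum_exp_neg_le ha n) hK

end MarkovTime

namespace NondegenerateMap

variable {f : ℝ → ℝ} {C E : Set ℝ} {β B M a b δ r κ : ℝ}

lemma markovTime_of_hypTime (H : NondegenerateMap f C β B M) (HC : HypConst β B a b δ r κ)
    (hEfin : E.Finite)
    (hEr : ∀ y ∈ Icc (0:ℝ) 1, ∀ z ∈ Icc (0:ℝ) 1, (∀ w ∈ uIcc y z, w ∉ E) → |y - z| ≤ r)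
    {x : ℝ} (hx : x ∈ Icc (0:ℝ) 1) {h : ℕ} (hpos : 1 ≤ h) (hh : HypTime f C a b δ h x)
    (hxE : f^[h] x ∉ E) (h0 : 4 * r * Real.exp (-(2 * a * h)) < x)
    (h1 : 4 * r * Real.exp (-(2 * a * h)) < 1 - x) :
    MarkovTime f C E a (2 * B / (δ / 2) ^ β) h x := by
  have hf := H.differentiable.continuous
  have ha := HC.a_pos
  have hb := HC.b_pos
  have hr := HC.r_pos
  have hδ := HC.δ_pos
  have hβ := H.β_pos
  have hB := H.B_pos
  have hit : ∀ j ≤ h, f^[h - j] (f^[j] x) = f^[h] x := fun j hj => by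
    rw [← Function.iterate_add_apply, Nat.sub_add_cancel hj]
  have hclose : ∀ j ≤ h, ∀ y ∈ orbitComp f E (h - j) (f^[j] x),
      |y - f^[j] x| ≤ 4 * r * Real.exp (-(2 * a * ((h:ℝ) - j))) := by
    refine H.abs_sub_le_of_hypTime HC hx hh (J := fun j => orbitComp f E (h - j) (f^[j] x))
      (fun j _ y hy => hy.1) (fun j _ => ordConnected_orbitComp (H.iterate_mem j hx))
      (fun j hj => mem_orbitComp_self (H.iterate_mem j hx) (by rwa [hit j hj])) ?_ ?_
    · intro j hj
      have := mapsTo_orbitComp (E := E) (n := 1) (m := h - (j + 1)) (x := f^[j] x) hf H.mapsTo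
      rw [show 1 + (h - (j + 1)) = h - j by omega, Function.iterate_one,
        ← Function.iterate_succ_apply' f] at this
      exact this
    · intro y hy
      simp only [Nat.sub_self] at hy
      rw [abs_sub_comm]
      exact hEr _ (H.iterate_mem h hx) y hy.1 hy.2
  have hmap : ∀ j ≤ h, ∀ y ∈ orbitComp f E h x, f^[j] y ∈ orbitComp f E (h - j) (f^[j] x) :=
    fun j hj y hy => by
      have := mapsTo_orbitComp (E := E) (n := j) (m := h - j) (x := x) hf H.mapsTo
      rw [Nat.add_sub_cancel' hj] at this
      exact this hy
  have hexpand : ∀ j < h, ∀ ξ ∈ orbitComp f E (h - j) (f^[j] x),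
      (∀ t < h - j, f^[t] ξ ∉ C) ∧
      2 * a * ((h:ℝ) - j) - Real.log 2 ≤ logExp f (h - j) ξ ∧
      a * ((h:ℝ) - j) ≤ logExp f (h - j) ξ := fun j hj ξ hξ =>
    H.le_logExp_of_close HC hx hh hj hξ.1 fun t ht => by
      have := mapsTo_orbitComp (E := E) (n := t) (m := h - (j + t)) (x := f^[j] x) hf H.mapsTo
      rw [show t + (h - (j + t)) = h - j by omega, ← Function.iterate_add_apply,
        add_comm t j] at this
      exact hclose (j + t) (by omega) _ (this hξ)
  have hcrit : ∀ y ∈ orbitComp f E h x, ∀ j < h, f^[j] y ∉ C := fun y hy j hj =>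
    (hexpand j hj _ (hmap j hj.le y hy)).1 0 (by omega)
  have hcontr : ∀ y ∈ orbitComp f E h x, ∀ z ∈ orbitComp f E h x, ∀ j < h,
      |f^[j] y - f^[j] z| ≤ 2 * Real.exp (-(2 * a * ((h:ℝ) - j))) * |f^[h] y - f^[h] z| := by
    intro y hy z hz j hj
    obtain ⟨ξ, hξ, he⟩ := exists_deriv_eq_slope_uIcc
      (hasDerivAt_iterate_derivProd H.differentiable (h - j)) (f^[j] z) (f^[j] y)
    have hξ' := (ordConnected_orbitComp (H.iterate_mem j hx)).uIcc_subset
      (hmap j hj.le z hz) (hmap j hj.le y hy) hξ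
    obtain ⟨hne, hlog, -⟩ := hexpand j hj ξ hξ'
    have e1 : ∀ w, f^[h - j] (f^[j] w) = f^[h] w := fun w => by
      rw [← Function.iterate_add_apply, Nat.sub_add_cancel hj.le]
    rw [e1, e1] at he
    have hD : Real.exp (2 * a * ((h:ℝ) - j)) / 2 ≤ |derivProd f (h - j) ξ| := by
      rw [← Real.exp_log (abs_pos.2 (H.derivProd_ne_zero hξ'.1 hne)),
        H.log_abs_derivProd hξ'.1 hne]
      calc _ = Real.exp (2 * a * ((h:ℝ) - j) - Real.log 2) := by
            rw [Real.exp_sub, Real.exp_log (by norm_num)]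
        _ ≤ _ := Real.exp_le_exp.2 hlog
    rw [he, abs_mul]
    have e2 : Real.exp (-(2 * a * ((h:ℝ) - j))) * Real.exp (2 * a * ((h:ℝ) - j)) = 1 := by
      rw [← Real.exp_add]; simp
    calc |f^[j] y - f^[j] z| = 2 * Real.exp (-(2 * a * ((h:ℝ) - j))) *
          (Real.exp (2 * a * ((h:ℝ) - j)) / 2 * |f^[j] y - f^[j] z|) := by
            linear_combination (-|f^[j] y - f^[j] z|) * e2
      _ ≤ _ := by gcongr
  refine ⟨hpos, hx, hxE, ?_, hcrit, fun y hy j hj => (hexpand j hj _ (hmap j hj.le y hy)).2.2, ?_⟩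
  · intro p hp
    have hEn := H.finite_iterate_preimage hEfin h
    have hc0 := hclose 0 (Nat.zero_le _)
    simp only [Function.iterate_zero, id, Nat.cast_zero, sub_zero, Nat.sub_zero] at hc0
    have hne1 : ({z ∈ Icc (0:ℝ) 1 | f^[h] z ∈ E} ∩ Iic x).Nonempty := by
      by_contra hcon
      have : (0:ℝ) ∈ orbitComp f E h x := ⟨by simp, fun z hz hzE => hcon ⟨z,
        ⟨uIcc_subset_Icc_of_mem hx (by simp) hz, hzE⟩, by
          rw [uIcc_of_ge hx.1] at hz; exact hz.2⟩⟩
      have := hc0 0 this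
      rw [zero_sub, abs_neg, abs_of_nonneg hx.1] at this
      linarith
    have hne2 : ({z ∈ Icc (0:ℝ) 1 | f^[h] z ∈ E} ∩ Ici x).Nonempty := by
      by_contra hcon
      have : (1:ℝ) ∈ orbitComp f E h x := ⟨by simp, fun z hz hzE => hcon ⟨z,
        ⟨uIcc_subset_Icc_of_mem hx (by simp) hz, hzE⟩, by
          rw [uIcc_of_le hx.2] at hz; exact hz.1⟩⟩
      have := hc0 1 this
      rw [abs_of_nonneg (by linarith [hx.2])] at this
      linarith
    obtain ⟨α, ⟨⟨hαI, hαE⟩, hαx⟩, hαmax⟩ := (hEn.inter_of_left (Iic x)).exists_maximal hne1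
    obtain ⟨γ, ⟨⟨hγI, hγE⟩, hγx⟩, hγmin⟩ := (hEn.inter_of_left (Ici x)).exists_minimal hne2
    have hxα : α < x := lt_of_le_of_ne hαx (by rintro rfl; exact hxE hαE)
    have hxγ : x < γ := lt_of_le_of_ne hγx (by rintro rfl; exact hxE hγE)
    have hsub : Ioo α γ ⊆ orbitComp f E h x := by
      intro w hw
      refine ⟨⟨hαI.1.trans hw.1.le, hw.2.le.trans hγI.2⟩, fun z hz hzE => ?_⟩
      have hzI : z ∈ Ioo α γ := ordConnected_Ioo.uIcc_subset ⟨hxα, hxγ⟩ hw hz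
      have hz01 : z ∈ Icc (0:ℝ) 1 := ⟨hαI.1.trans hzI.1.le, hzI.2.le.trans hγI.2⟩
      rcases le_total z x with hzx | hzx
      · exact absurd (hαmax ⟨⟨hz01, hzE⟩, hzx⟩ hzI.1.le) (not_le.2 hzI.1)
      · exact absurd (hγmin ⟨⟨hz01, hzE⟩, hzx⟩ hzI.2.le) (not_le.2 hzI.2)
    have hinj : InjOn f^[h] (orbitComp f E h x) := fun y hy z hz he => by
      have := hcontr y hy z hz 0 hpos
      rw [he, sub_self, abs_zero, mul_zero] at this
      exact sub_eq_zero.1 (abs_nonpos_iff.1 this)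
    obtain ⟨w, hw, he⟩ := exists_preimage_Ioo (H.continuous_iterate h) ⟨hxα, hxγ⟩
      (hinj.mono hsub) (p := p) (fun hm => hp.2 _ hm hαE) (fun hm => hp.2 _ hm hγE)
    exact ⟨w, hsub hw, he⟩
  · intro y hy z hz j hj
    set m : ℝ := (h:ℝ) - j with hm
    have hm0 : 0 < m := by
      have : (j:ℝ) < h := by exact_mod_cast hj
      linarith
    have hcy := hclose j hj.le _ (hmap j hj.le y hy)
    have hcz := hclose j hj.le _ (hmap j hj.le z hz)
    rw [← hm] at hcy hcz
    have hxd : δ * Real.exp (-(b * m)) ≤ infDist (f^[j] x) C := (hh j hj).2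
    have hle : Real.exp (-(2 * a * m)) ≤ Real.exp (-(b * m)) :=
      Real.exp_le_exp.2 (by have := HC.b_le; nlinarith)
    have hrm : 4 * r * Real.exp (-(2 * a * m)) ≤ 4 * r * Real.exp (-(b * m)) := by gcongr
    have hep := Real.exp_pos (-(b * m))
    have hre : 0 < r * Real.exp (-(b * m)) := by positivity
    have hrδ := HC.r_lt
    have hrδ' : 64 * r * Real.exp (-(b * m)) < δ * Real.exp (-(b * m)) := by gcongr
    have hyd : δ / 2 * Real.exp (-(b * m)) ≤ infDist (f^[j] y) C := by
      have h2 := infDist_le_infDist_add_dist (s := C) (x := f^[j] x) (y := f^[j] y)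
      rw [dist_comm, Real.dist_eq] at h2
      linarith
    have hyz : |f^[j] y - f^[j] z| < infDist (f^[j] y) C / 2 := by
      have := abs_sub_le (f^[j] y) (f^[j] x) (f^[j] z)
      rw [abs_sub_comm (f^[j] x)] at this
      linarith
    refine (H.distortion _ ⟨H.iterate_mem j hy.1, hcrit y hy j hj⟩ _
      ⟨H.iterate_mem j hz.1, hcrit z hz j hj⟩ hyz).trans ?_
    have h5 : (δ / 2) ^ β * Real.exp (-(a * m)) ≤ infDist (f^[j] y) C ^ β := by
      refine le_trans ?_ (Real.rpow_le_rpow (by positivity) hyd hβ.le)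
      rw [Real.mul_rpow (by positivity) (Real.exp_pos _).le, ← Real.exp_mul]
      have := HC.b_mul_le
      gcongr
      nlinarith
    have hδβ : 0 < (δ / 2) ^ β := Real.rpow_pos_of_pos (by positivity) _
    have hd0 : 0 < infDist (f^[j] y) C := lt_of_lt_of_le (by positivity) hyd
    rw [div_le_iff₀ (Real.rpow_pos_of_pos hd0 _)]
    have e1 : Real.exp (-(2 * a * m)) = Real.exp (-(a * m)) * Real.exp (-(a * m)) := by
      rw [← Real.exp_add]; congr 1; ring
    calc B * |f^[j] y - f^[j] z|
        ≤ B * (2 * Real.exp (-(2 * a * m)) * |f^[h] y - f^[h] z|) := by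
          gcongr; exact hcontr y hy z hz j hj
      _ = 2 * B / (δ / 2) ^ β * Real.exp (-(a * m)) * |f^[h] y - f^[h] z| *
          ((δ / 2) ^ β * Real.exp (-(a * m))) := by
          rw [e1]; field_simp
      _ ≤ _ := by gcongr

end NondegenerateMap

lemma orbitComp_eq_of_countBelow {f : ℝ → ℝ} {E : Set ℝ} {n : ℕ}
    (hE : {z ∈ Icc (0:ℝ) 1 | f^[n] z ∈ E}.Finite) {x y : ℝ} (hx : x ∈ Icc (0:ℝ) 1)
    (hxE : f^[n] x ∉ E) (hy : y ∈ Icc (0:ℝ) 1) (hyE : f^[n] y ∉ E)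
    (h : countBelow hE.toFinset x = countBelow hE.toFinset y) :
    orbitComp f E n y = orbitComp f E n x := by
  refine orbitComp_eq hx ⟨hy, fun z hz hzE => ?_⟩
  refine notMem_of_countBelow_eq (S := hE.toFinset) (by simp [hxE]) (by simp [hyE]) h hz ?_
  simpa using ⟨uIcc_subset_Icc_of_mem hx hy hz, hzE⟩

lemma volume_orbitComp_zero_pos {f : ℝ → ℝ} {E : Set ℝ} (hE : E.Finite) {x : ℝ}
    (hx : x ∈ Icc (0:ℝ) 1) (hxE : x ∉ E) : 0 < volume (orbitComp f E 0 x) := by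
  obtain ⟨ε, hε, hball⟩ := Metric.isOpen_iff.1 hE.isClosed.isOpen_compl x hxE
  have hsub : Ioo (0:ℝ) 1 ∩ ball x ε ⊆ orbitComp f E 0 x := by
    rintro y ⟨hy, hyx⟩
    refine ⟨Ioo_subset_Icc_self hy, fun z hz => hball ?_⟩
    rw [Real.ball_eq_Ioo] at hyx ⊢
    exact ordConnected_Ioo.uIcc_subset ⟨by linarith, by linarith⟩ hyx hz
  have hne : (Ioo (0:ℝ) 1 ∩ ball x ε).Nonempty := by
    have hcl : x ∈ closure (Ioo (0:ℝ) 1) := by rwa [closure_Ioo zero_ne_one]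
    rw [inter_comm]
    exact mem_closure_iff.1 hcl _ isOpen_ball (mem_ball_self hε)
  exact ((isOpen_Ioo.inter isOpen_ball).measure_pos volume hne).trans_le (measure_mono hsub)

lemma exists_le_volume_orbitComp_zero (f : ℝ → ℝ) {E : Set ℝ} (hE : E.Finite) :
    ∃ ρ : ENNReal, ρ ≠ 0 ∧ ∀ x ∈ Icc (0:ℝ) 1, x ∉ E → ρ ≤ volume (orbitComp f E 0 x) := by
  have hE0 : {z ∈ Icc (0:ℝ) 1 | f^[0] z ∈ E}.Finite := hE.subset fun z hz => hz.2
  have hex : ∀ i : ℕ, ∃ ρ : ENNReal, 0 < ρ ∧ ∀ x ∈ Icc (0:ℝ) 1, x ∉ E →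
      countBelow hE0.toFinset x = i → ρ ≤ volume (orbitComp f E 0 x) := by
    intro i
    by_cases h : ∃ x ∈ Icc (0:ℝ) 1, x ∉ E ∧ countBelow hE0.toFinset x = i
    · obtain ⟨x, hx, hxE, hi⟩ := h
      refine ⟨_, volume_orbitComp_zero_pos (f := f) hE hx hxE, fun y hy hyE hyi => ?_⟩
      rw [orbitComp_eq_of_countBelow hE0 hx hxE hy hyE (hi.trans hyi.symm)]
    · exact ⟨1, one_pos, fun x hx hxE hi => absurd ⟨x, hx, hxE, hi⟩ h⟩
  choose ρ hρ0 hρ using hex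
  refine ⟨(Finset.range (hE0.toFinset.card + 1)).inf ρ, ?_, fun x hx hxE => ?_⟩
  · exact ((Finset.lt_inf_iff ENNReal.zero_lt_top).2 fun i _ => hρ0 i).ne'
  · refine (Finset.inf_le ?_).trans (hρ _ x hx hxE rfl)
    simpa [Nat.lt_succ_iff] using countBelow_le hE0.toFinset x

namespace MarkovTime

variable {f : ℝ → ℝ} {C E : Set ℝ} {β B M a K : ℝ} {n : ℕ} {ρ : ENNReal}

lemma mul_volume_orbitComp_inter_preimage_le (H : NondegenerateMap f C β B M) (ha : 0 < a)
    (hK : 0 ≤ K) (hρ : ∀ x ∈ Icc (0:ℝ) 1, x ∉ E → ρ ≤ volume (orbitComp f E 0 x)) {x : ℝ}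
    (h : MarkovTime f C E a K n x) {A : Set ℝ} (hA : MeasurableSet A) :
    ρ * volume (orbitComp f E n x ∩ f^[n] ⁻¹' A) ≤
      ENNReal.ofReal (Real.exp (2 * (K * (1 / (Real.exp a - 1))))) * volume (A ∩ Icc 0 1) *
        volume (orbitComp f E n x) := by
  set D := K * (1 / (Real.exp a - 1))
  set L := logExp f n x
  set W := orbitComp f E n x
  set W' := W ∩ f^[n] ⁻¹' A
  have hW : MeasurableSet W := (ordConnected_orbitComp h.mem).measurableSet
  have hW' : MeasurableSet W' := hW.inter ((H.continuous_iterate n).measurable hA)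
  have hbd : ∀ y ∈ W, |logExp f n y - L| ≤ D := fun y hy =>
    h.abs_logExp_sub_le ha hK H hy (mem_orbitComp_self h.mem h.notMem)
  have himage : ∀ s : Set ℝ, MeasurableSet s → s ⊆ W →
      volume (f^[n] '' s) = ∫⁻ y in s, ENNReal.ofReal |derivProd f n y| := fun s hs hsW => by
    have := lintegral_image_eq_lintegral_abs_deriv_mul hs
      (fun y _ => (hasDerivAt_iterate_derivProd H.differentiable n y).hasDerivWithinAt)
      ((h.injOn H).mono hsW) (fun _ => 1)
    simpa using this
  have h1 : ρ ≤ ENNReal.ofReal (Real.exp (L + D)) * volume W := by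
    refine (hρ _ (H.iterate_mem n h.mem) h.notMem).trans ((measure_mono h.surj).trans ?_)
    rw [himage W hW subset_rfl, ← setLIntegral_const]
    refine setLIntegral_mono' hW fun y hy => ENNReal.ofReal_le_ofReal ?_
    rw [h.derivProd_eq H hy, Real.exp_le_exp]
    linarith [(abs_le.1 (hbd y hy)).2]
  have h2 : ENNReal.ofReal (Real.exp (L - D)) * volume W' ≤ volume (A ∩ Icc 0 1) := by
    refine le_trans ?_ (measure_mono (s := f^[n] '' W') ?_)
    · rw [himage W' hW' inter_subset_left, ← setLIntegral_const]
      refine setLIntegral_mono' hW' fun y hy => ENNReal.ofReal_le_ofReal ?_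
      rw [h.derivProd_eq H hy.1, Real.exp_le_exp]
      linarith [(abs_le.1 (hbd y hy.1)).1]
    · rintro _ ⟨y, hy, rfl⟩
      exact ⟨hy.2, H.iterate_mem n hy.1.1⟩
  calc ρ * volume W' ≤ ENNReal.ofReal (Real.exp (L + D)) * volume W * volume W' := by gcongr
    _ = ENNReal.ofReal (Real.exp (2 * D)) * (ENNReal.ofReal (Real.exp (L - D)) * volume W') *
        volume W := by
      rw [show L + D = 2 * D + (L - D) by ring, Real.exp_add,
        ENNReal.ofReal_mul (Real.exp_pos _).le]
      ring
    _ ≤ _ := by gcongr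

lemma measurableSet_and_mul_volume_le (H : NondegenerateMap f C β B M) (hEfin : E.Finite)
    (ha : 0 < a) (hK : 0 ≤ K)
    (hρ : ∀ x ∈ Icc (0:ℝ) 1, x ∉ E → ρ ≤ volume (orbitComp f E 0 x)) {P : ℝ → Prop}
    (hP : ∀ x, P x → MarkovTime f C E a K n x)
    (hsat : ∀ x, P x → ∀ y ∈ orbitComp f E n x, P y) :
    MeasurableSet {x | P x} ∧ ∀ A, MeasurableSet A → ρ * volume ({x | P x} ∩ f^[n] ⁻¹' A) ≤
      ENNReal.ofReal (Real.exp (2 * (K * (1 / (Real.exp a - 1))))) * volume (A ∩ Icc 0 1) *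
        volume {x | P x} := by
  have hEn := H.finite_iterate_preimage hEfin n
  set S : ℕ → Set ℝ := fun i => {x | P x ∧ countBelow hEn.toFinset x = i} with hS
  set I := Finset.range (hEn.toFinset.card + 1)
  have hPS : {x | P x} = ⋃ i ∈ I, S i := by
    ext x
    simp only [mem_iUnion, hS]
    constructor
    · intro h
      refine ⟨_, ?_, h, rfl⟩
      simpa [I, Nat.lt_succ_iff] using countBelow_le hEn.toFinset x
    · rintro ⟨i, -, h, -⟩
      exact h
  have hcase : ∀ i, S i = ∅ ∨ ∃ x, MarkovTime f C E a K n x ∧ S i = orbitComp f E n x := by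
    intro i
    rcases (S i).eq_empty_or_nonempty with h | ⟨x, hx, hxi⟩
    · exact Or.inl h
    · have hm := hP x hx
      refine Or.inr ⟨x, hm, Subset.antisymm ?_ ?_⟩
      · rintro y ⟨hy, hyi⟩
        have hmy := hP y hy
        rw [← orbitComp_eq_of_countBelow hEn hm.mem hm.notMem hmy.mem hmy.notMem
          (hxi.trans hyi.symm)]
        exact mem_orbitComp_self hmy.mem hmy.notMem
      · intro y hy
        refine ⟨hsat x hx y hy, ?_⟩
        rw [← hxi]
        refine (countBelow_eq_of_disjoint fun z hz hzE => ?_).symm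
        exact hy.2 z hz ((by simpa using hzE : _ ∧ f^[n] z ∈ E).2)
  have hSm : ∀ i, MeasurableSet (S i) := fun i => by
    rcases hcase i with h | ⟨x, hx, h⟩ <;> rw [h]
    · exact MeasurableSet.empty
    · exact (ordConnected_orbitComp hx.mem).measurableSet
  have hdisj : (I : Set ℕ).PairwiseDisjoint S := fun i _ j _ hij =>
    Set.disjoint_left.2 fun x hx hx' => hij (hx.2.symm.trans hx'.2)
  refine ⟨by rw [hPS]; exact Finset.measurableSet_biUnion _ fun i _ => hSm i, fun A hA => ?_⟩
  rw [hPS, measure_biUnion_finset hdisj fun i _ => hSm i, Finset.mul_sum, iUnion₂_inter]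
  refine (mul_le_mul_right (measure_biUnion_finset_le I _) _).trans ?_
  rw [Finset.mul_sum]
  refine Finset.sum_le_sum fun i _ => ?_
  rcases hcase i with h | ⟨x, hx, h⟩ <;> rw [h]
  · simp
  · exact hx.mul_volume_orbitComp_inter_preimage_le H ha hK hρ hA

lemma measurableSet_setOf (H : NondegenerateMap f C β B M) (hEfin : E.Finite)
    (ha : 0 < a) (hK : 0 ≤ K) : MeasurableSet {x | MarkovTime f C E a K n x} := by
  obtain ⟨ρ, -, hρ⟩ := exists_le_volume_orbitComp_zero f hEfin
  exact (measurableSet_and_mul_volume_le H hEfin ha hK hρ (fun _ h => h)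
    fun _ h _ hy => h.of_mem_orbitComp H hy).1

end MarkovTime

/-- The first Markov time of `x`, or `0` if there is none. -/
noncomputable def firstMarkov (f : ℝ → ℝ) (C E : Set ℝ) (a K : ℝ) (x : ℝ) : ℕ :=
  sInf {n | MarkovTime f C E a K n x}

/-- The map induced by `f` at the first Markov time. -/
noncomputable def inducedMap (f : ℝ → ℝ) (C E : Set ℝ) (a K : ℝ) (x : ℝ) : ℝ :=
  f^[firstMarkov f C E a K x] x

/-- The total time spent by `k` iterations of the induced map. -/
noncomputable def inducedTime (f : ℝ → ℝ) (C E : Set ℝ) (a K : ℝ) (k : ℕ) (x : ℝ) : ℕ :=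
  birkhoffSum (inducedMap f C E a K) (firstMarkov f C E a K) k x

section Induced

variable {f : ℝ → ℝ} {C E : Set ℝ} {β B M a K : ℝ} {x : ℝ}

lemma inducedTime_zero : inducedTime f C E a K 0 x = 0 := birkhoffSum_zero _ _ _

lemma iterate_inducedMap (k : ℕ) :
    (inducedMap f C E a K)^[k] x = f^[inducedTime f C E a K k x] x := by
  induction k with
  | zero => rfl
  | succ k ih =>
    rw [Function.iterate_succ_apply', inducedTime, birkhoffSum_succ, add_comm,
      Function.iterate_add_apply, ← inducedTime, ← ih, inducedMap]

lemma inducedTime_succ (k : ℕ) : inducedTime f C E a K (k + 1) x = inducedTime f C E a K k x +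
    firstMarkov f C E a K (f^[inducedTime f C E a K k x] x) := by
  rw [← iterate_inducedMap]
  exact birkhoffSum_succ _ _ _ _

lemma birkhoffSum_logExp_inducedMap (k : ℕ) :
    birkhoffSum (inducedMap f C E a K) (fun y => logExp f (firstMarkov f C E a K y) y) k x =
      logExp f (inducedTime f C E a K k x) x := by
  induction k with
  | zero => simp [inducedTime_zero, logExp_eq_sum]
  | succ k ih => rw [birkhoffSum_succ, ih, inducedTime_succ, logExp_add, iterate_inducedMap]

lemma birkhoffSum_firstMarkov_cast (k : ℕ) :
    birkhoffSum (inducedMap f C E a K) (fun y => (firstMarkov f C E a K y : ℝ)) k x =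
      inducedTime f C E a K k x := by
  simp [birkhoffSum, inducedTime]

lemma markovTime_firstMarkov (h : ∃ n, MarkovTime f C E a K n x) :
    MarkovTime f C E a K (firstMarkov f C E a K x) x := Nat.sInf_mem h

lemma frequently_markovTime_iterate (H : NondegenerateMap f C β B M) (hE : MapsTo f E E)
    (hx : ∃ᶠ n in atTop, MarkovTime f C E a K n x) {n : ℕ} (hn : MarkovTime f C E a K n x) :
    ∃ᶠ m in atTop, MarkovTime f C E a K m (f^[n] x) := by
  rw [frequently_atTop] at hx ⊢
  intro m₀
  obtain ⟨m, hm, h⟩ := hx (n + m₀ + 1)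
  exact ⟨m - n, by omega, hn.of_add H hE (by omega) (by rwa [Nat.add_sub_cancel' (by omega)])⟩

lemma markovTime_inducedTime (H : NondegenerateMap f C β B M) (hE : MapsTo f E E) (hK : 0 ≤ K)
    (hx : ∃ᶠ n in atTop, MarkovTime f C E a K n x) (k : ℕ) :
    MarkovTime f C E a K (inducedTime f C E a K (k + 1) x) x := by
  induction k with
  | zero =>
    rw [inducedTime_succ, inducedTime_zero, zero_add]
    exact markovTime_firstMarkov hx.exists
  | succ k ih =>
    rw [inducedTime_succ]
    exact ih.add H hE hK
      (markovTime_firstMarkov (frequently_markovTime_iterate H hE hx ih).exists)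

lemma inducedTime_lt_succ (H : NondegenerateMap f C β B M) (hE : MapsTo f E E) (hK : 0 ≤ K)
    (hx : ∃ᶠ n in atTop, MarkovTime f C E a K n x) (k : ℕ) :
    inducedTime f C E a K k x < inducedTime f C E a K (k + 1) x := by
  rw [inducedTime_succ]
  refine Nat.lt_add_of_pos_right (markovTime_firstMarkov ?_).pos
  cases k with
  | zero => rw [inducedTime_zero]; exact hx.exists
  | succ k =>
    exact (frequently_markovTime_iterate H hE hx (markovTime_inducedTime H hE hK hx k)).exists

open Classical in
lemma count_inducedTime (H : NondegenerateMap f C β B M) (hE : MapsTo f E E) (hK : 0 ≤ K)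
    (hx : ∃ᶠ n in atTop, MarkovTime f C E a K n x) (k : ℕ) :
    Nat.count (MarkovTime f C E a K · x) (inducedTime f C E a K (k + 1) x) = k := by
  induction k with
  | zero =>
    rw [inducedTime_succ, inducedTime_zero, zero_add]
    exact Nat.count_of_forall_not fun m hm => Nat.notMem_of_lt_sInf hm
  | succ k ih =>
    have hT := markovTime_inducedTime H hE hK hx k
    rw [inducedTime_succ, Nat.count_add, ih, Nat.add_left_cancel_iff]
    set T := inducedTime f C E a K (k + 1) x
    have hg := (markovTime_firstMarkov (frequently_markovTime_iterate H hE hx hT).exists).pos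
    obtain ⟨g, hg'⟩ := Nat.exists_eq_add_of_le' hg
    rw [hg', Nat.count_succ', add_zero, if_pos hT, Nat.count_of_forall_not]
    intro m hm h
    refine Nat.notMem_of_lt_sInf (s := {n | MarkovTime f C E a K n (f^[T] x)}) (m := m + 1) ?_
      (hT.of_add H hE (by omega) h)
    change m + 1 < firstMarkov f C E a K (f^[T] x)
    omega

lemma measurable_firstMarkov (H : NondegenerateMap f C β B M) (hEfin : E.Finite)
    (ha : 0 < a) (hK : 0 ≤ K) : Measurable (firstMarkov f C E a K) := by
  have hm : ∀ n, MeasurableSet {x | MarkovTime f C E a K n x} := fun n =>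
    MarkovTime.measurableSet_setOf H hEfin ha hK
  have hle : ∀ n, MeasurableSet (firstMarkov f C E a K ⁻¹' Iic n) := by
    intro n
    have : firstMarkov f C E a K ⁻¹' Iic n =
        (⋃ i ∈ Finset.range (n + 1), {x | MarkovTime f C E a K i x}) ∪
          (⋃ i, {x | MarkovTime f C E a K i x})ᶜ := by
      ext x
      simp only [mem_preimage, mem_Iic, mem_union, mem_iUnion, mem_compl_iff, Finset.mem_range,
        exists_prop, mem_ofPred_eq]
      constructor
      · intro h
        by_cases hex : ∃ i, MarkovTime f C E a K i x
        · exact Or.inl ⟨_, Nat.lt_succ_of_le h, markovTime_firstMarkov hex⟩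
        · exact Or.inr hex
      · rintro (⟨i, hi, h⟩ | h)
        · exact (Nat.sInf_le h).trans (Nat.le_of_lt_succ hi)
        · have : {n | MarkovTime f C E a K n x} = ∅ :=
            eq_empty_of_forall_notMem fun i hi => h ⟨i, hi⟩
          simp [firstMarkov, this]
    rw [this]
    exact (Finset.measurableSet_biUnion _ fun i _ => hm i).union
      (MeasurableSet.iUnion fun i => hm i).compl
  exact measurable_of_Iic hle

lemma measurable_inducedMap (H : NondegenerateMap f C β B M) (hEfin : E.Finite)
    (ha : 0 < a) (hK : 0 ≤ K) : Measurable (inducedMap f C E a K) :=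
  (measurable_from_prod_countable_right (f := fun p : ℕ × ℝ => f^[p.1] p.2) fun n =>
    (H.continuous_iterate n).measurable).comp
      ((measurable_firstMarkov H hEfin ha hK).prodMk measurable_id)

lemma measurable_logExp_firstMarkov (H : NondegenerateMap f C β B M) (hEfin : E.Finite)
    (ha : 0 < a) (hK : 0 ≤ K) :
    Measurable fun x => logExp f (firstMarkov f C E a K x) x := by
  refine (measurable_from_prod_countable_right (f := fun p : ℕ × ℝ => logExp f p.1 p.2)
    fun n => ?_).comp ((measurable_firstMarkov H hEfin ha hK).prodMk measurable_id)
  simp only [logExp_eq_sum]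
  exact Finset.measurable_fun_sum _ fun i _ => Real.measurable_log.comp
    (H.continuous_deriv.comp (H.continuous_iterate i)).measurable.abs

lemma exists_measure_preimage_inducedMap_le (H : NondegenerateMap f C β B M) (hEfin : E.Finite)
    (hE : MapsTo f E E) (ha : 0 < a) (hK : 0 ≤ K)
    (hx : ∀ᵐ x ∂(volume.restrict (Icc (0:ℝ) 1)), ∃ᶠ n in atTop, MarkovTime f C E a K n x) :
    ∃ Q : ENNReal, Q ≠ ⊤ ∧ ∀ (k : ℕ) (A : Set ℝ), MeasurableSet A →
      volume.restrict (Icc (0:ℝ) 1) ((inducedMap f C E a K)^[k] ⁻¹' A) ≤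
        Q * volume.restrict (Icc (0:ℝ) 1) A := by
  classical
  obtain ⟨ρ, hρ0, hρ⟩ := exists_le_volume_orbitComp_zero f hEfin
  set c := ENNReal.ofReal (Real.exp (2 * (K * (1 / (Real.exp a - 1)))))
  have hc : c ≠ ⊤ := ENNReal.ofReal_ne_top
  refine ⟨1 + c / ρ, ENNReal.add_ne_top.2 ⟨ENNReal.one_ne_top, ENNReal.div_ne_top hc hρ0⟩,
    fun k A hA => ?_⟩
  cases k with
  | zero => simpa using le_mul_of_one_le_left' le_self_add
  | succ k =>
    refine le_trans ?_ (mul_le_mul_left (le_add_self : c / ρ ≤ 1 + c / ρ) _)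
    set P : ℕ → ℝ → Prop := fun n x => MarkovTime f C E a K n x ∧
      Nat.count (MarkovTime f C E a K · x) n = k with hP
    have key := fun n => MarkovTime.measurableSet_and_mul_volume_le (n := n) (P := P n) H hEfin ha
      hK hρ (fun x hx => hx.1) (fun x hx y hy => ⟨hx.1.of_mem_orbitComp H hy, by
        rw [← hx.2, Nat.count_eq_card_filter_range, Nat.count_eq_card_filter_range]
        congr 1
        refine Finset.filter_congr fun i hi => ?_
        have hyi : y ∈ orbitComp f E i x := by
          have := orbitComp_add_subset (n := i) (m := n - i) hE (x := x)
          rw [Nat.add_sub_cancel' (Finset.mem_range.1 hi).le] at this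
          exact this hy
        exact ⟨fun h => h.of_mem_orbitComp H (mem_orbitComp_symm hx.1.mem hyi),
          fun h => h.of_mem_orbitComp H hyi⟩⟩)
    have hdisj : Pairwise fun n m => Disjoint {x | P n x} {x | P m x} := by
      intro n m hnm
      refine Set.disjoint_left.2 fun x hx hx' => ?_
      rcases hnm.lt_or_gt with h | h
      · have := Nat.count_strict_mono (p := (MarkovTime f C E a K · x)) hx.1 h
        rw [hx.2, hx'.2] at this
        exact this.false
      · have := Nat.count_strict_mono (p := (MarkovTime f C E a K · x)) hx'.1 h
        rw [hx.2, hx'.2] at this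
        exact this.false
    have hsub : volume.restrict (Icc (0:ℝ) 1) ((inducedMap f C E a K)^[k + 1] ⁻¹' A) ≤
        ∑' n, volume ({x | P n x} ∩ f^[n] ⁻¹' A) := by
      refine le_trans (measure_mono_ae ?_) (((Measure.restrict_le_self _).trans
        (measure_iUnion_le fun n => {x | P n x} ∩ f^[n] ⁻¹' A)))
      filter_upwards [hx] with x hx hxA
      have hxA' : (inducedMap f C E a K)^[k + 1] x ∈ A := hxA
      rw [iterate_inducedMap] at hxA'
      exact mem_iUnion.2 ⟨inducedTime f C E a K (k + 1) x,
        ⟨markovTime_inducedTime H hE hK hx k, count_inducedTime H hE hK hx k⟩, hxA'⟩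
    have hsum : ∑' n, volume {x | P n x} ≤ 1 := by
      rw [← measure_iUnion hdisj fun n => (key n).1]
      refine (measure_mono (t := Icc (0:ℝ) 1) (iUnion_subset fun n x hx => hx.1.mem)).trans ?_
      simp
    rw [← ENNReal.mul_div_right_comm, Measure.restrict_apply hA,
      ENNReal.le_div_iff_mul_le (Or.inl hρ0) (Or.inr (ENNReal.mul_ne_top hc
        (measure_ne_top_of_subset inter_subset_right (by simp))))]
    calc _ ≤ (∑' n, volume ({x | P n x} ∩ f^[n] ⁻¹' A)) * ρ := by gcongr
      _ = ∑' n, ρ * volume ({x | P n x} ∩ f^[n] ⁻¹' A) := by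
          rw [mul_comm, ENNReal.tsum_mul_left]
      _ ≤ ∑' n, c * volume (A ∩ Icc 0 1) * volume {x | P n x} :=
          ENNReal.tsum_le_tsum fun n => (key n).2 A hA
      _ = c * volume (A ∩ Icc 0 1) * ∑' n, volume {x | P n x} := ENNReal.tsum_mul_left
      _ ≤ _ := mul_le_of_le_one_right' hsum

end Induced

lemma frequently_of_frequently_le_card {p : ℕ → Prop} [DecidablePred p] {θ : ℝ} (hθ : 0 < θ)
    (h : ∃ᶠ n : ℕ in atTop, θ * n ≤ ((Finset.Icc 1 n).filter p).card) : ∃ᶠ n in atTop, p n := by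
  intro hev
  obtain ⟨N, hN⟩ := eventually_atTop.1 hev
  have hbig : ∀ᶠ n : ℕ in atTop, (N : ℝ) < θ * n :=
    (tendsto_natCast_atTop_atTop.const_mul_atTop hθ).eventually_gt_atTop _
  obtain ⟨n, h1, h2⟩ := (h.and_eventually hbig).exists
  have : ((Finset.Icc 1 n).filter p).card ≤ (Finset.range N).card := by
    refine Finset.card_le_card fun m hm => ?_
    rw [Finset.mem_filter] at hm
    by_contra hmN
    exact hN m (not_lt.1 fun h => hmN (Finset.mem_range.2 h)) hm.2
  rw [Finset.card_range] at this
  have : (((Finset.Icc 1 n).filter p).card : ℝ) ≤ N := by exact_mod_cast this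
  linarith

namespace NondegenerateMap

variable {f : ℝ → ℝ} {C E : Set ℝ} {β B M a b δ r κ K : ℝ} {x : ℝ}

lemma eventually_markovTime_of_hypTime (H : NondegenerateMap f C β B M)
    (HC : HypConst β B a b δ r κ) (hEfin : E.Finite)
    (hEr : ∀ y ∈ Icc (0:ℝ) 1, ∀ z ∈ Icc (0:ℝ) 1, (∀ w ∈ uIcc y z, w ∉ E) → |y - z| ≤ r)
    (hx : x ∈ Ioo (0:ℝ) 1) (hxE : ∀ n, f^[n] x ∉ E) :
    ∀ᶠ h in atTop, HypTime f C a b δ h x →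
      MarkovTime f C E a (2 * B / (δ / 2) ^ β) h x := by
  have ha := HC.a_pos
  have ht : Tendsto (fun h : ℕ => 4 * r * Real.exp (-(2 * a * h))) atTop (nhds 0) := by
    have h1 : Tendsto (fun h : ℕ => 2 * a * (h : ℝ)) atTop atTop :=
      tendsto_natCast_atTop_atTop.const_mul_atTop (by positivity)
    simpa using (Real.tendsto_exp_neg_atTop_nhds_zero.comp h1).const_mul (4 * r)
  filter_upwards [eventually_ge_atTop 1, ht.eventually_lt_const hx.1,
    ht.eventually_lt_const (sub_pos.2 hx.2)] with h h1 h2 h3 hh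
  exact H.markovTime_of_hypTime HC hEfin hEr (Ioo_subset_Icc_self hx) h1 hh (hxE h) h2 h3

open Classical in
lemma exists_inducedTime_lt (H : NondegenerateMap f C β B M) (hE : MapsTo f E E) (hK : 0 ≤ K)
    {θ : ℝ} (hθ : 0 < θ) {p : ℕ → Prop}
    (hp : ∃ᶠ n : ℕ in atTop, θ * n ≤ ((Finset.Icc 1 n).filter p).card)
    (hpx : ∀ᶠ n in atTop, p n → MarkovTime f C E a K n x) :
    ∃ k, (inducedTime f C E a K k x : ℝ) < 3 / θ * k := by
  have hx : ∃ᶠ n in atTop, MarkovTime f C E a K n x :=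
    (frequently_of_frequently_le_card hθ hp).mp hpx
  obtain ⟨N, hN⟩ := eventually_atTop.1 hpx
  have hbig : ∀ᶠ n : ℕ in atTop, (N : ℝ) + 1 ≤ θ / 2 * n :=
    (tendsto_natCast_atTop_atTop.const_mul_atTop (by positivity)).eventually_ge_atTop _
  obtain ⟨n, h1, h2⟩ := (hp.and_eventually hbig).exists
  set k := Nat.count (MarkovTime f C E a K · x) (n + 1) with hk
  have hcard : ((Finset.Icc 1 n).filter p).card ≤ N + k := by
    rw [hk, Nat.count_eq_card_filter_range]
    refine (Finset.card_le_card (t := Finset.range N ∪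
      (Finset.range (n + 1)).filter (MarkovTime f C E a K · x)) fun m hm => ?_).trans
      ((Finset.card_union_le _ _).trans_eq (by rw [Finset.card_range]))
    rw [Finset.mem_filter, Finset.mem_Icc] at hm
    rw [Finset.mem_union, Finset.mem_filter, Finset.mem_range, Finset.mem_range]
    rcases lt_or_ge m N with h | h
    · exact Or.inl h
    · exact Or.inr ⟨by omega, hN m h hm.2⟩
  have hcard' : (((Finset.Icc 1 n).filter p).card : ℝ) ≤ N + k := by exact_mod_cast hcard
  have hk1 : (1 : ℝ) ≤ k := by linarith
  have hkn : θ / 2 * n ≤ k := by linarith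
  have hk0 : 1 ≤ k := by exact_mod_cast hk1
  obtain ⟨j, hj⟩ : ∃ j, k = j + 1 := ⟨k - 1, by omega⟩
  refine ⟨k, ?_⟩
  have hT : inducedTime f C E a K k x ≤ n := by
    by_contra! hlt
    have h3 := count_inducedTime H hE hK hx j
    rw [← hj] at h3
    have h4 : k ≤ Nat.count (MarkovTime f C E a K · x) (inducedTime f C E a K k x) :=
      Nat.count_monotone _ hlt
    omega
  have hT' : (inducedTime f C E a K k x : ℝ) ≤ n := by exact_mod_cast hT
  refine hT'.trans_lt ?_
  rw [div_mul_eq_mul_div, lt_div_iff₀ hθ]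
  linarith

lemma exists_markov_inducing (H : NondegenerateMap f C β B M) {η : ℝ} (hη : 0 < η)
    (hexp : ∀ᵐ x ∂(volume.restrict (Icc (0:ℝ) 1)), ∃ᶠ n : ℕ in atTop, η * n ≤ logExp f n x)
    (hslow : ∀ ε > (0:ℝ), ∃ δ > (0:ℝ), ∀ᵐ x ∂(volume.restrict (Icc (0:ℝ) 1)),
      atTop.limsup (fun n : ℕ =>
        (n : ℝ)⁻¹ * ∑ j ∈ Finset.range n, -Real.log (truncDist δ C (f^[j] x))) ≤ ε) :
    ∃ (E : Set ℝ) (a K c : ℝ), E.Finite ∧ MapsTo f E E ∧ 0 < a ∧ 0 ≤ K ∧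
      ∀ᵐ x ∂(volume.restrict (Icc (0:ℝ) 1)), (∃ᶠ n in atTop, MarkovTime f C E a K n x) ∧
        ∃ k, (inducedTime f C E a K k x : ℝ) < c * k := by
  classical
  obtain ⟨a, b, δ, r, κ, θ, HC, hθ, hyp⟩ := H.exists_hypTime hη hexp hslow
  obtain ⟨E, hEfin, hE, hEr⟩ := H.exists_finite_invariant HC
    (hyp.mono fun x hx => frequently_of_frequently_le_card hθ hx)
  have hB := H.B_pos
  have hδ := HC.δ_pos
  have hK : 0 ≤ 2 * B / (δ / 2) ^ β := by positivity
  refine ⟨E, a, 2 * B / (δ / 2) ^ β, 3 / θ, hEfin, hE, HC.a_pos, hK, ?_⟩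
  filter_upwards [hyp, H.ae_orbit_notMem hEfin.countable,
    H.ae_orbit_notMem (Set.toFinite ({0, 1} : Set ℝ)).countable,
    ae_restrict_mem measurableSet_Icc] with x h1 h2 h3 h4
  have h01 := h3 0
  simp only [Function.iterate_zero, id, mem_insert_iff, mem_singleton_iff, not_or] at h01
  have hx : x ∈ Ioo (0:ℝ) 1 :=
    ⟨lt_of_le_of_ne h4.1 (Ne.symm h01.1), lt_of_le_of_ne h4.2 h01.2⟩
  have hev := H.eventually_markovTime_of_hypTime HC hEfin hEr hx h2
  exact ⟨(frequently_of_frequently_le_card hθ h1).mp hev,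
    H.exists_inducedTime_lt hE hK hθ h1 hev⟩

end NondegenerateMap

lemma tendsto_div_of_tendsto_subseq {T : ℕ → ℕ} (hT : StrictMono T) (hT0 : T 0 = 0) {u : ℕ → ℝ}
    {L R Φ : ℝ} (hu : ∀ m n, m ≤ n → u n - u m ≤ ((n:ℝ) - m) * L)
    (hTR : Tendsto (fun k => (T k : ℝ) / k) atTop (nhds R))
    (huΦ : Tendsto (fun k => u (T k) / k) atTop (nhds Φ)) :
    Tendsto (fun n => u n / n) atTop (nhds (Φ / R)) := by
  have hR : 1 ≤ R := by
    refine ge_of_tendsto hTR ?_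
    filter_upwards [eventually_gt_atTop 0] with k hk
    rw [one_le_div (by exact_mod_cast hk)]
    exact_mod_cast hT.id_le k
  -- the last index whose time does not exceed `n`
  set κ : ℕ → ℕ := fun n => Nat.findGreatest (fun k => T k ≤ n) n with hκ
  have h1 : ∀ n, T (κ n) ≤ n := fun n =>
    Nat.findGreatest_spec (P := fun k => T k ≤ n) (Nat.zero_le n) (by simp [hT0])
  have h2 : ∀ n, n < T (κ n + 1) := by
    intro n
    by_contra! h
    have : κ n + 1 ≤ κ n := Nat.le_findGreatest ((hT.id_le _).trans h) h
    omega
  have hκt : Tendsto κ atTop atTop := by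
    refine tendsto_atTop.2 fun k => ?_
    filter_upwards [eventually_ge_atTop (T k)] with n hn
    exact Nat.le_findGreatest ((hT.id_le _).trans hn) hn
  have hsucc : ∀ {v : ℕ → ℝ} {l : ℝ}, Tendsto (fun k => v k / k) atTop (nhds l) →
      Tendsto (fun k => v (k + 1) / k) atTop (nhds l) := by
    intro v l hv
    have h3 : Tendsto (fun k : ℕ => v (k + 1) / (k + 1 : ℕ) * (((k + 1 : ℕ) : ℝ) / k)) atTop
        (nhds (l * 1)) := by
      refine (hv.comp (tendsto_add_atTop_nat 1)).mul ?_
      have : Tendsto (fun k : ℕ => 1 + 1 / (k : ℝ)) atTop (nhds (1 + 0)) :=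
        tendsto_const_nhds.add tendsto_one_div_atTop_nhds_zero_nat
      rw [add_zero] at this
      refine this.congr' ?_
      filter_upwards [eventually_gt_atTop 0] with k hk
      have : (k : ℝ) ≠ 0 := by exact_mod_cast hk.ne'
      push_cast
      field_simp
    rw [mul_one] at h3
    refine h3.congr' ?_
    filter_upwards [eventually_gt_atTop 0] with k hk
    have : (k : ℝ) ≠ 0 := by exact_mod_cast hk.ne'
    have : ((k + 1 : ℕ) : ℝ) ≠ 0 := by positivity
    field_simp
  have hκpos : ∀ᶠ n in atTop, (0 : ℝ) < κ n := by
    filter_upwards [hκt.eventually_gt_atTop 0] with n hn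
    exact_mod_cast hn
  have hTs := hsucc hTR
  have hus := hsucc huΦ
  have hn : Tendsto (fun n : ℕ => (n : ℝ) / κ n) atTop (nhds R) := by
    refine tendsto_of_tendsto_of_tendsto_of_le_of_le' (hTR.comp hκt) (hTs.comp hκt) ?_ ?_
    · filter_upwards [hκpos] with n hn
      exact div_le_div_of_nonneg_right (by exact_mod_cast h1 n) hn.le
    · filter_upwards [hκpos] with n hn
      exact div_le_div_of_nonneg_right (by exact_mod_cast (h2 n).le) hn.le
  have hun : Tendsto (fun n : ℕ => u n / κ n) atTop (nhds Φ) := by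
    have lo := (hus.comp hκt).sub (((hTs.comp hκt).sub hn).mul_const L)
    have up := (huΦ.comp hκt).add ((hn.sub (hTR.comp hκt)).mul_const L)
    rw [sub_self, zero_mul, sub_zero] at lo
    rw [sub_self, zero_mul, add_zero] at up
    refine tendsto_of_tendsto_of_tendsto_of_le_of_le' lo up ?_ ?_
    · filter_upwards [hκpos] with n hn
      have := hu n (T (κ n + 1)) (h2 n).le
      simp only [Function.comp]
      rw [← sub_div, div_mul_eq_mul_div, ← sub_div]
      exact div_le_div_of_nonneg_right (by linarith) hn.le
    · filter_upwards [hκpos] with n hn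
      have := hu (T (κ n)) n (h1 n)
      simp only [Function.comp]
      rw [← sub_div, div_mul_eq_mul_div, ← add_div]
      exact div_le_div_of_nonneg_right (by linarith) hn.le
  refine (hun.div hn (by linarith)).congr' ?_
  filter_upwards [hκpos] with n hn
  simp only [Pi.div_apply]
  rw [div_div_div_cancel_right₀ hn.ne']

lemma frequently_lt_of_liminf_le {u : ℕ → ℝ} {lam η : ℝ} (hη : 0 < η) (hlam : η < lam)
    (h : atTop.liminf u ≤ -lam) : ∃ᶠ n in atTop, u n < -η := by
  intro hev
  have hev' : ∀ᶠ n in atTop, -η ≤ u n := hev.mono fun n hn => not_lt.1 hn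
  rw [liminf_eq] at h
  by_cases hb : BddAbove {a | ∀ᶠ n in atTop, a ≤ u n}
  · have := le_csSup hb hev'
    linarith
  · rw [Real.sSup_of_not_bddAbove hb] at h
    linarith

lemma sum_log_one_div_eq (f : ℝ → ℝ) (n : ℕ) (x : ℝ) :
    (n : ℝ)⁻¹ * ∑ i ∈ Finset.range n, Real.log (1 / |deriv f (f^[i] x)|) =
      -(logExp f n x / n) := by
  simp only [one_div, Real.log_inv, Finset.sum_neg_distrib, logExp_eq_sum]
  rw [div_eq_inv_mul, mul_neg]

lemma NondegenerateMap.ae_exists_tendsto_logExp {f : ℝ → ℝ} {C : Set ℝ} {β B M η : ℝ}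
    (H : NondegenerateMap f C β B M) (hη : 0 < η)
    (hexp : ∀ᵐ x ∂(volume.restrict (Icc (0:ℝ) 1)), ∃ᶠ n : ℕ in atTop, η * n ≤ logExp f n x)
    (hslow : ∀ ε > (0:ℝ), ∃ δ > (0:ℝ), ∀ᵐ x ∂(volume.restrict (Icc (0:ℝ) 1)),
      atTop.limsup (fun n : ℕ =>
        (n : ℝ)⁻¹ * ∑ j ∈ Finset.range n, -Real.log (truncDist δ C (f^[j] x))) ≤ ε) :
    ∀ᵐ x ∂(volume.restrict (Icc (0:ℝ) 1)),
      ∃ χ, Tendsto (fun n : ℕ => logExp f n x / n) atTop (nhds χ) := by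
  obtain ⟨E, a, K, c, hEfin, hE, ha, hK, hM⟩ := H.exists_markov_inducing hη hexp hslow
  obtain ⟨Q, hQ, hdom⟩ := exists_measure_preimage_inducedMap_le H hEfin hE ha hK
    (hM.mono fun x hx => hx.1)
  have hconv := ae_exists_tendsto_of_dominated_pushforward (volume.restrict (Icc (0:ℝ) 1))
    (measurable_inducedMap H hEfin ha hK) hQ hdom
    (R := fun y => (firstMarkov f C E a K y : ℝ))
    (Φ := fun y => logExp f (firstMarkov f C E a K y) y) (a := Real.log M) (b := 0) (c := c)
    (measurable_from_top.comp (measurable_firstMarkov H hEfin ha hK))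
    (measurable_logExp_firstMarkov H hEfin ha hK) (fun y => Nat.cast_nonneg _) ?_ ?_
  · filter_upwards [hconv, hM, ae_restrict_mem measurableSet_Icc]
      with x ⟨⟨R, hR⟩, ⟨Φ, hΦ⟩⟩ ⟨hfr, _⟩ hx
    simp only [birkhoffSum_firstMarkov_cast] at hR
    simp only [birkhoffSum_logExp_inducedMap] at hΦ
    refine ⟨Φ / R, tendsto_div_of_tendsto_subseq (L := Real.log M)
      (strictMono_nat_of_lt_succ fun k => inducedTime_lt_succ H hE hK hfr k)
      inducedTime_zero (fun m n hmn => ?_) hR hΦ⟩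
    obtain ⟨d, rfl⟩ := Nat.exists_eq_add_of_le hmn
    have := H.logExp_le (H.iterate_mem m hx) d
    rw [logExp_add]
    push_cast
    linarith
  · filter_upwards [hM, ae_restrict_mem measurableSet_Icc] with x ⟨hfr, _⟩ hx
    have hg := markovTime_firstMarkov hfr.exists
    have h1 := hg.expand x (mem_orbitComp_self hx hg.notMem) 0 hg.pos
    have h2 := H.logExp_le hx (firstMarkov f C E a K x)
    simp only [Nat.cast_zero, sub_zero, Nat.sub_zero, Function.iterate_zero, id] at h1
    have h3 : 0 ≤ a * (firstMarkov f C E a K x : ℝ) := by positivity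
    rw [abs_of_nonneg (h3.trans h1)]
    linarith
  · filter_upwards [hM] with x ⟨_, k, hk⟩
    exact ⟨k, by rwa [birkhoffSum_firstMarkov_cast]⟩

/-- One-dimensional case of Theorem 2: for a C² interval map with non-degenerate critical
set satisfying the slow approximation condition, the liminf expansion condition implies
the limsup (non-uniform expansion) condition. -/
theorem liminf_expansion_implies_nonuniform_expansion_interval
    (f : ℝ → ℝ) (C : Set ℝ) (β B lam : ℝ)
    (hβ : 0 < β) (hB : 0 < B) (hlam : 0 < lam)
    (hC2 : ContDiff ℝ 2 f)
    (hmaps : MapsTo f (Icc (0:ℝ) 1) (Icc (0:ℝ) 1))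
    (hC : C = {x ∈ Icc (0:ℝ) 1 | deriv f x = 0}) (hCfin : C.Finite)
    -- non-degeneracy of the critical set with exponent β and constant B
    (hnd1 : ∀ x ∈ Icc (0:ℝ) 1 \ C,
      B⁻¹ * infDist x C ^ β ≤ |deriv f x| ∧ |deriv f x| ≤ B * infDist x C ^ (-β))
    (hnd2 : ∀ x ∈ Icc (0:ℝ) 1 \ C, ∀ y ∈ Icc (0:ℝ) 1 \ C,
      |x - y| < infDist x C / 2 →
      abs (Real.log |deriv f x| - Real.log |deriv f y|) ≤ B * |x - y| / infDist x C ^ β)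
    -- slow approximation condition
    (hslow : ∀ ε > (0:ℝ), ∃ δ > (0:ℝ), ∀ᵐ x ∂(volume.restrict (Icc (0:ℝ) 1)),
      atTop.limsup (fun n : ℕ =>
        (n : ℝ)⁻¹ * ∑ j ∈ Finset.range n, -Real.log (truncDist δ C (f^[j] x))) ≤ ε)
    -- liminf expansion condition
    (hexp : ∀ᵐ x ∂(volume.restrict (Icc (0:ℝ) 1)),
      atTop.liminf (fun n : ℕ =>
        (n : ℝ)⁻¹ * ∑ i ∈ Finset.range n, Real.log (1 / |deriv f (f^[i] x)|)) ≤ -lam) :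
    -- conclusion: the limsup (non-uniform expansion) condition
    ∀ᵐ x ∂(volume.restrict (Icc (0:ℝ) 1)),
      atTop.limsup (fun n : ℕ =>
        (n : ℝ)⁻¹ * ∑ i ∈ Finset.range n, Real.log (1 / |deriv f (f^[i] x)|)) ≤ -lam := by
  obtain ⟨M, H⟩ := exists_nondegenerateMap hβ hB hC2 hmaps hC hCfin hnd1 hnd2
  simp only [sum_log_one_div_eq] at hexp ⊢
  have hexp' : ∀ᵐ x ∂(volume.restrict (Icc (0:ℝ) 1)),
      ∃ᶠ n : ℕ in atTop, lam / 2 * n ≤ logExp f n x := by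
    filter_upwards [hexp] with x hx
    refine ((frequently_lt_of_liminf_le (half_pos hlam) (half_lt_self hlam) hx).and_eventually
      (eventually_gt_atTop 0)).mono fun n ⟨h1, h2⟩ => ?_
    have h3 : (0:ℝ) < n := by exact_mod_cast h2
    exact ((lt_div_iff₀ h3).1 (neg_lt_neg_iff.1 h1)).le
  filter_upwards [hexp, H.ae_exists_tendsto_logExp (half_pos hlam) hexp' hslow] with x hx ⟨χ, hχ⟩
  rw [hχ.neg.limsup_eq]
  rwa [hχ.neg.liminf_eq] at hx
end

section
/- Let X be a compact metric space, f : X → X a Borel measurable map, C ⊆ X a nonempty closed set, and m a Borel measure on X. Suppose there are finitely many f-invariant Borel probability measures μ₁,…,μ_s such that x ↦ log dist(x,C) is μ_i-integrable for each i, and such that for m-almost every point p there exist i ∈ {1,…,s} and n₀ ∈ ℕ for which the point q = f^{n₀}(p) satisfies, for every δ > 0, (1/n) ∑_{j=0}^{n−1} −log dist_δ(f^j(q),C) → ∫ −log dist_δ(·,C) dμ_i as n → ∞. Then f satisfies the slow approximation condition with respect to C and m: for every ε > 0 there exists δ > 0 such that for m-almost every p ∈ X, limsup_{n→∞} (1/n)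 ∑_{j=0}^{n−1} −log dist_δ(f^j(p),C) ≤ ε. -/
open MeasureTheory Filter Metric Set

lemma measurable_truncDist {X : Type*} [MetricSpace X] [MeasurableSpace X] [BorelSpace X]
    (δ : ℝ) (C : Set X) : Measurable (truncDist δ C) :=
  Measurable.ite (measurableSet_le (continuous_infDist_pt C).measurable measurable_const)
    (continuous_infDist_pt C).measurable measurable_const

lemma abs_log_truncDist_le {X : Type*} [MetricSpace X] (δ : ℝ) (C : Set X) (x : X) :
    |Real.log (truncDist δ C x)| ≤ |Real.log (infDist x C)| := by
  unfold truncDist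
  split_ifs <;> simp

/-- Since `Real.log 0 = 0`, this also holds at the points of `C`. -/
lemma eventually_log_truncDist_eq_zero {X : Type*} [MetricSpace X] (C : Set X) (x : X) :
    ∀ᶠ δ in nhdsWithin (0 : ℝ) (Ioi 0), Real.log (truncDist δ C x) = 0 := by
  rcases (infDist_nonneg (x := x) (s := C)).eq_or_lt with h | h
  · refine Eventually.of_forall fun δ => ?_
    unfold truncDist
    rw [← h]
    split_ifs <;> simp
  · filter_upwards [nhdsWithin_le_nhds (Iio_mem_nhds h)] with δ hδ
    simp [truncDist, if_neg (not_le.mpr (mem_Iio.mp hδ))]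

lemma tendsto_integral_neg_log_truncDist {X : Type*} [MetricSpace X] [MeasurableSpace X]
    [BorelSpace X] {C : Set X} {μ : Measure X}
    (hint : Integrable (fun x => Real.log (infDist x C)) μ) :
    Tendsto (fun δ => ∫ x, -Real.log (truncDist δ C x) ∂μ) (nhdsWithin (0 : ℝ) (Ioi 0))
      (nhds 0) := by
  have h := tendsto_integral_filter_of_dominated_convergence (μ := μ)
    (l := nhdsWithin (0 : ℝ) (Ioi 0)) (F := fun δ x => -Real.log (truncDist δ C x))
    (f := fun _ => 0) (fun x => |Real.log (infDist x C)|)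
    (Eventually.of_forall fun δ =>
      (Real.measurable_log.comp (measurable_truncDist δ C)).neg.aestronglyMeasurable)
    (Eventually.of_forall fun δ => ae_of_all _ fun x => by
      simpa using abs_log_truncDist_le δ C x)
    hint.abs
    (ae_of_all _ fun x => tendsto_const_nhds.congr' <| by
      filter_upwards [eventually_log_truncDist_eq_zero C x] with δ hδ
      simp [hδ])
  simpa using h

/-- Limits of Birkhoff averages do not depend on a finite initial piece of the orbit. -/
lemma tendsto_birkhoff_of_tendsto_iterate {X : Type*} {f : X → X} {g : X → ℝ} {p : X} {k : ℕ}
    {L : ℝ} (h : Tendsto (fun n : ℕ =>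
      (n : ℝ)⁻¹ * ∑ j ∈ Finset.range n, g (f^[j] (f^[k] p))) atTop (nhds L)) :
    Tendsto (fun n : ℕ => (n : ℝ)⁻¹ * ∑ j ∈ Finset.range n, g (f^[j] p)) atTop (nhds L) := by
  rw [← tendsto_add_atTop_iff_nat k]
  have hinv : Tendsto (fun n : ℕ => ((n + k : ℕ) : ℝ)⁻¹) atTop (nhds 0) :=
    (tendsto_add_atTop_iff_nat k).2 tendsto_inv_atTop_nhds_zero_nat
  have hratio : Tendsto (fun n : ℕ => 1 - (k : ℝ) * ((n + k : ℕ) : ℝ)⁻¹) atTop (nhds 1) := by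
    simpa using (hinv.const_mul (k : ℝ)).const_sub 1
  have key := (hinv.mul_const (∑ j ∈ Finset.range k, g (f^[j] p))).add (hratio.mul h)
  rw [zero_mul, one_mul, zero_add] at key
  refine key.congr' ?_
  filter_upwards [eventually_gt_atTop 0] with n hn
  have hn' : (n : ℝ) ≠ 0 := by positivity
  have hnk : (n : ℝ) + k ≠ 0 := by positivity
  have hsum : ∑ j ∈ Finset.range (n + k), g (f^[j] p) =
      ∑ j ∈ Finset.range k, g (f^[j] p) + ∑ j ∈ Finset.range n, g (f^[j] (f^[k] p)) := by
    rw [add_comm n k, Finset.sum_range_add]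
    simp only [← Function.iterate_add_apply, add_comm]
  rw [hsum]
  push_cast
  field_simp
  ring

/-- Abstract form of the proof of Proposition 2.2: if `m`-almost every point is eventually
generic (for Birkhoff averages of the truncated log-distance) for one of finitely many
invariant probability measures integrating `log dist(·,C)`, then `f` satisfies the slow
approximation condition with respect to `C` and `m`. -/
theorem slow_approximation_from_generic_points
    {X : Type*} [MetricSpace X] [CompactSpace X] [MeasurableSpace X] [BorelSpace X]
    (f : X → X) (hf : Measurable f)
    (C : Set X) (hCne : C.Nonempty) (hCcl : IsClosed C)
    (m : Measure X)
    (s : ℕ) (μ : Fin s → Measure X)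
    (hprob : ∀ i, IsProbabilityMeasure (μ i))
    (hinv : ∀ i, (μ i).map f = μ i)
    (hint : ∀ i, Integrable (fun x => Real.log (infDist x C)) (μ i))
    (hgen : ∀ᵐ p ∂m, ∃ i : Fin s, ∃ n₀ : ℕ,
      ∀ δ > (0:ℝ), Tendsto (fun n : ℕ =>
          (n : ℝ)⁻¹ * ∑ j ∈ Finset.range n, -Real.log (truncDist δ C (f^[j] (f^[n₀] p))))
        atTop (nhds (∫ x, -Real.log (truncDist δ C x) ∂(μ i)))) :
    ∀ ε > (0:ℝ), ∃ δ > (0:ℝ), ∀ᵐ p ∂m,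
      atTop.limsup (fun n : ℕ =>
        (n : ℝ)⁻¹ * ∑ j ∈ Finset.range n, -Real.log (truncDist δ C (f^[j] p))) ≤ ε := by
  intro ε hε
  have hsmall : ∀ᶠ δ in nhdsWithin (0 : ℝ) (Ioi 0),
      ∀ i, ∫ x, -Real.log (truncDist δ C x) ∂(μ i) < ε :=
    eventually_all.2 fun i =>
      (tendsto_integral_neg_log_truncDist (hint i)).eventually (gt_mem_nhds hε)
  obtain ⟨δ, hδε, hδ⟩ := (hsmall.and self_mem_nhdsWithin).exists
  refine ⟨δ, hδ, ?_⟩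
  filter_upwards [hgen] with p ⟨i, n₀, hp⟩
  rw [(tendsto_birkhoff_of_tendsto_iterate
    (g := fun x => -Real.log (truncDist δ C x)) (hp δ hδ)).limsup_eq]
  exact (hδε i).le
end
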